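/- Let F be the finite field with 16 = 2^4 elements. Consider the set S of all F_2-subspaces C of M_2(F) with dim_{F_2} C = 8 such that every nonzero matrix in C is invertible (i.e. MRD codes in M_2(F_{2^4}) with minimum distance 2). Declare C ~ C' if there exist invertible X, Y ∈ M_2(F) and a field automorphism ρ of F with C' = { X A^ρ Y : A ∈ C }, where A^ρ applies ρ entrywise. Then ~ is an equivalence relation on S and the number of equivalence classes of S under ~ is exactly 757. -/

import Mathlib

/-- `F` is the finite field with `16 = 2⁴` elements. -/
notation "F16" => GaloisField 2 4

/-- The set `S` of all `F₂`-subspaces `C` of `M₂(F)` with `dim_{F₂} C = 8` in which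
every nonzero matrix is invertible (i.e. MRD codes in `M₂(F_{2⁴})` with minimum
distance `2`, equivalently semifield spread sets). -/
def mrdSet : Set (Submodule (ZMod 2) (Matrix (Fin 2) (Fin 2) F16)) :=
  {C | Module.finrank (ZMod 2) C = 8 ∧ ∀ A ∈ C, A ≠ 0 → IsUnit A}

/-- `C ~ C'` iff there are invertible `X, Y ∈ M₂(F)` and a field automorphism `ρ` of
`F` with `C' = { X A^ρ Y : A ∈ C }`, `ρ` applied entrywise. -/
def mrdEquiv (C C' : Submodule (ZMod 2) (Matrix (Fin 2) (Fin 2) F16)) : Prop :=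
  ∃ (X Y : Matrix (Fin 2) (Fin 2) F16) (ρ : F16 ≃+* F16), IsUnit X ∧ IsUnit Y ∧
    (C' : Set (Matrix (Fin 2) (Fin 2) F16)) =
      (fun A => X * A.map ρ * Y) '' (C : Set (Matrix (Fin 2) (Fin 2) F16))

set_option maxRecDepth 100000
set_option exponentiation.threshold 600
namespace MRD

/-! ### Bulk bit-set engine -/

noncomputable def FULL : Nat := Nat.sub (Nat.pow 2 256) 1
/-- flags of the nonzero rows -/
noncomputable def nz (one fo x : Nat) : Nat := Nat.land (Nat.shiftRight (Nat.add x fo) 256) one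
noncomputable def low (one fo x : Nat) : Nat := Nat.land x (Nat.sub x (nz one fo x))
noncomputable def lm (k : Nat) : Nat := Nat.div (Nat.sub (Nat.pow 2 256) 1) (Nat.add (Nat.pow 2 (Nat.pow 2 k)) 1)
noncomputable def mc (k : Nat) : Nat := Nat.shiftLeft (lm k) (Nat.pow 2 k)
noncomputable def mask (one fo oh k : Nat) : Nat :=
  Nat.mul (nz one fo (Nat.land oh (Nat.mul one (mc k)))) (lm k)
noncomputable def cswap (k m x : Nat) : Nat :=
  (fun d => Nat.xor (Nat.xor x d) (Nat.shiftLeft d (Nat.pow 2 k)))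
    (Nat.land (Nat.xor x (Nat.shiftRight x (Nat.pow 2 k))) m)
noncomputable def tr (m : Nat → Nat) (x : Nat) : Nat :=
  cswap 7 (m 7) (cswap 6 (m 6) (cswap 5 (m 5) (cswap 4 (m 4)
    (cswap 3 (m 3) (cswap 2 (m 2) (cswap 1 (m 1) (cswap 0 (m 0) x)))))))
noncomputable def collect (sh one fo : Nat) (fin : Nat → Nat → Nat → Nat) (fuel : Nat) :
    Nat → Nat → Nat → Nat → Nat :=
  Nat.rec (motive := fun _ => Nat → Nat → Nat → Nat → Nat) (fun _ _ _ _ => 0)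
   (fun _ ih cur k rp oh =>
      Bool.rec (motive := fun _ => Nat) ((fun lo => ih lo (Nat.add sh k) (Nat.add (Nat.shiftLeft 1 k) rp)
          (Nat.add (Nat.shiftLeft (Nat.xor cur lo) k) oh))
        (low one fo cur)) (fin k rp oh) (Nat.beq cur 0)) fuel
noncomputable def pr (rp : Nat) (t : Nat → Nat) (va : Nat) (v : Nat) : Nat :=
   Nat.land (Nat.mul rp va) (tr t (Nat.mul rp v))
noncomputable def enter (one rp oh v2 v3 : Nat) (c : Nat → Nat → (Nat → Nat) → Nat → Nat) : Nat :=
  (fun one' => (fun fo' => c one' fo' (mask one' fo' oh)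
    (Nat.land (Nat.mul (nz one' fo' oh) FULL) (pr rp (mask one' fo' oh) v2 v3)))
     (Nat.mul one' FULL)) (Nat.mul rp one)
noncomputable def cntbits (one fo fuel : Nat) : Nat → Nat :=
  Nat.rec (motive := fun _ => Nat → Nat) (fun _ => 0)
   (fun _ ih cur => Bool.rec (motive := fun _ => Nat)
      (Nat.add (Nat.mod (nz one fo cur) (Nat.sub (Nat.pow 2 257) 1))
         (ih (low one fo cur))) 0 (Nat.beq cur 0)) fuel
noncomputable def lev1 (one fo v2 v3 : Nat) (fuel : Nat) : Nat → Nat → Nat :=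
  Nat.rec (motive := fun _ => Nat → Nat → Nat) (fun _ _ => 0)
   (fun _ ih cur acc =>
      Bool.rec (motive := fun _ => Nat)
        ((fun lo => (fun oh => ih lo (Nat.add acc (cntbits one fo 257
            (Nat.land (Nat.mul (nz one fo oh) FULL) (Nat.land v2 (tr (mask one fo oh) v3)))))) 
        (Nat.xor cur lo)) (low one fo cur)) acc (Nat.beq cur 0)) fuel
noncomputable def lev2 (sh one fo v1 v2 v3 v4 v5 v6 v7 : Nat) : Nat :=
  collect sh one fo (fun _ rp oh => enter one rp oh v2 v3 fun one fo t w1 =>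
     lev1 one fo (pr rp t v4 v5) (pr rp t v6 v7) 257 w1 0) 257 v1 0 0 0
noncomputable def lev3 (sh one fo v1 v2 v3 v4 v5 v6 v7 v8 v9 v10 v11 v12 v13 v14 v15 : Nat) : Nat :=
  collect sh one fo (fun sh' rp oh => enter one rp oh v2 v3 fun one fo t w1 =>
     lev2 sh' one fo w1 (pr rp t v4 v5) (pr rp t v6 v7) (pr rp t v8 v9) (pr rp t v10 v11)
       (pr rp t v12 v13) (pr rp t v14 v15)) 257 v1 0 0 0

/-! ### block lemmas -/

theorem testBit_block {w a b : ℕ} (h : b < 2 ^ w) (j : ℕ) :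
    (b + 2 ^ w * a).testBit j = if j < w then b.testBit j else a.testBit (j - w) := by
  rw [add_comm]; exact Nat.testBit_two_pow_mul_add a h j

theorem land_block {w a b a' b' : ℕ} (h : b < 2 ^ w) (h' : b' < 2 ^ w) :
    Nat.land (b + 2 ^ w * a) (b' + 2 ^ w * a') = Nat.land b b' + 2 ^ w * Nat.land a a' := by
  change (b + 2 ^ w * a) &&& (b' + 2 ^ w * a') = (b &&& b') + 2 ^ w * (a &&& a')
  have h2 : b &&& b' < 2 ^ w := Nat.and_lt_two_pow _ h'
  apply Nat.eq_of_testBit_eq; intro j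
  rw [Nat.testBit_and, testBit_block h, testBit_block h', testBit_block h2]
  split_ifs <;> simp

theorem xor_block {w a b a' b' : ℕ} (h : b < 2 ^ w) (h' : b' < 2 ^ w) :
    Nat.xor (b + 2 ^ w * a) (b' + 2 ^ w * a') = Nat.xor b b' + 2 ^ w * Nat.xor a a' := by
  change (b + 2 ^ w * a) ^^^ (b' + 2 ^ w * a') = (b ^^^ b') + 2 ^ w * (a ^^^ a')
  have h2 : b ^^^ b' < 2 ^ w := Nat.xor_lt_two_pow h h'
  apply Nat.eq_of_testBit_eq; intro j
  rw [Nat.testBit_xor, testBit_block h, testBit_block h', testBit_block h2]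
  split_ifs <;> simp

theorem shr_land_block {w s a b a' b' : ℕ} (h : b < 2 ^ w) (hs : s ≤ w) (h' : b' < 2 ^ (w - s)) :
    Nat.land (Nat.shiftRight (b + 2 ^ w * a) s) (b' + 2 ^ w * a') =
      Nat.land (Nat.shiftRight b s) b' + 2 ^ w * Nat.land (Nat.shiftRight a s) a' := by
  change ((b + 2 ^ w * a) >>> s) &&& (b' + 2 ^ w * a') = ((b >>> s) &&& b') + 2 ^ w * ((a >>> s) &&& a')
  have h'' : b' < 2 ^ w := h'.trans_le (Nat.pow_le_pow_right (by norm_num) (by omega))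
  have h2 : (b >>> s) &&& b' < 2 ^ w := Nat.and_lt_two_pow _ h''
  apply Nat.eq_of_testBit_eq; intro j
  rw [Nat.testBit_and, Nat.testBit_shiftRight, testBit_block h, testBit_block h'', testBit_block h2]
  by_cases hj : j < w
  · simp only [hj, if_true, Nat.testBit_and, Nat.testBit_shiftRight]
    by_cases hj2 : s + j < w
    · simp [hj2]
    · have : b'.testBit j = false :=
        Nat.testBit_lt_two_pow (h'.trans_le (Nat.pow_le_pow_right (by norm_num) (by omega)))
      simp [this]
  · have : ¬ (s + j < w) := by omega
    simp only [hj, this, if_false, Nat.testBit_and, Nat.testBit_shiftRight]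
    congr 2; omega

theorem pow256 : Nat.pow 2 256 = 2 ^ 256 := rfl
theorem FULL_lt : FULL < 2 ^ 256 := by decide +kernel

theorem nz_block {b a one' fo' : ℕ} (hb : b < 2 ^ 256) :
    nz (1 + 2 ^ 257 * one') (FULL + 2 ^ 257 * fo') (b + 2 ^ 257 * a) =
      nz 1 FULL b + 2 ^ 257 * nz one' fo' a := by
  unfold nz
  have e : Nat.add (b + 2 ^ 257 * a) (FULL + 2 ^ 257 * fo') =
      Nat.add b FULL + 2 ^ 257 * Nat.add a fo' := by
    simp only [Nat.add_eq]; ring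
  rw [e, shr_land_block _ (by norm_num) (by norm_num)]
  have := FULL_lt
  simp only [Nat.add_eq]
  calc b + FULL < 2 ^ 256 + 2 ^ 256 := by omega
    _ = 2 ^ 257 := by rw [← two_mul, ← pow_succ']

theorem nz_one (b : ℕ) (hb : b < 2 ^ 256) : nz 1 FULL b = if b = 0 then 0 else 1 := by
  have hF : FULL = 2 ^ 256 - 1 := rfl
  unfold nz
  change ((b + FULL) >>> 256) &&& 1 = _
  rw [Nat.shiftRight_eq_div_pow, Nat.and_one_is_mod, hF]
  generalize hX : 2 ^ 256 = X at *
  have hX0 : 0 < X := by rw [← hX]; positivity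
  split_ifs with h
  · subst h; rw [Nat.div_eq_of_lt (by omega)]
  · have : (b + (X - 1)) / X = 1 := by
      rw [Nat.div_eq_iff hX0]; omega
    rw [this]

theorem nz_le (b : ℕ) (hb : b < 2 ^ 256) : nz 1 FULL b ≤ b := by
  rw [nz_one b hb]; split_ifs <;> omega

/-! ### single row facts -/

/-- sum over the bits of `r` below 256 -/
def bs (r : ℕ) (f : ℕ → ℕ) : ℕ := ∑ g ∈ Finset.range 256, if r.testBit g then f g else 0

theorem low_spec (r : ℕ) (hr : r < 2 ^ 256) (h0 : r ≠ 0) :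
    ∃ g, g < 256 ∧ r.testBit g = true ∧ Nat.xor r (low 1 FULL r) = 2 ^ g ∧
      ∀ j, (low 1 FULL r).testBit j = (r.testBit j && decide (j ≠ g)) := by
  obtain ⟨k, m, hm, hk⟩ := Nat.exists_eq_two_pow_mul_odd h0
  obtain ⟨t, rfl⟩ := hm
  have hl : low 1 FULL r = r &&& (r - 1) := by
    unfold low; rw [nz_one r hr, if_neg h0]; rfl
  have hk256 : k < 256 := by
    by_contra hc
    have : 2 ^ 256 ≤ 2 ^ k := Nat.pow_le_pow_right (by norm_num) (by omega)
    have : 2 ^ k ≤ r := by rw [hk]; exact Nat.le_mul_of_pos_right _ (by omega)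
    omega
  have hr1 : r = 0 + 2 ^ k * (2 * t + 1) := by omega
  have hr2 : r - 1 = (2 ^ k - 1) + 2 ^ k * (2 * t) := by
    have : 0 < 2 ^ k := by positivity
    rw [hk, mul_add]; omega
  have hp : 0 < 2 ^ k := by positivity
  have hb : ∀ j, r.testBit j = if j < k then false else (2 * t + 1).testBit (j - k) := by
    intro j; rw [hr1, testBit_block hp]; simp
  have hb' : ∀ j, (r - 1).testBit j = if j < k then true else (2 * t).testBit (j - k) := by
    intro j; rw [hr2, testBit_block (by omega)]
    split_ifs with h
    · simp [Nat.testBit_two_pow_sub_one, h]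
    · rfl
  have hlow : ∀ j, (low 1 FULL r).testBit j = (r.testBit j && decide (j ≠ k)) := by
    intro j
    rw [hl, Nat.testBit_and, hb, hb']
    split_ifs with h
    · simp
    · rcases Nat.eq_or_lt_of_le (not_lt.1 h) with h1 | h1
      · subst h1; simp
      · obtain ⟨i, hi⟩ : ∃ i, j - k = i + 1 := ⟨j - k - 1, by omega⟩
        have : j ≠ k := by omega
        rw [hi, Nat.testBit_succ, Nat.testBit_succ]
        have e1 : (2 * t + 1) / 2 = t := by omega
        have e2 : (2 * t) / 2 = t := by omega
        simp [e1, e2, this]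
  refine ⟨k, hk256, by rw [hb]; simp, ?_, hlow⟩
  change r ^^^ (low 1 FULL r) = 2 ^ k
  apply Nat.eq_of_testBit_eq; intro j
  rw [Nat.testBit_xor, hlow, Nat.testBit_two_pow]
  by_cases hj : k = j
  · subst hj
    have : r.testBit k = true := by rw [hb]; simp
    simp [this]
  · have : j ≠ k := fun h => hj h.symm
    simp [hj, this]

theorem low_zero : low 1 FULL 0 = 0 := by
  change 0 &&& _ = 0
  simp

theorem low_lt (r : ℕ) (hr : r < 2 ^ 256) : low 1 FULL r < 2 ^ 256 :=
  lt_of_le_of_lt (Nat.and_le_left) hr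

theorem bs_low (r : ℕ) (f : ℕ → ℕ) {g : ℕ} (hg : g < 256) (hr : r.testBit g = true)
    (hj : ∀ j, (low 1 FULL r).testBit j = (r.testBit j && decide (j ≠ g))) :
    bs r f = f g + bs (low 1 FULL r) f := by
  unfold bs
  rw [← Finset.add_sum_erase _ _ (Finset.mem_range.2 hg), ← Finset.add_sum_erase (Finset.range 256) (fun i => if (low 1 FULL r).testBit i then f i else 0) (Finset.mem_range.2 hg)]
  simp only [hr, hj, if_true]
  simp only [ne_eq, not_true_eq_false, decide_false, Bool.and_false, Bool.false_eq_true, if_false, zero_add]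
  congr 1
  apply Finset.sum_congr rfl
  intro x hx
  have : x ≠ g := (Finset.mem_erase.1 hx).1
  simp [this]

theorem bs_zero (f : ℕ → ℕ) : bs 0 f = 0 := by simp [bs]


/-! ### vectors of rows -/

def enc : List ℕ → ℕ
  | [] => 0
  | r :: l => r + 2 ^ 257 * enc l

theorem enc_append (A B : List ℕ) : enc (A ++ B) = enc A + 2 ^ (257 * A.length) * enc B := by
  induction A with
  | nil => simp [enc]
  | cons r l ih =>
    simp only [List.cons_append, enc, ih, List.length_cons]
    rw [show 257 * (l.length + 1) = 257 + 257 * l.length by ring, pow_add]; ring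

theorem lt257 {b : ℕ} (h : b < 2 ^ 256) : b < 2 ^ 257 := by
  rw [pow_succ]; omega

section
variable {α : Type} (L : List α)

theorem enc_land (φ ψ : α → ℕ) (hφ : ∀ a, φ a < 2 ^ 256) (hψ : ∀ a, ψ a < 2 ^ 256) :
    Nat.land (enc (L.map φ)) (enc (L.map ψ)) = enc (L.map fun a => Nat.land (φ a) (ψ a)) := by
  induction L with
  | nil => exact Nat.and_zero 0
  | cons a l ih =>
    simp only [List.map_cons, enc]
    rw [land_block (lt257 (hφ a)) (lt257 (hψ a)), ih]

theorem enc_xor (φ ψ : α → ℕ) (hφ : ∀ a, φ a < 2 ^ 256) (hψ : ∀ a, ψ a < 2 ^ 256) :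
    Nat.xor (enc (L.map φ)) (enc (L.map ψ)) = enc (L.map fun a => Nat.xor (φ a) (ψ a)) := by
  induction L with
  | nil => exact Nat.xor_zero 0
  | cons a l ih =>
    simp only [List.map_cons, enc]
    rw [xor_block (lt257 (hφ a)) (lt257 (hψ a)), ih]

theorem enc_mul (φ : α → ℕ) (c : ℕ) :
    Nat.mul (enc (L.map φ)) c = enc (L.map fun a => Nat.mul (φ a) c) := by
  induction L with
  | nil => simp [enc]
  | cons a l ih =>
    simp only [List.map_cons, enc]
    rw [← ih]; simp only [Nat.mul_eq]; ring

theorem enc_nz (φ : α → ℕ) (hφ : ∀ a, φ a < 2 ^ 256) :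
    nz (enc (L.map fun _ => 1)) (enc (L.map fun _ => FULL)) (enc (L.map φ)) =
      enc (L.map fun a => nz 1 FULL (φ a)) := by
  induction L with
  | nil => change Nat.land _ 0 = 0; exact Nat.and_zero _
  | cons a l ih =>
    simp only [List.map_cons, enc]
    rw [nz_block (hφ a), ih]

theorem enc_sub (φ ψ : α → ℕ) (h : ∀ a, ψ a ≤ φ a) :
    Nat.sub (enc (L.map φ)) (enc (L.map ψ)) = enc (L.map fun a => Nat.sub (φ a) (ψ a)) := by
  have key : enc (L.map φ) = enc (L.map ψ) + enc (L.map fun a => Nat.sub (φ a) (ψ a)) := by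
    induction L with
    | nil => rfl
    | cons a l ih =>
      simp only [List.map_cons, enc]
      have e : φ a = ψ a + Nat.sub (φ a) (ψ a) := by
        have := h a; simp only [Nat.sub_eq]; omega
      conv_lhs => rw [ih, e]
      ring
  rw [key]; simp only [Nat.sub_eq]; omega

theorem nz_lt (b : ℕ) : nz 1 FULL b ≤ 1 := by
  unfold nz; exact Nat.and_le_right

theorem enc_low (φ : α → ℕ) (hφ : ∀ a, φ a < 2 ^ 256) :
    low (enc (L.map fun _ => 1)) (enc (L.map fun _ => FULL)) (enc (L.map φ)) =
      enc (L.map fun a => low 1 FULL (φ a)) := by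
  unfold low
  rw [enc_nz L φ hφ, enc_sub L _ _ (fun a => nz_le _ (hφ a)), enc_land L _ _ hφ]
  intro a; exact lt_of_le_of_lt (Nat.sub_le _ _) (hφ a)

theorem mc_lt (k : ℕ) (hk : k < 8) : mc k < 2 ^ 256 := by
  interval_cases k <;> decide +kernel

theorem lm_lt (k : ℕ) (hk : k < 8) : lm k < 2 ^ (256 - 2 ^ k) := by
  interval_cases k <;> decide +kernel

theorem enc_mask (φ : α → ℕ) (hφ : ∀ a, φ a < 2 ^ 256) (k : ℕ) (hk : k < 8) :
    mask (enc (L.map fun _ => 1)) (enc (L.map fun _ => FULL)) (enc (L.map φ)) k =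
      enc (L.map fun a => mask 1 FULL (φ a) k) := by
  unfold mask
  have e : ∀ c, Nat.mul 1 c = c := fun c => Nat.one_mul c
  rw [enc_mul L (fun _ => 1), e]
  rw [enc_land L φ _ hφ (fun _ => mc_lt k hk), enc_nz, enc_mul]
  · intro a; exact lt_of_le_of_lt (Nat.and_le_left) (hφ a)

theorem mask_le (o k : ℕ) : mask 1 FULL o k ≤ lm k := by
  unfold mask
  calc _ ≤ 1 * lm k := Nat.mul_le_mul_right _ (nz_lt _)
    _ = _ := one_mul _

theorem land_xor (x y m : ℕ) : Nat.land (Nat.xor x y) m = Nat.xor (Nat.land x m) (Nat.land y m) :=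
  Nat.and_xor_distrib_right

theorem enc_shr_land (φ ψ : α → ℕ) (s : ℕ) (hs : s ≤ 257) (hφ : ∀ a, φ a < 2 ^ 256)
    (hψ : ∀ a, ψ a < 2 ^ (257 - s)) :
    Nat.land (Nat.shiftRight (enc (L.map φ)) s) (enc (L.map ψ)) =
      enc (L.map fun a => Nat.land (Nat.shiftRight (φ a) s) (ψ a)) := by
  induction L with
  | nil => exact Nat.and_zero _
  | cons a l ih =>
    simp only [List.map_cons, enc]
    rw [shr_land_block (lt257 (hφ a)) hs (hψ a), ih]

theorem cswap_aux {k m x : ℕ} (hk : k < 8) (hm : m ≤ lm k) :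
    Nat.land (Nat.xor x (Nat.shiftRight x (Nat.pow 2 k))) m < 2 ^ (256 - 2 ^ k) :=
  lt_of_le_of_lt (Nat.and_le_right.trans hm) (lm_lt k hk)

theorem pow_le_256 {k : ℕ} (hk : k < 8) : 2 ^ k ≤ 256 := by
  interval_cases k <;> norm_num

theorem cswap_aux2 {k d : ℕ} (hk : k < 8) (hd : d < 2 ^ (256 - 2 ^ k)) :
    Nat.shiftLeft d (Nat.pow 2 k) < 2 ^ 256 := by
  change d <<< (2 ^ k) < _
  have := pow_le_256 hk
  rw [Nat.shiftLeft_eq]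
  calc d * 2 ^ 2 ^ k < 2 ^ (256 - 2 ^ k) * 2 ^ 2 ^ k := Nat.mul_lt_mul_of_pos_right hd (by positivity)
    _ = 2 ^ 256 := by rw [← pow_add]; congr 1; omega

theorem cswap_lt {k m x : ℕ} (hk : k < 8) (hm : m ≤ lm k) (hx : x < 2 ^ 256) :
    cswap k m x < 2 ^ 256 := by
  unfold cswap
  have h1 := @cswap_aux k m x hk hm
  exact Nat.xor_lt_two_pow (Nat.xor_lt_two_pow hx
    (h1.trans_le (Nat.pow_le_pow_right (by norm_num) (Nat.sub_le _ _)))) (cswap_aux2 hk h1)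

theorem enc_cswap (m φ : α → ℕ) (k : ℕ) (hk : k < 8) (hm : ∀ a, m a ≤ lm k)
    (hφ : ∀ a, φ a < 2 ^ 256) :
    cswap k (enc (L.map m)) (enc (L.map φ)) = enc (L.map fun a => cswap k (m a) (φ a)) := by
  have hk2 := pow_le_256 hk
  have hm1 : ∀ a, m a < 2 ^ (256 - 2 ^ k) := fun a => (hm a).trans_lt (lm_lt k hk)
  have hm2 : ∀ a, m a < 2 ^ 256 :=
    fun a => (hm1 a).trans_le (Nat.pow_le_pow_right (by norm_num) (Nat.sub_le _ _))
  have hm3 : ∀ a, m a < 2 ^ (257 - Nat.pow 2 k) :=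
    fun a => (hm1 a).trans_le (Nat.pow_le_pow_right (by norm_num)
      (by change 256 - 2 ^ k ≤ 257 - 2 ^ k; omega))
  have hl : ∀ x a, Nat.land x (m a) < 2 ^ 256 := fun x a => Nat.and_le_right.trans_lt (hm2 a)
  have hs : ∀ d, Nat.shiftLeft d (Nat.pow 2 k) = Nat.mul d (2 ^ 2 ^ k) :=
    fun d => Nat.shiftLeft_eq d (2 ^ k)
  have hd := fun a => @cswap_aux k (m a) (φ a) hk (hm a)
  unfold cswap
  beta_reduce
  rw [land_xor, enc_land L φ m hφ hm2, enc_shr_land L φ m _ (by change 2 ^ k ≤ 257; omega) hφ hm3,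
    enc_xor L _ _ (fun a => hl _ _) (fun a => hl _ _)]
  simp only [← land_xor]
  rw [hs, enc_mul, enc_xor L _ _ hφ (fun a => hl _ _), enc_xor]
  · simp only [hs]
  · exact fun a => Nat.xor_lt_two_pow (hφ a) (hl _ _)
  · intro a; rw [← hs]; exact cswap_aux2 hk (hd a)

theorem tr_lt (m : ℕ → ℕ) (x : ℕ) (hm : ∀ k, k < 8 → m k ≤ lm k) (hx : x < 2 ^ 256) :
    tr m x < 2 ^ 256 := by
  unfold tr
  iterate 8 refine cswap_lt (by norm_num) (hm _ (by norm_num)) ?_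
  exact hx

theorem enc_tr (M : ℕ → ℕ) (m : α → ℕ → ℕ) (φ : α → ℕ)
    (hM : ∀ k, k < 8 → M k = enc (L.map fun a => m a k))
    (hm : ∀ a k, k < 8 → m a k ≤ lm k) (hφ : ∀ a, φ a < 2 ^ 256) :
    tr M (enc (L.map φ)) = enc (L.map fun a => tr (m a) (φ a)) := by
  have step : ∀ k, k < 8 → ∀ ψ : α → ℕ, (∀ a, ψ a < 2 ^ 256) →
      cswap k (M k) (enc (L.map ψ)) = enc (L.map fun a => cswap k (m a k) (ψ a)) := by
    intro k hk ψ hψ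
    rw [hM k hk, enc_cswap L _ _ k hk (fun a => hm a k hk) hψ]
  have lt : ∀ k, k < 8 → ∀ ψ : α → ℕ, (∀ a, ψ a < 2 ^ 256) →
      ∀ a, cswap k (m a k) (ψ a) < 2 ^ 256 :=
    fun k hk ψ hψ a => cswap_lt hk (hm a k hk) (hψ a)
  have h0 := lt 0 (by norm_num) _ hφ
  have h1 := lt 1 (by norm_num) _ h0
  have h2 := lt 2 (by norm_num) _ h1
  have h3 := lt 3 (by norm_num) _ h2
  have h4 := lt 4 (by norm_num) _ h3
  have h5 := lt 5 (by norm_num) _ h4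
  have h6 := lt 6 (by norm_num) _ h5
  unfold tr
  rw [step 0 (by norm_num) _ hφ, step 1 (by norm_num) _ h0, step 2 (by norm_num) _ h1,
    step 3 (by norm_num) _ h2, step 4 (by norm_num) _ h3, step 5 (by norm_num) _ h4,
    step 6 (by norm_num) _ h5, step 7 (by norm_num) _ h6]

theorem enc_eq_zero (φ : α → ℕ) : enc (L.map φ) = 0 ↔ ∀ a ∈ L, φ a = 0 := by
  induction L with
  | nil => simp [enc]
  | cons a l ih =>
    simp only [List.map_cons, enc, List.mem_cons, forall_eq_or_imp, Nat.add_eq_zero_iff,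
      mul_eq_zero, ih]
    simp

end

theorem collect_zero (sh one fo : ℕ) (fin : ℕ → ℕ → ℕ → ℕ) (cur k rp oh : ℕ) :
    collect sh one fo fin 0 cur k rp oh = 0 := rfl

theorem collect_succ (sh one fo : ℕ) (fin : ℕ → ℕ → ℕ → ℕ) (n cur k rp oh : ℕ) :
    collect sh one fo fin (n + 1) cur k rp oh = if cur = 0 then fin k rp oh else
      collect sh one fo fin n (low one fo cur) (sh + k) (2 ^ k + rp)
        (Nat.xor cur (low one fo cur) * 2 ^ k + oh) := by
  have h1 : Nat.shiftLeft 1 k = 2 ^ k := by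
    change 1 <<< k = _; rw [Nat.shiftLeft_eq, one_mul]
  have h2 : Nat.shiftLeft (Nat.xor cur (low one fo cur)) k = Nat.xor cur (low one fo cur) * 2 ^ k :=
    Nat.shiftLeft_eq _ _
  change Bool.rec (motive := fun _ => Nat) (collect sh one fo fin n (low one fo cur) (sh + k)
    (Nat.shiftLeft 1 k + rp)
        (Nat.shiftLeft (Nat.xor cur (low one fo cur)) k + oh)) (fin k rp oh) (Nat.beq cur 0) = _
  rw [h1, h2]
  by_cases h : cur = 0
  · subst h; simp
  · rw [if_neg h]
    have : Nat.beq cur 0 = false := by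
      cases cur with
      | zero => exact absurd rfl h
      | succ n => rfl
    rw [this]

theorem bs_pow {g : ℕ} (hg : g < 256) (f : ℕ → ℕ) : bs (2 ^ g) f = f g := by
  unfold bs
  rw [Finset.sum_eq_single g]
  · simp
  · intro b _ hb; simp [Nat.testBit_two_pow, hb.symm]
  · intro h; exact absurd (Finset.mem_range.2 hg) h

/-- one-hot rows -/
def OneHot (o : ℕ) : Prop := o = 0 ∨ ∃ g, g < 256 ∧ o = 2 ^ g

theorem OneHot.lt {o : ℕ} (h : OneHot o) : o < 2 ^ 256 := by
  rcases h with rfl | ⟨g, hg, rfl⟩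
  · norm_num
  · exact Nat.pow_lt_pow_right (by norm_num) hg

theorem low_step (r : ℕ) (hr : r < 2 ^ 256) :
    OneHot (Nat.xor r (low 1 FULL r)) ∧
    (∀ f, bs r f = bs (Nat.xor r (low 1 FULL r)) f + bs (low 1 FULL r) f) ∧
    (∀ n, bs r (fun _ => 1) < n + 1 + 1 → bs (low 1 FULL r) (fun _ => 1) < n + 1) := by
  by_cases h0 : r = 0
  · subst h0
    have : Nat.xor 0 0 = 0 := Nat.xor_zero 0
    rw [low_zero, this]
    simp [OneHot, bs_zero]
  · obtain ⟨g, hg, h1, h2, h3⟩ := low_spec r hr h0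
    have hb := fun f => bs_low r f hg h1 h3
    rw [h2]
    refine ⟨Or.inr ⟨g, hg, rfl⟩, fun f => by rw [hb f, bs_pow hg], fun n hn => ?_⟩
    rw [hb] at hn; omega

/-- state of a product list -/
structure PState {α : Type} (L : List α) (k rp oh : ℕ) (L' : List ({o : ℕ // OneHot o} × α)) :
    Prop where
  hk : k = 257 * L'.length
  hoh : oh = enc (L'.map fun x => x.1.1)
  hrp : ∀ φ : α → ℕ, Nat.mul rp (enc (L.map φ)) = enc (L'.map fun x => φ x.2)

theorem collect_spec {α : Type} (L : List α) (fin : ℕ → ℕ → ℕ → ℕ) (n : ℕ) :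
    ∀ (cur : α → ℕ) (k rp oh : ℕ) (L' : List ({o : ℕ // OneHot o} × α)),
      (∀ a, cur a < 2 ^ 256) → (∀ a, bs (cur a) (fun _ => 1) < n + 1) → PState L k rp oh L' →
      ∃ (k' rp' oh' : ℕ) (L'' : List ({o : ℕ // OneHot o} × α)), PState L k' rp' oh' L'' ∧
        collect (257 * L.length) (enc (L.map fun _ => 1)) (enc (L.map fun _ => FULL)) fin (n + 1)
          (enc (L.map cur)) k rp oh = fin k' rp' oh' ∧
        L''.length ≤ L'.length + n * L.length ∧
        ∀ F : ℕ → α → ℕ, (L''.map fun x => bs x.1.1 (fun g => F g x.2)).sum =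
          (L'.map fun x => bs x.1.1 (fun g => F g x.2)).sum +
            (L.map fun a => bs (cur a) (fun g => F g a)).sum := by
  have base : ∀ (n : ℕ) (cur : α → ℕ) (k rp oh : ℕ) (L' : List ({o : ℕ // OneHot o} × α)),
      (∀ a, cur a < 2 ^ 256) → enc (L.map cur) = 0 → PState L k rp oh L' →
      ∃ (k' rp' oh' : ℕ) (L'' : List ({o : ℕ // OneHot o} × α)), PState L k' rp' oh' L'' ∧
        collect (257 * L.length) (enc (L.map fun _ => 1)) (enc (L.map fun _ => FULL)) fin (n + 1)
          (enc (L.map cur)) k rp oh = fin k' rp' oh' ∧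
        L''.length ≤ L'.length + n * L.length ∧
        ∀ F : ℕ → α → ℕ, (L''.map fun x => bs x.1.1 (fun g => F g x.2)).sum =
          (L'.map fun x => bs x.1.1 (fun g => F g x.2)).sum +
            (L.map fun a => bs (cur a) (fun g => F g a)).sum := by
    intro n cur k rp oh L' hc h0 hP
    refine ⟨k, rp, oh, L', hP, ?_, by omega, fun F => ?_⟩
    · rw [collect_succ, if_pos h0]
    · have : (L.map fun a => bs (cur a) (fun g => F g a)).sum = 0 := by
        apply List.sum_eq_zero
        intro x hx
        obtain ⟨a, ha, rfl⟩ := List.mem_map.1 hx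
        rw [(enc_eq_zero L cur).1 h0 a ha, bs_zero]
      omega
  induction n with
  | zero =>
    intro cur k rp oh L' hc hb hP
    refine base 0 cur k rp oh L' hc ?_ hP
    rw [enc_eq_zero]
    intro a _
    by_contra h0
    obtain ⟨g, hg, h1, h2, h3⟩ := low_spec _ (hc a) h0
    have := bs_low _ (fun _ => 1) hg h1 h3
    have := hb a
    omega
  | succ n ih =>
    intro cur k rp oh L' hc hb hP
    by_cases h0 : enc (L.map cur) = 0
    · exact base (n + 1) cur k rp oh L' hc h0 hP
    · have hlow := fun a => low_lt _ (hc a)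
      have hst := fun a => low_step _ (hc a)
      let L1 : List ({o : ℕ // OneHot o} × α) :=
        L' ++ L.map (fun a => (⟨Nat.xor (cur a) (low 1 FULL (cur a)), (hst a).1⟩, a))
      have hP1 : PState L (257 * L.length + k) (2 ^ k + rp)
          (enc (L.map fun a => Nat.xor (cur a) (low 1 FULL (cur a))) * 2 ^ k + oh) L1 := by
        refine ⟨?_, ?_, ?_⟩
        · simp only [L1, List.length_append, List.length_map]; rw [hP.hk]; ring
        · simp only [L1, List.map_append, enc_append, List.length_map, List.map_map]
          rw [hP.hoh, hP.hk]
          simp only [Function.comp_def]; ring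
        · intro φ
          have := hP.hrp φ
          simp only [L1, List.map_append, enc_append, List.length_map, List.map_map]
          rw [← this, hP.hk]
          simp only [Nat.mul_eq, Function.comp_def]; ring
      obtain ⟨k', rp', oh', L'', hP', he, hlen, hF⟩ :=
        ih (fun a => low 1 FULL (cur a)) _ _ _ L1 hlow (fun a => (hst a).2.2 n (hb a)) hP1
      refine ⟨k', rp', oh', L'', hP', ?_, ?_, fun F => ?_⟩
      · rw [collect_succ, if_neg h0, enc_low L cur hc, enc_xor L _ _ hc hlow, he]
      · simp only [L1, List.length_append, List.length_map] at hlen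
        rw [Nat.succ_mul]; omega
      · rw [hF F]
        simp only [L1, List.map_append, List.sum_append, List.map_map, Function.comp_def]
        rw [add_assoc, ← List.sum_map_add]
        have e : (fun a => bs (cur a) fun g => F g a) = fun a =>
            bs (Nat.xor (cur a) (low 1 FULL (cur a))) (fun g => F g a) +
              bs (low 1 FULL (cur a)) (fun g => F g a) := by
          funext a; exact (hst a).2.1 _
        rw [e]

end MRD

set_option maxRecDepth 100000
set_option exponentiation.threshold 600
namespace MRD

theorem sum_congr' {α : Type} (L : List α) {f g : α → ℕ} (h : ∀ a ∈ L, f a = g a) :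
    (L.map f).sum = (L.map g).sum := by rw [List.map_congr_left h]

/-! ### translation rows -/

noncomputable def T (g x : ℕ) : ℕ := tr (mask 1 FULL (2 ^ g)) x

theorem mc_bit : ∀ k < 8, ∀ j < 256, (mc k).testBit j = j.testBit k := by decide +kernel
theorem lm_bit : ∀ k < 8, ∀ j < 256, (lm k).testBit j = !j.testBit k := by decide +kernel
theorem idx_bit : ∀ k < 8, ∀ j < 256,
    (j.testBit k = true → 2 ^ k ≤ j ∧ j - 2 ^ k = j ^^^ 2 ^ k ∧ (j - 2 ^ k).testBit k = false) ∧
    (j.testBit k = false → j + 2 ^ k = j ^^^ 2 ^ k ∧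
      (2 ^ k ≤ j → (j - 2 ^ k).testBit k = true)) := by decide +kernel

theorem mask_pow {g k : ℕ} (hg : g < 256) (hk : k < 8) :
    mask 1 FULL (2 ^ g) k = if g.testBit k then lm k else 0 := by
  unfold mask
  have e1 : Nat.mul 1 (mc k) = mc k := Nat.one_mul _
  have e2 : Nat.land (2 ^ g) (mc k) = if g.testBit k then 2 ^ g else 0 := by
    apply Nat.eq_of_testBit_eq; intro j
    change (2 ^ g &&& mc k).testBit j = _
    rw [Nat.testBit_and]
    by_cases hj : g = j
    · subst hj; rw [mc_bit k hk g hg]; cases g.testBit k <;> simp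
    · have : (2 ^ g).testBit j = false := by rw [Nat.testBit_two_pow]; simp [hj]
      split_ifs <;> simp [this]
  rw [e1, e2, nz_one]
  · split_ifs with h1 h2 h2
    · exact absurd h2 (by positivity)
    · exact Nat.one_mul _
    · exact Nat.zero_mul _
    · exact absurd rfl h2
  · split_ifs
    · exact Nat.pow_lt_pow_right (by norm_num) hg
    · positivity

theorem cswap_bit {k x j : ℕ} (hk : k < 8) (hj : j < 256) :
    (cswap k (lm k) x).testBit j = x.testBit (j ^^^ 2 ^ k) := by
  have hb : ∀ i, i < 256 → (Nat.land (Nat.xor x (Nat.shiftRight x (Nat.pow 2 k))) (lm k)).testBit i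
      = ((x.testBit i ^^ x.testBit (2 ^ k + i)) && !i.testBit k) := by
    intro i hi
    change ((x ^^^ (x >>> 2 ^ k)) &&& lm k).testBit i = _
    rw [Nat.testBit_and, Nat.testBit_xor, Nat.testBit_shiftRight, lm_bit k hk i hi]
  unfold cswap
  generalize hd : Nat.land (Nat.xor x (Nat.shiftRight x (Nat.pow 2 k))) (lm k) = d at hb
  change (x ^^^ d ^^^ (d <<< 2 ^ k)).testBit j = _
  rw [Nat.testBit_xor, Nat.testBit_xor, Nat.testBit_shiftLeft, hb j hj]
  obtain ⟨h1, h2⟩ := idx_bit k hk j hj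
  cases hjk : j.testBit k with
  | true =>
    obtain ⟨a1, a2, a3⟩ := h1 hjk
    rw [hb (j - 2 ^ k) ((Nat.sub_le _ _).trans_lt hj), a3, show 2 ^ k + (j - 2 ^ k) = j by omega, ← a2]
    cases x.testBit j <;> cases x.testBit (j - 2 ^ k) <;> simp [a1]
  | false =>
    obtain ⟨a1, a2⟩ := h2 hjk
    rw [← a1, add_comm (2 ^ k) j]
    by_cases h : 2 ^ k ≤ j
    · rw [hb (j - 2 ^ k) ((Nat.sub_le _ _).trans_lt hj), a2 h]; simp
    · simp [h]

theorem cswap_zero (k x : ℕ) : cswap k 0 x = x := by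
  change x ^^^ (_ &&& 0) ^^^ ((_ &&& 0) <<< _) = x
  simp

theorem cswap_bit' {g k x j : ℕ} (hg : g < 256) (hk : k < 8) (hj : j < 256) :
    (cswap k (mask 1 FULL (2 ^ g) k) x).testBit j =
      x.testBit (j ^^^ (if g.testBit k then 2 ^ k else 0)) := by
  rw [mask_pow hg hk]
  split_ifs
  · exact cswap_bit hk hj
  · rw [cswap_zero]; simp

theorem xor_all : ∀ g < 256, (if g.testBit 7 then 2 ^ 7 else 0) ^^^ (if g.testBit 6 then 2 ^ 6 else 0) ^^^
    (if g.testBit 5 then 2 ^ 5 else 0) ^^^ (if g.testBit 4 then 2 ^ 4 else 0) ^^^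
    (if g.testBit 3 then 2 ^ 3 else 0) ^^^ (if g.testBit 2 then 2 ^ 2 else 0) ^^^
    (if g.testBit 1 then 2 ^ 1 else 0) ^^^ (if g.testBit 0 then 2 ^ 0 else 0) = g := by
  decide +kernel

theorem xor_lt_256 {a b : ℕ} (ha : a < 256) (hb : b < 256) : a ^^^ b < 256 :=
  Nat.xor_lt_two_pow (n := 8) ha hb

theorem T_bit {g x j : ℕ} (hg : g < 256) (hj : j < 256) :
    (T g x).testBit j = x.testBit (j ^^^ g) := by
  have hlt : ∀ k, k < 8 → (if g.testBit k then 2 ^ k else 0) < 256 := by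
    intro k hk
    split_ifs
    · exact Nat.pow_lt_pow_right (n := 8) (by norm_num) hk
    · norm_num
  have h7 := xor_lt_256 hj (hlt 7 (by norm_num))
  have h6 := xor_lt_256 h7 (hlt 6 (by norm_num))
  have h5 := xor_lt_256 h6 (hlt 5 (by norm_num))
  have h4 := xor_lt_256 h5 (hlt 4 (by norm_num))
  have h3 := xor_lt_256 h4 (hlt 3 (by norm_num))
  have h2 := xor_lt_256 h3 (hlt 2 (by norm_num))
  have h1 := xor_lt_256 h2 (hlt 1 (by norm_num))
  unfold T tr
  rw [cswap_bit' hg (by norm_num) hj, cswap_bit' hg (by norm_num) h7,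
    cswap_bit' hg (by norm_num) h6, cswap_bit' hg (by norm_num) h5,
    cswap_bit' hg (by norm_num) h4, cswap_bit' hg (by norm_num) h3,
    cswap_bit' hg (by norm_num) h2, cswap_bit' hg (by norm_num) h1]
  congr 1
  conv_rhs => rw [← xor_all g hg]
  simp only [Nat.xor_assoc]

theorem T_lt {g x : ℕ} (hx : x < 2 ^ 256) : T g x < 2 ^ 256 :=
  tr_lt _ _ (fun k _ => mask_le _ k) hx

/-! ### specification of the counters -/

noncomputable def c1 (v1 : ℕ) : ℕ := bs v1 fun _ => 1
noncomputable def c3 (v1 v2 v3 : ℕ) : ℕ := bs v1 fun g => c1 (Nat.land v2 (T g v3))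
noncomputable def c7 (v1 v2 v3 v4 v5 v6 v7 : ℕ) : ℕ := bs v1 fun g =>
  c3 (Nat.land v2 (T g v3)) (Nat.land v4 (T g v5)) (Nat.land v6 (T g v7))
noncomputable def c15 (v1 v2 v3 v4 v5 v6 v7 v8 v9 v10 v11 v12 v13 v14 v15 : ℕ) : ℕ := bs v1 fun g =>
  c7 (Nat.land v2 (T g v3)) (Nat.land v4 (T g v5)) (Nat.land v6 (T g v7)) (Nat.land v8 (T g v9))
    (Nat.land v10 (T g v11)) (Nat.land v12 (T g v13)) (Nat.land v14 (T g v15))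

section
variable {α : Type} (L : List α)

theorem enc_modEq (φ : α → ℕ) : enc (L.map φ) ≡ (L.map φ).sum [MOD 2 ^ 257 - 1] := by
  induction L with
  | nil => rfl
  | cons a l ih =>
    simp only [List.map_cons, enc, List.sum_cons]
    have h : 2 ^ 257 ≡ 1 [MOD 2 ^ 257 - 1] := by
      apply Nat.ModEq.symm
      exact (Nat.modEq_iff_dvd' (by norm_num)).2 dvd_rfl
    simpa using (h.mul ih).add_left (φ a)

theorem enc_mod (φ : α → ℕ) (h1 : ∀ a, φ a ≤ 1) (hL : L.length < 2 ^ 200) :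
    Nat.mod (enc (L.map φ)) (Nat.sub (Nat.pow 2 257) 1) = (L.map φ).sum := by
  have hs : (L.map φ).sum ≤ L.length := by
    have := List.sum_le_card_nsmul (L.map φ) 1 (by
      intro x hx; obtain ⟨a, _, rfl⟩ := List.mem_map.1 hx; exact h1 a)
    simpa using this
  have h2 : (2:ℕ) ^ 200 < 2 ^ 257 - 1 := by norm_num
  have := enc_modEq L φ
  change enc (L.map φ) % (2 ^ 257 - 1) = _
  rw [this, Nat.mod_eq_of_lt (by omega)]

theorem cntbits_spec (n : ℕ) (hL : L.length < 2 ^ 200) : ∀ cur : α → ℕ, (∀ a, cur a < 2 ^ 256) →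
    (∀ a, c1 (cur a) < n + 1) →
    cntbits (enc (L.map fun _ => 1)) (enc (L.map fun _ => FULL)) (n + 1) (enc (L.map cur)) =
      (L.map fun a => c1 (cur a)).sum := by
  have unf : ∀ one fo n cur, cntbits one fo (n + 1) cur = if cur = 0 then 0 else
      (Nat.mod (nz one fo cur) (Nat.sub (Nat.pow 2 257) 1)) + cntbits one fo n (low one fo cur) := by
    intro one fo n cur
    by_cases h : cur = 0
    · subst h; rfl
    · rw [if_neg h]
      cases cur with
      | zero => exact absurd rfl h
      | succ m => rfl
  have base : ∀ cur : α → ℕ, enc (L.map cur) = 0 → (L.map fun a => c1 (cur a)).sum = 0 := by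
    intro cur h0
    apply List.sum_eq_zero
    intro x hx
    obtain ⟨a, ha, rfl⟩ := List.mem_map.1 hx
    rw [(enc_eq_zero L cur).1 h0 a ha]; exact bs_zero _
  induction n with
  | zero =>
    intro cur hc hb
    have h0 : enc (L.map cur) = 0 := by
      rw [enc_eq_zero]
      intro a _
      by_contra h0
      obtain ⟨g, hg, h1, h2, h3⟩ := low_spec _ (hc a) h0
      have := bs_low _ (fun _ => 1) hg h1 h3
      have := hb a
      unfold c1 at this
      omega
    rw [unf, if_pos h0, base _ h0]
  | succ n ih =>
    intro cur hc hb
    rw [unf]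
    split_ifs with h0
    · rw [base _ h0]
    · have hlow := fun a => low_lt _ (hc a)
      have hst := fun a => low_step _ (hc a)
      rw [enc_low L cur hc, enc_nz L cur hc, enc_mod L _ (fun a => nz_lt _) hL,
        ih _ hlow (fun a => (hst a).2.2 n (hb a)), ← List.sum_map_add]
      apply sum_congr'
      intro a _
      by_cases h : cur a = 0
      · rw [h, nz_one 0 (by norm_num), low_zero]; simp [c1, bs_zero]
      · obtain ⟨g, hg, h1, h2, h3⟩ := low_spec _ (hc a) h
        rw [nz_one _ (hc a), if_neg h]
        exact (bs_low _ (fun _ => 1) hg h1 h3).symm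

/-- guarded row -/
noncomputable def gd (o v2 v3 : ℕ) : ℕ :=
  Nat.land (Nat.mul (nz 1 FULL o) FULL) (Nat.land v2 (tr (mask 1 FULL o) v3))

theorem gd_zero (v2 v3 : ℕ) : gd 0 v2 v3 = 0 := by
  unfold gd
  rw [nz_one 0 (by norm_num), if_pos rfl]
  change (0 * FULL) &&& _ = 0
  simp

theorem gd_pow {g v2 v3 : ℕ} (hg : g < 256) (h2 : v2 < 2 ^ 256) :
    gd (2 ^ g) v2 v3 = Nat.land v2 (T g v3) := by
  unfold gd
  rw [nz_one _ (Nat.pow_lt_pow_right (by norm_num) hg), if_neg (by positivity)]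
  have : Nat.land v2 (T g v3) < 2 ^ 256 := Nat.and_le_left.trans_lt h2
  change (1 * (2 ^ 256 - 1)) &&& (Nat.land v2 (T g v3)) = _
  rw [one_mul, Nat.and_comm, Nat.and_two_pow_sub_one_eq_mod, Nat.mod_eq_of_lt this]

theorem gd_bs {o v2 v3 : ℕ} (ho : OneHot o) (h2 : v2 < 2 ^ 256) (H : ℕ → ℕ) (H0 : H 0 = 0) :
    H (gd o v2 v3) = bs o fun g => H (Nat.land v2 (T g v3)) := by
  rcases ho with rfl | ⟨g, hg, rfl⟩
  · rw [gd_zero, H0, bs_zero]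
  · rw [gd_pow hg h2, bs_pow hg]

theorem gd_lt (o : ℕ) {v2 v3 : ℕ} (h2 : v2 < 2 ^ 256) : gd o v2 v3 < 2 ^ 256 :=
  Nat.and_le_right.trans_lt (Nat.and_le_left.trans_lt h2)

theorem c1_lt (v : ℕ) : c1 v < 256 + 1 := by
  unfold c1 bs
  calc _ ≤ ∑ g ∈ Finset.range 256, 1 := Finset.sum_le_sum (fun g _ => by split_ifs <;> simp)
    _ < _ := by simp

theorem enc_gd (o v2 v3 : α → ℕ) (ho : ∀ a, o a < 2 ^ 256) (h2 : ∀ a, v2 a < 2 ^ 256)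
    (h3 : ∀ a, v3 a < 2 ^ 256) :
    Nat.land (Nat.mul (nz (enc (L.map fun _ => 1)) (enc (L.map fun _ => FULL)) (enc (L.map o))) FULL)
      (Nat.land (enc (L.map v2)) (tr (mask (enc (L.map fun _ => 1)) (enc (L.map fun _ => FULL))
        (enc (L.map o))) (enc (L.map v3)))) =
      enc (L.map fun a => gd (o a) (v2 a) (v3 a)) := by
  rw [enc_nz L o ho, enc_mul, enc_tr L _ (fun a => mask 1 FULL (o a)) v3
    (fun k hk => enc_mask L o ho k hk) (fun a k _ => mask_le _ k) h3, enc_land L v2 _ h2,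
    enc_land]
  · rfl
  · intro a
    have := FULL_lt
    calc _ ≤ 1 * FULL := Nat.mul_le_mul_right _ (nz_lt _)
      _ < _ := by omega
  · exact fun a => Nat.and_le_left.trans_lt (h2 a)
  · exact fun a => tr_lt _ _ (fun k _ => mask_le _ k) (h3 a)

theorem lev1_spec (n : ℕ) (hL : L.length < 2 ^ 200) (v2 v3 : α → ℕ)
    (h2 : ∀ a, v2 a < 2 ^ 256) (h3 : ∀ a, v3 a < 2 ^ 256) :
    ∀ (cur : α → ℕ) (acc : ℕ), (∀ a, cur a < 2 ^ 256) →
    (∀ a, c1 (cur a) < n + 1) →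
    lev1 (enc (L.map fun _ => 1)) (enc (L.map fun _ => FULL)) (enc (L.map v2)) (enc (L.map v3))
      (n + 1) (enc (L.map cur)) acc =
      acc + (L.map fun a => c3 (cur a) (v2 a) (v3 a)).sum := by
  have unf : ∀ one fo v2 v3 n cur acc, lev1 one fo v2 v3 (n + 1) cur acc = if cur = 0 then acc else
      lev1 one fo v2 v3 n (low one fo cur) (acc + cntbits one fo 257
            (Nat.land (Nat.mul (nz one fo (Nat.xor cur (low one fo cur))) FULL)
              (Nat.land v2 (tr (mask one fo (Nat.xor cur (low one fo cur))) v3)))) := by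
    intro one fo v2 v3 n cur acc
    by_cases h : cur = 0
    · subst h; rfl
    · rw [if_neg h]
      have hb : Nat.beq cur 0 = false := by
        cases cur with
        | zero => exact absurd rfl h
        | succ m => rfl
      change Bool.rec (motive := fun _ => Nat) (lev1 one fo v2 v3 n (low one fo cur)
        (acc + cntbits one fo 257
            (Nat.land (Nat.mul (nz one fo (Nat.xor cur (low one fo cur))) FULL)
              (Nat.land v2 (tr (mask one fo (Nat.xor cur (low one fo cur))) v3))))) acc
          (Nat.beq cur 0) = _
      rw [hb]
  have base : ∀ cur : α → ℕ, enc (L.map cur) = 0 →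
      (L.map fun a => c3 (cur a) (v2 a) (v3 a)).sum = 0 := by
    intro cur h0
    apply List.sum_eq_zero
    intro x hx
    obtain ⟨a, ha, rfl⟩ := List.mem_map.1 hx
    rw [(enc_eq_zero L cur).1 h0 a ha]; exact bs_zero _
  induction n with
  | zero =>
    intro cur acc hc hb
    have h0 : enc (L.map cur) = 0 := by
      rw [enc_eq_zero]
      intro a _
      by_contra h0
      obtain ⟨g, hg, h1, h2, h3⟩ := low_spec _ (hc a) h0
      have := bs_low _ (fun _ => 1) hg h1 h3
      have := hb a
      unfold c1 at this
      omega
    rw [unf, if_pos h0, base _ h0, add_zero]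
  | succ n ih =>
    intro cur acc hc hb
    rw [unf]
    split_ifs with h0
    · rw [base _ h0, add_zero]
    · have hlow := fun a => low_lt _ (hc a)
      have hst := fun a => low_step _ (hc a)
      rw [enc_low L cur hc, enc_xor L _ _ hc hlow, enc_gd L _ _ _ (fun a => (hst a).1.lt) h2 h3,
        ih _ _ hlow (fun a => (hst a).2.2 n (hb a)),
        cntbits_spec L 256 hL _ (fun a => gd_lt _ (h2 a)) (fun a => c1_lt _),
        add_assoc, ← List.sum_map_add]
      refine congrArg (fun z => acc + z) (sum_congr' L ?_)
      intro a _
      rw [gd_bs (hst a).1 (h2 a) c1 (bs_zero _)]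
      exact ((hst a).2.1 _).symm

theorem enc_pr (k rp oh : ℕ) (L' : List ({o : ℕ // OneHot o} × α)) (hP : PState L k rp oh L')
    (u v : α → ℕ) (hu : ∀ a, u a < 2 ^ 256) (hv : ∀ a, v a < 2 ^ 256) :
    pr rp (mask (enc (L'.map fun _ => 1)) (enc (L'.map fun _ => FULL)) oh) (enc (L.map u))
      (enc (L.map v)) =
      enc (L'.map fun x => Nat.land (u x.2) (tr (mask 1 FULL x.1.1) (v x.2))) := by
  unfold pr
  rw [hP.hrp, hP.hrp, hP.hoh, enc_tr L' _ (fun x => mask 1 FULL x.1.1) (fun x => v x.2)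
    (fun k hk => enc_mask L' _ (fun x => x.1.2.lt) k hk) (fun x k _ => mask_le _ k)
    (fun x => hv _), enc_land]
  · exact fun x => hu _
  · exact fun x => tr_lt _ _ (fun k _ => mask_le _ k) (hv _)

theorem enter_spec (k rp oh : ℕ) (L' : List ({o : ℕ // OneHot o} × α)) (hP : PState L k rp oh L')
    (v2 v3 : α → ℕ) (h2 : ∀ a, v2 a < 2 ^ 256) (h3 : ∀ a, v3 a < 2 ^ 256)
    (c : ℕ → ℕ → (ℕ → ℕ) → ℕ → ℕ) :
    enter (enc (L.map fun _ => 1)) rp oh (enc (L.map v2)) (enc (L.map v3)) c =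
      c (enc (L'.map fun _ => 1)) (enc (L'.map fun _ => FULL))
        (mask (enc (L'.map fun _ => 1)) (enc (L'.map fun _ => FULL)) oh)
        (enc (L'.map fun x => gd x.1.1 (v2 x.2) (v3 x.2))) := by
  unfold enter
  have e1 := hP.hrp (fun _ => 1)
  have e2 : Nat.mul (enc (L'.map fun _ => 1)) FULL = enc (L'.map fun _ => FULL) := by
    rw [enc_mul]; simp only [Nat.mul_eq, one_mul]
  beta_reduce
  rw [e1, e2]
  congr 1
  rw [← enc_gd L' (fun x => x.1.1) (fun x => v2 x.2) (fun x => v3 x.2) (fun x => x.1.2.lt)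
    (fun x => h2 _) (fun x => h3 _)]
  unfold pr
  rw [hP.hrp, hP.hrp, hP.hoh]

theorem PState.nil : PState L 0 0 0 [] := ⟨rfl, rfl, fun φ => Nat.zero_mul _⟩

theorem gl_lt {o u v : ℕ} (hu : u < 2 ^ 256) :
    Nat.land u (tr (mask 1 FULL o) v) < 2 ^ 256 := Nat.and_le_left.trans_lt hu

theorem lev2_spec (hL : L.length < 2 ^ 150) (v1 v2 v3 v4 v5 v6 v7 : α → ℕ)
    (h1 : ∀ a, v1 a < 2 ^ 256) (h2 : ∀ a, v2 a < 2 ^ 256) (h3 : ∀ a, v3 a < 2 ^ 256)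
    (h4 : ∀ a, v4 a < 2 ^ 256) (h5 : ∀ a, v5 a < 2 ^ 256) (h6 : ∀ a, v6 a < 2 ^ 256)
    (h7 : ∀ a, v7 a < 2 ^ 256) :
    lev2 (257 * L.length) (enc (L.map fun _ => 1)) (enc (L.map fun _ => FULL)) (enc (L.map v1))
      (enc (L.map v2)) (enc (L.map v3)) (enc (L.map v4)) (enc (L.map v5)) (enc (L.map v6))
      (enc (L.map v7)) =
      (L.map fun a => c7 (v1 a) (v2 a) (v3 a) (v4 a) (v5 a) (v6 a) (v7 a)).sum := by
  unfold lev2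
  obtain ⟨k, rp, oh, L', hP, he, hlen, hF⟩ := collect_spec L (fun _ rp oh =>
    enter (enc (L.map fun _ => 1)) rp oh (enc (L.map v2)) (enc (L.map v3)) fun one fo t w1 =>
     lev1 one fo (pr rp t (enc (L.map v4)) (enc (L.map v5))) (pr rp t (enc (L.map v6))
      (enc (L.map v7))) 257 w1 0) 256 v1 0 0 0 [] h1 (fun a => c1_lt _) (PState.nil L)
  rw [he, enter_spec L k rp oh L' hP v2 v3 h2 h3, enc_pr L k rp oh L' hP v4 v5 h4 h5,
    enc_pr L k rp oh L' hP v6 v7 h6 h7,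
    lev1_spec L' 256 _ _ _ (fun x => gl_lt (h4 _)) (fun x => gl_lt (h6 _)) _ _
      (fun x => gd_lt _ (h2 _)) (fun x => c1_lt _), zero_add]
  · have := hF (fun g a => c3 (Nat.land (v2 a) (T g (v3 a))) (Nat.land (v4 a) (T g (v5 a)))
      (Nat.land (v6 a) (T g (v7 a))))
    simp only [List.map_nil, List.sum_nil, zero_add] at this
    refine Eq.trans ?_ this
    apply sum_congr'
    rintro ⟨⟨o, ho⟩, a⟩ _
    rcases ho with rfl | ⟨g, hg, rfl⟩
    · simp only [gd_zero, bs_zero]; exact bs_zero _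
    · simp only [gd_pow hg (h2 a), bs_pow hg]; rfl
  · simp at hlen
    have : (2:ℕ) ^ 150 * 256 < 2 ^ 200 := by norm_num
    omega

theorem lev3_spec (hL : L.length < 2 ^ 100) (v1 v2 v3 v4 v5 v6 v7 v8 v9 v10 v11 v12 v13 v14 v15 : α → ℕ)
    (h1 : ∀ a, v1 a < 2 ^ 256) (h2 : ∀ a, v2 a < 2 ^ 256) (h3 : ∀ a, v3 a < 2 ^ 256)
    (h4 : ∀ a, v4 a < 2 ^ 256) (h5 : ∀ a, v5 a < 2 ^ 256) (h6 : ∀ a, v6 a < 2 ^ 256)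
    (h7 : ∀ a, v7 a < 2 ^ 256) (h8 : ∀ a, v8 a < 2 ^ 256) (h9 : ∀ a, v9 a < 2 ^ 256)
    (h10 : ∀ a, v10 a < 2 ^ 256) (h11 : ∀ a, v11 a < 2 ^ 256) (h12 : ∀ a, v12 a < 2 ^ 256)
    (h13 : ∀ a, v13 a < 2 ^ 256) (h14 : ∀ a, v14 a < 2 ^ 256) (h15 : ∀ a, v15 a < 2 ^ 256) :
    lev3 (257 * L.length) (enc (L.map fun _ => 1)) (enc (L.map fun _ => FULL)) (enc (L.map v1))
      (enc (L.map v2)) (enc (L.map v3)) (enc (L.map v4)) (enc (L.map v5)) (enc (L.map v6))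
      (enc (L.map v7)) (enc (L.map v8)) (enc (L.map v9)) (enc (L.map v10)) (enc (L.map v11))
      (enc (L.map v12)) (enc (L.map v13)) (enc (L.map v14)) (enc (L.map v15)) =
      (L.map fun a => c15 (v1 a) (v2 a) (v3 a) (v4 a) (v5 a) (v6 a) (v7 a) (v8 a) (v9 a) (v10 a)
        (v11 a) (v12 a) (v13 a) (v14 a) (v15 a)).sum := by
  unfold lev3
  obtain ⟨k, rp, oh, L', hP, he, hlen, hF⟩ := collect_spec L (fun sh' rp oh =>
    enter (enc (L.map fun _ => 1)) rp oh (enc (L.map v2)) (enc (L.map v3)) fun one fo t w1 =>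
     lev2 sh' one fo w1 (pr rp t (enc (L.map v4)) (enc (L.map v5))) (pr rp t (enc (L.map v6))
      (enc (L.map v7))) (pr rp t (enc (L.map v8)) (enc (L.map v9))) (pr rp t (enc (L.map v10))
      (enc (L.map v11))) (pr rp t (enc (L.map v12)) (enc (L.map v13))) (pr rp t (enc (L.map v14))
      (enc (L.map v15)))) 256 v1 0 0 0 [] h1 (fun a => c1_lt _) (PState.nil L)
  rw [he, enter_spec L k rp oh L' hP v2 v3 h2 h3, enc_pr L k rp oh L' hP v4 v5 h4 h5,
    enc_pr L k rp oh L' hP v6 v7 h6 h7, enc_pr L k rp oh L' hP v8 v9 h8 h9,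
    enc_pr L k rp oh L' hP v10 v11 h10 h11, enc_pr L k rp oh L' hP v12 v13 h12 h13,
    enc_pr L k rp oh L' hP v14 v15 h14 h15, hP.hk,
    lev2_spec L' _ _ _ _ _ _ _ _ (fun x => gd_lt _ (h2 _)) (fun x => gl_lt (h4 _))
      (fun x => gl_lt (h6 _)) (fun x => gl_lt (h8 _)) (fun x => gl_lt (h10 _))
      (fun x => gl_lt (h12 _)) (fun x => gl_lt (h14 _))]
  · have := hF (fun g a => c7 (Nat.land (v2 a) (T g (v3 a))) (Nat.land (v4 a) (T g (v5 a)))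
      (Nat.land (v6 a) (T g (v7 a))) (Nat.land (v8 a) (T g (v9 a))) (Nat.land (v10 a) (T g (v11 a)))
      (Nat.land (v12 a) (T g (v13 a))) (Nat.land (v14 a) (T g (v15 a))))
    simp only [List.map_nil, List.sum_nil, zero_add] at this
    refine Eq.trans ?_ this
    apply sum_congr'
    rintro ⟨⟨o, ho⟩, a⟩ _
    rcases ho with rfl | ⟨g, hg, rfl⟩
    · simp only [gd_zero, bs_zero]; exact bs_zero _
    · simp only [gd_pow hg (h2 a), bs_pow hg]; rfl
  · simp at hlen
    have : (2:ℕ) ^ 100 * 256 < 2 ^ 150 := by norm_num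
    omega

end

/-- the counting engine -/
theorem lev3_eq {v1 v2 v3 v4 v5 v6 v7 v8 v9 v10 v11 v12 v13 v14 v15 : ℕ}
    (h1 : v1 < 2 ^ 256) (h2 : v2 < 2 ^ 256) (h3 : v3 < 2 ^ 256)
    (h4 : v4 < 2 ^ 256) (h5 : v5 < 2 ^ 256) (h6 : v6 < 2 ^ 256)
    (h7 : v7 < 2 ^ 256) (h8 : v8 < 2 ^ 256) (h9 : v9 < 2 ^ 256)
    (h10 : v10 < 2 ^ 256) (h11 : v11 < 2 ^ 256) (h12 : v12 < 2 ^ 256)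
    (h13 : v13 < 2 ^ 256) (h14 : v14 < 2 ^ 256) (h15 : v15 < 2 ^ 256) :
    lev3 257 1 FULL v1 v2 v3 v4 v5 v6 v7 v8 v9 v10 v11 v12 v13 v14 v15 =
      c15 v1 v2 v3 v4 v5 v6 v7 v8 v9 v10 v11 v12 v13 v14 v15 := by
  have := lev3_spec [()] (by norm_num) (fun _ => v1) (fun _ => v2) (fun _ => v3) (fun _ => v4)
    (fun _ => v5) (fun _ => v6) (fun _ => v7) (fun _ => v8) (fun _ => v9) (fun _ => v10)
    (fun _ => v11) (fun _ => v12) (fun _ => v13) (fun _ => v14) (fun _ => v15) (fun _ => h1)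
    (fun _ => h2) (fun _ => h3) (fun _ => h4) (fun _ => h5) (fun _ => h6) (fun _ => h7)
    (fun _ => h8) (fun _ => h9) (fun _ => h10) (fun _ => h11) (fun _ => h12) (fun _ => h13)
    (fun _ => h14) (fun _ => h15)
  simpa only [List.map_cons, List.map_nil, enc, mul_zero, add_zero, List.length_cons,
    List.length_nil, List.sum_cons, List.sum_nil, zero_add, mul_one] using this

end MRD

set_option maxRecDepth 100000
set_option exponentiation.threshold 600
namespace MRD

/-! ### the field with 16 elements, coded by numbers below 16 -/

/-- the packed multiplication table of `F₂[α]/(α⁴+α+1)` -/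
noncomputable def MTAB : ℕ := 116196760129267793630862849262464326346044543732748708940920453221664288556434379745879494961270582141731748813355742142288220638766218855867759359510984593843506004200114943278699875244065120512813025380665946106619127097398772031257643617143689515450995722003729973585221105779229319991106539050771048038400
noncomputable def mt (a b : ℕ) : ℕ :=
  Nat.land (Nat.shiftRight MTAB (Nat.mul 4 (Nat.add (Nat.mul 16 a) b))) 15

theorem mt_lt (a b : ℕ) : mt a b < 16 := lt_of_le_of_lt Nat.and_le_right (by norm_num)

theorem xor_lt16 {a b : ℕ} (ha : a < 16) (hb : b < 16) : a ^^^ b < 16 :=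
  Nat.xor_lt_two_pow (n := 4) ha hb

/-- concrete model -/
structure Q where
  v : Fin 16

noncomputable instance : Zero Q := ⟨⟨0⟩⟩
noncomputable instance : One Q := ⟨⟨1⟩⟩
noncomputable instance : Add Q := ⟨fun a b => ⟨⟨a.v.1 ^^^ b.v.1, xor_lt16 a.v.2 b.v.2⟩⟩⟩
noncomputable instance : Neg Q := ⟨fun a => a⟩
noncomputable instance : Mul Q := ⟨fun a b => ⟨⟨mt a.v.1 b.v.1, mt_lt _ _⟩⟩⟩
/-- inverse by fourteenth power -/
noncomputable def invN (a : ℕ) : ℕ :=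
  (fun a2 => (fun a4 => mt a2 (mt a4 (mt a4 a4))) (mt a2 a2)) (mt a a)
theorem invN_lt (a : ℕ) : invN a < 16 := mt_lt _ _
noncomputable instance : Inv Q := ⟨fun a => ⟨⟨invN a.v.1, invN_lt _⟩⟩⟩

theorem Q.ext' {a b : Q} (h : a.v.1 = b.v.1) : a = b := by
  cases a; cases b; congr; exact Fin.ext h

theorem mt_comm' : ∀ a < 16, ∀ b < 16, mt a b = mt b a := by decide +kernel
theorem mt_assoc' : ∀ a < 16, ∀ b < 16, ∀ c < 16, mt (mt a b) c = mt a (mt b c) := by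
  decide +kernel
theorem mt_add' : ∀ a < 16, ∀ b < 16, ∀ c < 16, mt a (b ^^^ c) = mt a b ^^^ mt a c := by
  decide +kernel
theorem mt_one' : ∀ a < 16, mt 1 a = a := by decide +kernel
theorem mt_zero' : ∀ a < 16, mt 0 a = 0 := by decide +kernel
theorem mt_inv' : ∀ a < 16, a ≠ 0 → mt a (invN a) = 1 := by decide +kernel
theorem inv_zero' : invN 0 = 0 := by decide +kernel

noncomputable instance : CommRing Q where
  add_assoc a b c := Q.ext' (Nat.xor_assoc _ _ _)
  zero_add a := Q.ext' (Nat.zero_xor _)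
  add_zero a := Q.ext' (Nat.xor_zero _)
  add_comm a b := Q.ext' (Nat.xor_comm _ _)
  neg_add_cancel a := Q.ext' (Nat.xor_self _)
  mul_assoc a b c := Q.ext' (mt_assoc' _ a.v.2 _ b.v.2 _ c.v.2)
  mul_comm a b := Q.ext' (mt_comm' _ a.v.2 _ b.v.2)
  one_mul a := Q.ext' (mt_one' _ a.v.2)
  mul_one a := Q.ext' ((mt_comm' _ a.v.2 _ (by decide)).trans (mt_one' _ a.v.2))
  zero_mul a := Q.ext' (mt_zero' _ a.v.2)
  mul_zero a := Q.ext' ((mt_comm' _ a.v.2 _ (by decide)).trans (mt_zero' _ a.v.2))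
  left_distrib a b c := Q.ext' (mt_add' _ a.v.2 _ b.v.2 _ c.v.2)
  right_distrib a b c := Q.ext' (by
    have e1 := mt_comm' _ (xor_lt16 a.v.2 b.v.2) _ c.v.2
    have e2 := mt_comm' _ a.v.2 _ c.v.2
    have e3 := mt_comm' _ b.v.2 _ c.v.2
    change mt (a.v.1 ^^^ b.v.1) c.v.1 = mt a.v.1 c.v.1 ^^^ mt b.v.1 c.v.1
    rw [e1, e2, e3]; exact mt_add' _ c.v.2 _ a.v.2 _ b.v.2)
  nsmul := nsmulRec
  zsmul := zsmulRec
  npow := npowRec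

noncomputable instance : Field Q where
  exists_pair_ne := ⟨0, 1, fun h => by
    have : (0 : ℕ) = 1 := congrArg (fun q : Q => q.v.1) h
    omega⟩
  mul_inv_cancel a ha := Q.ext' (mt_inv' _ a.v.2 (fun h => ha (Q.ext' h)))
  inv_zero := Q.ext' inv_zero'
  nnqsmul := _
  nnqsmul_def := fun _ _ => rfl
  qsmul := _
  qsmul_def := fun _ _ => rfl

def Qequiv : Q ≃ Fin 16 := ⟨fun a => a.v, fun a => ⟨a⟩, fun _ => rfl, fun _ => rfl⟩
noncomputable instance : Fintype Q := Fintype.ofEquiv _ Qequiv.symm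

/-- a coding of the elements of a field by the numbers below 16 -/
class Cod (K : Type) [Field K] where
  c : K → ℕ
  d : ℕ → K
  c_lt : ∀ x, c x < 16
  d_c : ∀ x, d (c x) = x
  c_d : ∀ n, n < 16 → c (d n) = n
  c_add : ∀ x y, c (x + y) = c x ^^^ c y
  c_mul : ∀ x y, c (x * y) = mt (c x) (c y)
  c_one : c 1 = 1

noncomputable instance codGalois : Cod (GaloisField 2 4) := by
  have hc : Nat.card (GaloisField 2 4) = 2 ^ 4 := GaloisField.card 2 4 (by norm_num)
  haveI : Finite (GaloisField 2 4) := Nat.finite_of_card_ne_zero (by rw [hc]; norm_num)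
  haveI : Fintype (GaloisField 2 4) := Fintype.ofFinite _
  have hQ : Fintype.card (GaloisField 2 4) = Fintype.card Q := by
    rw [← Nat.card_eq_fintype_card, hc, Fintype.card_congr Qequiv]; rfl
  exact
    let e : GaloisField 2 4 ≃+* Q := FiniteField.ringEquivOfCardEq hQ
    { c := fun x => (e x).v.1
      d := fun n => e.symm ⟨Fin.ofNat 16 n⟩
      c_lt := fun x => (e x).v.2
      d_c := fun x => by
        apply e.injective; rw [e.apply_symm_apply]
        apply Q.ext'; exact Nat.mod_eq_of_lt (e x).v.2
      c_d := fun n hn => by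
        rw [e.apply_symm_apply]; exact Nat.mod_eq_of_lt hn
      c_add := fun x y => by rw [map_add]; rfl
      c_mul := fun x y => by rw [map_mul]; rfl
      c_one := by rw [map_one]; rfl }

end MRD

set_option maxRecDepth 100000
set_option exponentiation.threshold 600
namespace MRD

/-! ### kernel side of the counting -/

noncomputable def nib (t y : ℕ) : ℕ := Nat.land (Nat.shiftRight t (Nat.mul 4 y)) 15
noncomputable def linN (a y : ℕ) : ℕ :=
  (fun y2 => (fun y4 => Nat.xor (Nat.xor (mt (nib a 0) y) (mt (nib a 1) y2))
    (Nat.xor (mt (nib a 2) y4) (mt (nib a 3) (mt y4 y4)))) (mt y2 y2)) (mt y y)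
/-- sum of `n` terms -/
noncomputable def sumN (f : ℕ → ℕ) (n : ℕ) : ℕ :=
  Nat.rec (motive := fun _ => ℕ) 0 (fun i acc => Nat.add acc (f i)) n
noncomputable def lorN (f : ℕ → ℕ) (n : ℕ) : ℕ :=
  Nat.rec (motive := fun _ => ℕ) 0 (fun i acc => Nat.lor acc (f i)) n
noncomputable def tabN (a : ℕ) : ℕ := lorN (fun y => Nat.shiftLeft (linN a y) (Nat.mul 4 y)) 16
/-- the points `(b, d)` with `b + s d = h` -/
noncomputable def line (s h : ℕ) : ℕ :=
  lorN (fun d => Nat.shiftLeft 1 (Nat.add (Nat.mul 16 d) (Nat.xor h (mt s d)))) 16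
noncomputable def LINES : ℕ :=
  lorN (fun i => Nat.shiftLeft (line (Nat.shiftRight i 4) (Nat.land i 15)) (Nat.mul 256 i)) 256
noncomputable def lineAt (s h : ℕ) : ℕ :=
  Nat.land (Nat.shiftRight LINES (Nat.mul 256 (Nat.add (Nat.mul 16 s) h))) FULL
noncomputable def sx (ta tp x : ℕ) : ℕ :=
  Nat.xor FULL (lorN (fun s => (fun y => lineAt s (Nat.xor (nib ta y) (mt s (nib tp y)))) (mt x s)) 16)
noncomputable def eng (a p : ℕ) : ℕ :=
  (fun ta => (fun tp => lev3 257 1 FULL (sx ta tp 1) (sx ta tp 2) (sx ta tp 3) (sx ta tp 4)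
    (sx ta tp 5) (sx ta tp 6) (sx ta tp 7) (sx ta tp 8) (sx ta tp 9) (sx ta tp 10) (sx ta tp 11)
    (sx ta tp 12) (sx ta tp 13) (sx ta tp 14) (sx ta tp 15)) (tabN p)) (tabN a)
noncomputable def chunk (p base step n : ℕ) : ℕ :=
  sumN (fun t => eng (Nat.add base (Nat.mul step t)) p) n
noncomputable def w18 (p ej ek : ℕ) : ℕ :=
  Nat.add (eng 0 p) (Nat.mul 15 (Nat.add (eng ek p) (chunk p ej ek 16)))

end MRD

set_option maxRecDepth 100000
set_option exponentiation.threshold 600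
namespace MRD

/-! ### lower bound for the engine count -/

theorem card_le_bs {β : Type} [DecidableEq β] (P : ℕ → β → Prop) (v : ℕ) (f : ℕ → ℕ)
    (hf : ∀ g < 256, v.testBit g = true → ∀ Z : Finset β, (∀ y ∈ Z, P g y) → Z.card ≤ f g)
    (Z : Finset (ℕ × β)) (hZ : ∀ z ∈ Z, z.1 < 256 ∧ v.testBit z.1 = true ∧ P z.1 z.2) :
    Z.card ≤ bs v f := by
  have h1 : Z.card = ∑ g ∈ Finset.range 256, (Z.filter (fun z => z.1 = g)).card := by
    apply Finset.card_eq_sum_card_fiberwise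
    intro z hz; simpa using (hZ z hz).1
  rw [h1]; unfold bs
  apply Finset.sum_le_sum
  intro g hg
  have hg' : g < 256 := by simpa using hg
  split_ifs with hv
  · have h2 : ((Z.filter (fun z => z.1 = g)).image Prod.snd).card = (Z.filter (fun z => z.1 = g)).card := by
      apply Finset.card_image_of_injOn
      rintro ⟨a, b⟩ h ⟨a', b'⟩ h' e
      simp only [Finset.coe_filter, Set.mem_ofPred_eq] at h h'
      simp only at e
      rw [e, h.2, h'.2]
    rw [← h2]
    apply hf g hg' hv
    intro y hy
    simp only [Finset.mem_image, Finset.mem_filter] at hy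
    obtain ⟨z, ⟨hz, rfl⟩, rfl⟩ := hy
    exact (hZ z hz).2.2
  · rw [Nat.le_zero, Finset.card_eq_zero, Finset.filter_eq_empty_iff]
    rintro z hz rfl
    exact hv (hZ z hz).2.1

theorem land_T_bit {v w g j : ℕ} (hg : g < 256) (hj : j < 256) :
    (Nat.land v (T g w)).testBit j = (v.testBit j && w.testBit (j ^^^ g)) := by
  change (v &&& T g w).testBit j = _
  rw [Nat.testBit_and, T_bit hg hj]

theorem le_c1 (v : ℕ) (Z : Finset ℕ) (hZ : ∀ z ∈ Z, z < 256 ∧ v.testBit z = true) :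
    Z.card ≤ c1 v := by
  unfold c1 bs
  rw [← Finset.sum_filter, ← Finset.card_eq_sum_ones]
  apply Finset.card_le_card
  intro z hz
  simpa using hZ z hz

theorem le_c3 (v1 v2 v3 : ℕ) (Z : Finset (ℕ × ℕ)) (hZ : ∀ z ∈ Z, z.1 < 256 ∧ z.2 < 256 ∧
    v1.testBit z.1 = true ∧ v2.testBit z.2 = true ∧ v3.testBit (z.2 ^^^ z.1) = true) :
    Z.card ≤ c3 v1 v2 v3 := by
  apply card_le_bs (fun g y => y < 256 ∧ v2.testBit y = true ∧ v3.testBit (y ^^^ g) = true)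
  · intro g hg _ Z hZ
    apply le_c1
    intro z hz
    obtain ⟨h1, h2, h3⟩ := hZ z hz
    refine ⟨h1, ?_⟩
    rw [land_T_bit hg h1, h2, h3]; rfl
  · intro z hz
    obtain ⟨a, b, c, d, e⟩ := hZ z hz
    exact ⟨a, c, b, d, e⟩

theorem le_c7 (v1 v2 v3 v4 v5 v6 v7 : ℕ) (Z : Finset (ℕ × ℕ × ℕ)) (hZ : ∀ z ∈ Z,
    (z.1 < 256 ∧ z.2.1 < 256 ∧ z.2.2 < 256) ∧ v1.testBit z.1 = true ∧ v2.testBit z.2.1 = true ∧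
    v3.testBit (z.2.1 ^^^ z.1) = true ∧ v4.testBit z.2.2 = true ∧
    v5.testBit (z.2.2 ^^^ z.1) = true ∧ v6.testBit (z.2.2 ^^^ z.2.1) = true ∧
    v7.testBit (z.2.2 ^^^ z.2.1 ^^^ z.1) = true) :
    Z.card ≤ c7 v1 v2 v3 v4 v5 v6 v7 := by
  apply card_le_bs (fun g y => (y.1 < 256 ∧ y.2 < 256) ∧ v2.testBit y.1 = true ∧
    v3.testBit (y.1 ^^^ g) = true ∧ v4.testBit y.2 = true ∧
    v5.testBit (y.2 ^^^ g) = true ∧ v6.testBit (y.2 ^^^ y.1) = true ∧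
    v7.testBit (y.2 ^^^ y.1 ^^^ g) = true)
  · intro g hg _ Z hZ
    apply le_c3
    intro z hz
    obtain ⟨⟨h1, h2⟩, a2, a3, a4, a5, a6, a7⟩ := hZ z hz
    have h3 := xor_lt_256 h2 h1
    refine ⟨h1, h2, ?_, ?_, ?_⟩
    · rw [land_T_bit hg h1, a2, a3]; rfl
    · rw [land_T_bit hg h2, a4, a5]; rfl
    · rw [land_T_bit hg h3, a6, a7]; rfl
  · intro z hz
    obtain ⟨⟨a, b, c⟩, d, e⟩ := hZ z hz
    exact ⟨a, d, ⟨b, c⟩, e⟩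

theorem le_c15 (v1 v2 v3 v4 v5 v6 v7 v8 v9 v10 v11 v12 v13 v14 v15 : ℕ)
    (Z : Finset (ℕ × ℕ × ℕ × ℕ)) (hZ : ∀ z ∈ Z,
    (z.1 < 256 ∧ z.2.1 < 256 ∧ z.2.2.1 < 256 ∧ z.2.2.2 < 256) ∧
    v1.testBit z.1 = true ∧ v2.testBit z.2.1 = true ∧
    v3.testBit (z.2.1 ^^^ z.1) = true ∧ v4.testBit z.2.2.1 = true ∧
    v5.testBit (z.2.2.1 ^^^ z.1) = true ∧ v6.testBit (z.2.2.1 ^^^ z.2.1) = true ∧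
    v7.testBit (z.2.2.1 ^^^ z.2.1 ^^^ z.1) = true ∧
    v8.testBit z.2.2.2 = true ∧ v9.testBit (z.2.2.2 ^^^ z.1) = true ∧
    v10.testBit (z.2.2.2 ^^^ z.2.1) = true ∧
    v11.testBit (z.2.2.2 ^^^ z.2.1 ^^^ z.1) = true ∧ v12.testBit (z.2.2.2 ^^^ z.2.2.1) = true ∧
    v13.testBit (z.2.2.2 ^^^ z.2.2.1 ^^^ z.1) = true ∧
    v14.testBit (z.2.2.2 ^^^ z.2.2.1 ^^^ z.2.1) = true ∧
    v15.testBit (z.2.2.2 ^^^ z.2.2.1 ^^^ z.2.1 ^^^ z.1) = true) :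
    Z.card ≤ c15 v1 v2 v3 v4 v5 v6 v7 v8 v9 v10 v11 v12 v13 v14 v15 := by
  apply card_le_bs (fun g z => (z.1 < 256 ∧ z.2.1 < 256 ∧ z.2.2 < 256) ∧
    v2.testBit z.1 = true ∧
    v3.testBit (z.1 ^^^ g) = true ∧ v4.testBit z.2.1 = true ∧
    v5.testBit (z.2.1 ^^^ g) = true ∧ v6.testBit (z.2.1 ^^^ z.1) = true ∧
    v7.testBit (z.2.1 ^^^ z.1 ^^^ g) = true ∧
    v8.testBit z.2.2 = true ∧ v9.testBit (z.2.2 ^^^ g) = true ∧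
    v10.testBit (z.2.2 ^^^ z.1) = true ∧
    v11.testBit (z.2.2 ^^^ z.1 ^^^ g) = true ∧ v12.testBit (z.2.2 ^^^ z.2.1) = true ∧
    v13.testBit (z.2.2 ^^^ z.2.1 ^^^ g) = true ∧
    v14.testBit (z.2.2 ^^^ z.2.1 ^^^ z.1) = true ∧
    v15.testBit (z.2.2 ^^^ z.2.1 ^^^ z.1 ^^^ g) = true)
  · intro g hg _ Z hZ
    apply le_c7
    intro z hz
    obtain ⟨⟨h1, h2, h4⟩, a2, a3, a4, a5, a6, a7, a8, a9, a10, a11, a12, a13, a14, a15⟩ := hZ z hz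
    have h3 := xor_lt_256 h2 h1
    have h5 := xor_lt_256 h4 h1
    have h6 := xor_lt_256 h4 h2
    have h7 := xor_lt_256 h6 h1
    refine ⟨⟨h1, h2, h4⟩, ?_, ?_, ?_, ?_, ?_, ?_, ?_⟩
    · rw [land_T_bit hg h1, a2, a3]; rfl
    · rw [land_T_bit hg h2, a4, a5]; rfl
    · rw [land_T_bit hg h3, a6, a7]; rfl
    · rw [land_T_bit hg h4, a8, a9]; rfl
    · rw [land_T_bit hg h5, a10, a11]; rfl
    · rw [land_T_bit hg h6, a12, a13]; rfl
    · rw [land_T_bit hg h7, a14, a15]; rfl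
  · intro z hz
    obtain ⟨⟨a, b⟩, d, e⟩ := hZ z hz
    exact ⟨a, d, b, e⟩

/-! ### bits of the tables -/

theorem lorN_bit (f : ℕ → ℕ) (n j : ℕ) :
    (lorN f n).testBit j = true ↔ ∃ i < n, (f i).testBit j = true := by
  induction n with
  | zero => simp [lorN]
  | succ n ih =>
    have : lorN f (n + 1) = lorN f n ||| f n := rfl
    rw [this, Nat.testBit_or, Bool.or_eq_true, ih]
    constructor
    · rintro (⟨i, hi, h⟩ | h)
      · exact ⟨i, by omega, h⟩
      · exact ⟨n, by omega, h⟩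
    · rintro ⟨i, hi, h⟩
      rcases Nat.lt_succ_iff_lt_or_eq.1 hi with h' | rfl
      · exact Or.inl ⟨i, h', h⟩
      · exact Or.inr h

theorem sumN_eq (f : ℕ → ℕ) (n : ℕ) : sumN f n = ∑ i ∈ Finset.range n, f i := by
  induction n with
  | zero => rfl
  | succ n ih => rw [Finset.sum_range_succ, ← ih]; rfl

theorem line_bit (s h j : ℕ) :
    (line s h).testBit j = true ↔ ∃ d < 16, j = 16 * d + (h ^^^ mt s d) := by
  unfold line
  rw [lorN_bit]
  apply exists_congr; intro d
  apply and_congr_right; intro _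
  change (1 <<< (16 * d + (h ^^^ mt s d))).testBit j = true ↔ _
  rw [Nat.one_shiftLeft, Nat.testBit_two_pow]
  rw [decide_eq_true_eq, eq_comm]

theorem lineAt_eq : ∀ s < 16, ∀ h < 16, lineAt s h = line s h := by decide +kernel

theorem nib_lt (t y : ℕ) : nib t y < 16 := lt_of_le_of_lt Nat.and_le_right (by norm_num)

theorem linN_lt (a y : ℕ) : linN a y < 16 :=
  xor_lt16 (xor_lt16 (mt_lt _ _) (mt_lt _ _)) (xor_lt16 (mt_lt _ _) (mt_lt _ _))

theorem nib_tabN (a y : ℕ) (hy : y < 16) : nib (tabN a) y = linN a y := by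
  apply Nat.eq_of_testBit_eq
  intro i
  have e15 : (15 : ℕ) = 2 ^ 4 - 1 := rfl
  have e : nib (tabN a) y = (tabN a >>> (4 * y)) &&& (2 ^ 4 - 1) := rfl
  rw [e, Nat.testBit_and, Nat.testBit_two_pow_sub_one, Nat.testBit_shiftRight]
  by_cases hi : i < 4
  · simp only [hi, decide_true, Bool.and_true]
    rw [Bool.eq_iff_iff]
    unfold tabN
    rw [lorN_bit]
    constructor
    · rintro ⟨z, _, hz⟩
      change (linN a z <<< (4 * z)).testBit _ = true at hz
      rw [Nat.testBit_shiftLeft] at hz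
      simp only [Bool.and_eq_true, decide_eq_true_eq] at hz
      have h3 : 4 * y + i - 4 * z < 4 := by
        by_contra hc
        have h4 : (linN a z).testBit (4 * y + i - 4 * z) = false :=
          Nat.testBit_lt_two_pow (lt_of_lt_of_le (linN_lt a z)
            (show 2 ^ 4 ≤ _ from Nat.pow_le_pow_right (by norm_num) (by omega)))
        rw [h4] at hz; simp at hz
      have : z = y := by omega
      subst this
      have h5 : 4 * z + i - 4 * z = i := by omega
      rw [h5] at hz; exact hz.2
    · intro h
      refine ⟨y, hy, ?_⟩
      change (linN a y <<< (4 * y)).testBit _ = true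
      rw [Nat.testBit_shiftLeft]
      have h5 : 4 * y + i - 4 * y = i := by omega
      simp [h5, h]
  · simp only [hi, decide_false, Bool.and_false]
    symm
    exact Nat.testBit_lt_two_pow (lt_of_lt_of_le (linN_lt a y)
            (show 2 ^ 4 ≤ _ from Nat.pow_le_pow_right (by norm_num) (by omega)))

theorem sx_lt (ta tp x : ℕ) : sx ta tp x < 2 ^ 256 := by
  unfold sx
  refine Nat.xor_lt_two_pow FULL_lt ?_
  apply Nat.lt_pow_two_of_testBit
  intro i hi
  rw [Bool.eq_false_iff, Ne, lorN_bit]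
  rintro ⟨s, _, h⟩
  change (_ &&& FULL).testBit i = true at h
  rw [Nat.testBit_and, Bool.and_eq_true] at h
  have : FULL.testBit i = false := Nat.testBit_lt_two_pow (FULL_lt.trans_le
    (Nat.pow_le_pow_right (by norm_num) hi))
  rw [this] at h; exact absurd h.2 (by simp)

theorem sx_bit (a p x b d : ℕ) (hb : b < 16) (hd : d < 16)
    (h : ∀ s < 16, b ≠ linN a (mt x s) ^^^ mt s (linN p (mt x s)) ^^^ mt s d) :
    (sx (tabN a) (tabN p) x).testBit (b + 16 * d) = true := by
  unfold sx
  change (FULL ^^^ _).testBit _ = true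
  rw [Nat.testBit_xor]
  have hF : FULL = 2 ^ 256 - 1 := rfl
  rw [hF, Nat.testBit_two_pow_sub_one]
  have h1 : b + 16 * d < 256 := by omega
  have h2 : (lorN (fun s => (fun y => lineAt s (Nat.xor (nib (tabN a) y) (mt s (nib (tabN p) y)))) (mt x s)) 16).testBit (b + 16 * d) = false := by
    rw [Bool.eq_false_iff, Ne, lorN_bit]
    rintro ⟨s, hs, h'⟩
    simp only [nib_tabN _ _ (mt_lt _ _)] at h'
    have h0 : Nat.xor (linN a (mt x s)) (mt s (linN p (mt x s))) < 16 :=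
      xor_lt16 (linN_lt _ _) (mt_lt _ _)
    rw [lineAt_eq s hs _ h0, line_bit] at h'
    obtain ⟨d', hd', e⟩ := h'
    have h3 : Nat.xor (linN a (mt x s)) (mt s (linN p (mt x s))) ^^^ mt s d' < 16 :=
      xor_lt16 (xor_lt16 (linN_lt _ _) (mt_lt _ _)) (mt_lt _ _)
    have e1 : d = d' := by omega
    subst e1
    have e2 : b = Nat.xor (linN a (mt x s)) (mt s (linN p (mt x s))) ^^^ mt s d := by omega
    exact h s hs e2
  rw [h2]; simp [h1]

end MRD

set_option maxRecDepth 100000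
set_option exponentiation.threshold 600
namespace MRD

/-! ### additive maps of the field -/

section field
variable {K : Type} [Field K] [Cod K]
open Cod

theorem c_inj {x y : K} (h : c x = c y) : x = y := by rw [← d_c x, ← d_c y, h]
theorem c_zero : c (0 : K) = 0 := by
  have h := c_add (0 : K) 0
  rw [add_zero, Nat.xor_self] at h; exact h
theorem add_self (x : K) : x + x = 0 := by
  apply c_inj; rw [c_add, Nat.xor_self, c_zero]
theorem two_zero : (2 : K) = 0 := by rw [← one_add_one_eq_two]; exact add_self 1
instance instChar : CharP K 2 := CharTwo.of_one_ne_zero_of_two_eq_zero one_ne_zero two_zero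
def codE : K ≃ Fin 16 := ⟨fun x => ⟨c x, c_lt x⟩, fun n => d n.1, fun x => d_c x,
  fun n => Fin.ext (c_d _ n.2)⟩
noncomputable instance instFin : Fintype K := Fintype.ofEquiv _ codE.symm
theorem card_K : Fintype.card K = 16 := by rw [Fintype.card_congr codE]; rfl
theorem natcard_K : Nat.card K = 16 := by rw [Nat.card_eq_fintype_card, card_K]
theorem neg_self (x : K) : -x = x := CharTwo.neg_eq x
theorem d_zero : d 0 = (0 : K) := c_inj (by rw [c_d _ (by norm_num), c_zero])
theorem d_one : d 1 = (1 : K) := c_inj (by rw [c_d _ (by norm_num), c_one])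
theorem d_xor {m n : ℕ} (hm : m < 16) (hn : n < 16) : d (m ^^^ n) = (d m + d n : K) :=
  c_inj (by rw [c_add, c_d _ hm, c_d _ hn, c_d _ (xor_lt16 hm hn)])
theorem c_ne_zero {x : K} (h : x ≠ 0) : c x ≠ 0 := fun h' => h (c_inj (h'.trans c_zero.symm))
theorem d_ne_zero {n : ℕ} (h : n < 16) (h0 : n ≠ 0) : d n ≠ (0 : K) := fun h' => h0 (by
  rw [← c_d (K := K) n h, h', c_zero])
theorem sq_add (x y : K) : (x + y) ^ 2 = x ^ 2 + y ^ 2 := CharTwo.add_sq x y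
theorem p4_add (x y : K) : (x + y) ^ 4 = x ^ 4 + y ^ 4 := by
  have h : ∀ z : K, z ^ 4 = (z ^ 2) ^ 2 := fun z => by ring
  rw [h, h, h, sq_add, sq_add]
theorem p8_add (x y : K) : (x + y) ^ 8 = x ^ 8 + y ^ 8 := by
  have h : ∀ z : K, z ^ 8 = (z ^ 4) ^ 2 := fun z => by ring
  rw [h, h, h, p4_add, sq_add]
theorem p16 (x : K) : x ^ 16 = x := by rw [← card_K (K := K)]; exact FiniteField.pow_card x

/-- the linearized polynomial with coefficients `p` -/
def lin (p : Fin 4 → K) : K →+ K where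
  toFun x := p 0 * x + p 1 * x ^ 2 + p 2 * x ^ 4 + p 3 * x ^ 8
  map_zero' := by ring
  map_add' x y := by rw [sq_add, p4_add, p8_add]; ring

theorem lin_apply (p : Fin 4 → K) (x : K) :
    lin p x = p 0 * x + p 1 * x ^ 2 + p 2 * x ^ 4 + p 3 * x ^ 8 := rfl
theorem lin_add (p q : Fin 4 → K) : lin (p + q) = lin p + lin q := by
  ext x; simp only [lin_apply, AddMonoidHom.add_apply, Pi.add_apply]; ring

instance finE : Finite (K →+ K) := DFunLike.finite _

theorem lin_inj : Function.Injective (lin : (Fin 4 → K) → (K →+ K)) := by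
  intro p q h
  let P : Polynomial K := Polynomial.C (p 0 - q 0) * Polynomial.X + Polynomial.C (p 1 - q 1) * Polynomial.X ^ 2
    + Polynomial.C (p 2 - q 2) * Polynomial.X ^ 4 + Polynomial.C (p 3 - q 3) * Polynomial.X ^ 8
  have hd : P.natDegree < Fintype.card K := by
    rw [card_K]
    have : P.natDegree ≤ 8 := by
      simp only [P]; compute_degree
    omega
  have hP : P = 0 := by
    apply Polynomial.eq_zero_of_natDegree_lt_card_of_eval_eq_zero P (f := (id : K → K)) Function.injective_id
    · intro x
      have := DFunLike.congr_fun h x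
      rw [lin_apply, lin_apply] at this
      simp only [P, id, Polynomial.eval_add, Polynomial.eval_mul, Polynomial.eval_C, Polynomial.eval_pow,
        Polynomial.eval_X]
      linear_combination this
    · exact hd
  have hc : ∀ n, P.coeff n = 0 := fun n => by rw [hP]; rfl
  have h1 := hc 1
  have h2 := hc 2
  have h4 := hc 4
  have h8 := hc 8
  simp only [P, Polynomial.coeff_add, Polynomial.coeff_C_mul, Polynomial.coeff_X, Polynomial.coeff_X_pow] at h1 h2 h4 h8
  norm_num at h1 h2 h4 h8
  ext i
  fin_cases i
  · exact sub_eq_zero.1 h1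
  · exact sub_eq_zero.1 h2
  · exact sub_eq_zero.1 h4
  · exact sub_eq_zero.1 h8

theorem bit_split : ∀ n < 16, n = (n &&& 1) ^^^ (n &&& 2) ^^^ (n &&& 4) ^^^ (n &&& 8) ∧
    (n &&& 1 = 0 ∨ n &&& 1 = 1) ∧ (n &&& 2 = 0 ∨ n &&& 2 = 2) ∧ (n &&& 4 = 0 ∨ n &&& 4 = 4) ∧
    (n &&& 8 = 0 ∨ n &&& 8 = 8) := by decide +kernel

theorem hom_ext {V : Type} [AddMonoid V] {f g : K →+ V} (h1 : f (d 1) = g (d 1)) (h2 : f (d 2) = g (d 2))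
    (h4 : f (d 4) = g (d 4)) (h8 : f (d 8) = g (d 8)) : f = g := by
  have h0 : f (d 0) = g (d 0) := by rw [d_zero, map_zero, map_zero]
  ext x
  obtain ⟨e, b1, b2, b4, b8⟩ := bit_split (c x) (c_lt x)
  have l1 : c x &&& 1 < 16 := by omega
  have l2 : c x &&& 2 < 16 := by omega
  have l4 : c x &&& 4 < 16 := by omega
  have l8 : c x &&& 8 < 16 := by omega
  have ex : x = d (c x &&& 1) + d (c x &&& 2) + d (c x &&& 4) + d (c x &&& 8) := by
    rw [← d_xor l1 l2, ← d_xor (xor_lt16 l1 l2) l4, ← d_xor (xor_lt16 (xor_lt16 l1 l2) l4) l8, ← e, d_c]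
  rw [ex]
  simp only [map_add]
  congr 1; congr 1; congr 1
  · rcases b1 with h | h <;> rw [h] <;> assumption
  · rcases b2 with h | h <;> rw [h] <;> assumption
  · rcases b4 with h | h <;> rw [h] <;> assumption
  · rcases b8 with h | h <;> rw [h] <;> assumption

theorem lin_bij : Function.Bijective (lin : (Fin 4 → K) → (K →+ K)) := by
  rw [Nat.bijective_iff_injective_and_card]
  refine ⟨lin_inj, le_antisymm (Nat.card_le_card_of_injective _ lin_inj) ?_⟩
  apply Nat.card_le_card_of_injective
    (fun f : K →+ K => (![f (d 1), f (d 2), f (d 4), f (d 8)] : Fin 4 → K))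
  intro f g h
  exact hom_ext (congrFun h 0) (congrFun h 1) (congrFun h 2) (congrFun h 3)

/-- scalar multiples -/
def scE (a b : K) (f : K →+ K) : K →+ K where
  toFun x := a * f (b * x)
  map_zero' := by rw [mul_zero, map_zero, mul_zero]
  map_add' x y := by rw [mul_add, map_add, mul_add]
theorem scE_apply (a b : K) (f : K →+ K) (x : K) : scE a b f x = a * f (b * x) := rfl

/-! ### the counting function -/

def Good (A P : K →+ K) (q : (K →+ K) × (K →+ K)) : Prop :=
  ∀ u x : K, ¬ (u = 0 ∧ x = 0) → u * P u + x * A u + u * q.1 x + x * q.2 x ≠ 0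

noncomputable def nn (A P : K →+ K) : ℕ := Nat.card {q : (K →+ K) × (K →+ K) // Good A P q}

theorem nn_le {A P A' P' : K →+ K} (Φ : (K →+ K) × (K →+ K) → (K →+ K) × (K →+ K))
    (hi : Function.Injective Φ) (h : ∀ q, Good A' P' q → Good A P (Φ q)) : nn A' P' ≤ nn A P := by
  apply Nat.card_le_card_of_injective
    (fun q : {q : (K →+ K) × (K →+ K) // Good A' P' q} => (⟨Φ q.1, h _ q.2⟩ : {q // Good A P q}))
  intro a b e
  exact Subtype.ext (hi (congrArg Subtype.val e))

theorem nn_id (A P : K →+ K) (t : K) : nn (A + scE t 1 (AddMonoidHom.id K)) P ≤ nn A P := by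
  apply nn_le (fun q => (q.1 + scE t 1 (AddMonoidHom.id K), q.2))
  · intro q r h
    simp only [Prod.mk.injEq, add_left_inj] at h
    exact Prod.ext h.1 h.2
  · intro q h u x hux e
    apply h u x hux
    simp only [AddMonoidHom.add_apply, scE_apply, AddMonoidHom.id_apply] at e ⊢
    linear_combination e

theorem nn_P (A P : K →+ K) (s : K) : nn (A + scE s 1 P) P ≤ nn A P := by
  apply nn_le (fun q => (q.1 + scE 1 s P, q.2 + scE 1 s A + scE s 1 q.1))
  · intro q r h
    simp only [Prod.mk.injEq, add_left_inj] at h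
    have h1 := h.1
    have h2 := h.2
    rw [h1, add_left_inj, add_left_inj] at h2
    exact Prod.ext h1 h2
  · intro q h u x hux e
    have hux' : ¬ (u + s * x = 0 ∧ x = 0) := by
      rintro ⟨h1, rfl⟩; rw [mul_zero, add_zero] at h1; exact hux ⟨h1, rfl⟩
    apply h (u + s * x) x hux'
    simp only [AddMonoidHom.add_apply, scE_apply, map_add, one_mul] at e ⊢
    linear_combination e + (x * s * P u + x * s * P (s * x)) * two_zero (K := K)

theorem nn_mul (A P : K →+ K) (m : K) (hm : m ≠ 0) : nn (scE m 1 A) P ≤ nn A P := by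
  have hm1 : m * m⁻¹ = 1 := mul_inv_cancel₀ hm
  apply nn_le (fun q => (scE 1 m⁻¹ q.1, scE m⁻¹ m⁻¹ q.2))
  · intro q r h
    simp only [Prod.mk.injEq] at h
    refine Prod.ext ?_ ?_
    · ext x
      have := DFunLike.congr_fun h.1 (m * x)
      simpa only [scE_apply, one_mul, ← mul_assoc, inv_mul_cancel₀ hm] using this
    · ext x
      have := DFunLike.congr_fun h.2 (m * x)
      simp only [scE_apply, ← mul_assoc, inv_mul_cancel₀ hm, one_mul] at this
      exact mul_left_cancel₀ (inv_ne_zero hm) this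
  · intro q h u x hux e
    have hux' : ¬ (u = 0 ∧ m⁻¹ * x = 0) := by
      rintro ⟨h1, h2⟩
      exact hux ⟨h1, (mul_eq_zero.1 h2).resolve_left (inv_ne_zero hm)⟩
    apply h u (m⁻¹ * x) hux'
    simp only [scE_apply, one_mul] at e ⊢
    linear_combination e + x * A u * hm1

/-- conjugation by a field automorphism combined with scalars -/
def actE (a b : K) (ρ : K ≃+* K) (f : K →+ K) : K →+ K where
  toFun x := a * ρ (f (ρ.symm (b * x)))
  map_zero' := by rw [mul_zero, map_zero, map_zero, map_zero, mul_zero]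
  map_add' x y := by rw [mul_add, map_add, map_add, map_add, mul_add]
theorem actE_apply (a b : K) (ρ : K ≃+* K) (f : K →+ K) (x : K) :
  actE a b ρ f x = a * ρ (f (ρ.symm (b * x))) := rfl

theorem nn_act (A P : K →+ K) (a b : K) (ρ : K ≃+* K) (ha : a ≠ 0) (hb : b ≠ 0) :
    nn (actE a b ρ A) (actE a b ρ P) ≤ nn A P := by
  have hb1 : b * b⁻¹ = 1 := mul_inv_cancel₀ hb
  have ha1 : a * a⁻¹ = 1 := mul_inv_cancel₀ ha
  let F : (K →+ K) → (K →+ K) := fun f => actE (ρ.symm a⁻¹) (ρ.symm b⁻¹) ρ.symm f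
  have hF : ∀ f x, F f x = ρ.symm (a⁻¹ * f (b⁻¹ * ρ x)) := by
    intro f x; simp [F, actE_apply]
  have hFi : Function.Injective F := by
    intro f g h
    ext x
    have := DFunLike.congr_fun h (ρ.symm (b * x))
    rw [hF, hF] at this
    have h2 := ρ.symm.injective this
    have h3 := mul_left_cancel₀ (inv_ne_zero ha) h2
    simpa only [RingEquiv.apply_symm_apply, ← mul_assoc, inv_mul_cancel₀ hb, one_mul] using h3
  apply nn_le (fun q => (F q.1, F q.2))
  · intro q r h
    simp only [Prod.mk.injEq] at h
    exact Prod.ext (hFi h.1) (hFi h.2)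
  · intro q h u x hux e
    have hux' : ¬ (b⁻¹ * ρ u = 0 ∧ b⁻¹ * ρ x = 0) := by
      rintro ⟨h1, h2⟩
      have h1' := (mul_eq_zero.1 h1).resolve_left (inv_ne_zero hb)
      have h2' := (mul_eq_zero.1 h2).resolve_left (inv_ne_zero hb)
      exact hux ⟨by simpa using h1', by simpa using h2'⟩
    apply h _ _ hux'
    have e' := congrArg ρ e
    simp only [hF, map_add, map_mul, RingEquiv.apply_symm_apply, map_zero] at e'
    have hu : ρ.symm (b * (b⁻¹ * ρ u)) = u := by
      rw [← mul_assoc, hb1, one_mul, RingEquiv.symm_apply_apply]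
    simp only [actE_apply, hu]
    linear_combination a * b⁻¹ * e' - b⁻¹ * (ρ u * q.1 (b⁻¹ * ρ x) + ρ x * q.2 (b⁻¹ * ρ x)) * ha1

theorem nn_sing (A P : K →+ K) (u : K) (hu : u ≠ 0) (h : P u = 0) : nn A P = 0 := by
  unfold nn
  rw [Nat.card_eq_zero]; left
  refine ⟨fun q => q.2 u 0 (fun h => hu h.1) ?_⟩
  rw [h]; simp

/-! ### comparison with the engine -/

noncomputable def code (a : Fin 4 → K) : ℕ := c (a 0) + 16 * c (a 1) + 256 * c (a 2) + 4096 * c (a 3)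

theorem nib_code (a : Fin 4 → K) : nib (code a) 0 = c (a 0) ∧ nib (code a) 1 = c (a 1) ∧
    nib (code a) 2 = c (a 2) ∧ nib (code a) 3 = c (a 3) := by
  have h0 := c_lt (a 0)
  have h1 := c_lt (a 1)
  have h2 := c_lt (a 2)
  have h3 := c_lt (a 3)
  have e : ∀ t y, nib t y = t / 2 ^ (4 * y) % 16 := by
    intro t y
    change (t >>> (4 * y)) &&& (2 ^ 4 - 1) = _
    rw [Nat.and_two_pow_sub_one_eq_mod, Nat.shiftRight_eq_div_pow]
  rw [e, e, e, e]; unfold code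
  norm_num
  omega

theorem c_lin (a : Fin 4 → K) (x : K) : c (lin a x) = linN (code a) (c x) := by
  obtain ⟨e0, e1, e2, e3⟩ := nib_code a
  have h2 : c (x ^ 2) = mt (c x) (c x) := by rw [pow_two, c_mul]
  have h4 : c (x ^ 4) = mt (c (x ^ 2)) (c (x ^ 2)) := by rw [← c_mul]; ring_nf
  have h8 : c (x ^ 8) = mt (c (x ^ 4)) (c (x ^ 4)) := by rw [← c_mul]; ring_nf
  have : linN (code a) (c x) = (mt (nib (code a) 0) (c x) ^^^ mt (nib (code a) 1) (mt (c x) (c x))) ^^^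
    (mt (nib (code a) 2) (mt (mt (c x) (c x)) (mt (c x) (c x))) ^^^ mt (nib (code a) 3)
      (mt (mt (mt (c x) (c x)) (mt (c x) (c x))) (mt (mt (c x) (c x)) (mt (c x) (c x))))) := rfl
  rw [this, e0, e1, e2, e3, ← h2, ← h4, ← h8, lin_apply]
  simp only [c_add, c_mul, Nat.xor_assoc]

theorem pack_xor : ∀ a < 16, ∀ b < 16, ∀ a' < 16, ∀ b' < 16,
    (a + 16 * b) ^^^ (a' + 16 * b') = (a ^^^ a') + 16 * (b ^^^ b') := by
  intro a ha b _ a' ha' b' _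
  have h : ∀ a b : ℕ, a + 16 * b = a + 2 ^ 4 * b := fun _ _ => rfl
  rw [h, h, h]
  exact xor_block (w := 4) ha ha'

noncomputable def gx (q : (K →+ K) × (K →+ K)) (x : K) : ℕ := c (q.2 x) + 16 * c (q.1 x)
theorem gx_lt (q : (K →+ K) × (K →+ K)) (x : K) : gx q x < 256 := by
  have h1 := c_lt (q.2 x)
  have h2 := c_lt (q.1 x)
  unfold gx; omega
theorem gx_add (q : (K →+ K) × (K →+ K)) (x y : K) : gx q (x + y) = gx q x ^^^ gx q y := by
  unfold gx
  rw [pack_xor _ (c_lt _) _ (c_lt _) _ (c_lt _) _ (c_lt _), map_add, map_add, c_add, c_add]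

theorem gx_sx (a p : Fin 4 → K) (q : (K →+ K) × (K →+ K)) (h : Good (lin a) (lin p) q) (x : K)
    (hx : x ≠ 0) : (sx (tabN (code a)) (tabN (code p)) (c x)).testBit (gx q x) = true := by
  apply sx_bit _ _ _ _ _ (c_lt _) (c_lt _)
  intro s hs e
  rw [← c_d (K := K) s hs] at e
  simp only [← c_mul, ← c_lin, ← c_add] at e
  have e' := c_inj e
  apply h (x * d s) x (fun h => hx h.2)
  rw [e']
  linear_combination (x * lin a (x * d s) + x * d s * lin p (x * d s) + x * d s * q.1 x) * two_zero (K := K)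

theorem nn_le_eng (a p : Fin 4 → K) : nn (lin a) (lin p) ≤ eng (code a) (code p) := by
  classical
  have he : eng (code a) (code p) = lev3 257 1 FULL (sx (tabN (code a)) (tabN (code p)) 1)
    (sx (tabN (code a)) (tabN (code p)) 2) (sx (tabN (code a)) (tabN (code p)) 3)
    (sx (tabN (code a)) (tabN (code p)) 4) (sx (tabN (code a)) (tabN (code p)) 5)
    (sx (tabN (code a)) (tabN (code p)) 6) (sx (tabN (code a)) (tabN (code p)) 7)
    (sx (tabN (code a)) (tabN (code p)) 8) (sx (tabN (code a)) (tabN (code p)) 9)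
    (sx (tabN (code a)) (tabN (code p)) 10) (sx (tabN (code a)) (tabN (code p)) 11)
    (sx (tabN (code a)) (tabN (code p)) 12) (sx (tabN (code a)) (tabN (code p)) 13)
    (sx (tabN (code a)) (tabN (code p)) 14) (sx (tabN (code a)) (tabN (code p)) 15) := rfl
  rw [he, lev3_eq (sx_lt _ _ _) (sx_lt _ _ _) (sx_lt _ _ _) (sx_lt _ _ _) (sx_lt _ _ _)
    (sx_lt _ _ _) (sx_lt _ _ _) (sx_lt _ _ _) (sx_lt _ _ _) (sx_lt _ _ _) (sx_lt _ _ _)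
    (sx_lt _ _ _) (sx_lt _ _ _) (sx_lt _ _ _) (sx_lt _ _ _)]
  let φ : {q : (K →+ K) × (K →+ K) // Good (lin a) (lin p) q} → ℕ × ℕ × ℕ × ℕ :=
    fun q => (gx q.1 (d 1), gx q.1 (d 2), gx q.1 (d 4), gx q.1 (d 8))
  have hφ : Function.Injective φ := by
    intro q r h
    have key : ∀ x : K, gx q.1 x = gx r.1 x → q.1.1 x = r.1.1 x ∧ q.1.2 x = r.1.2 x := by
      intro x hx
      have a1 := c_lt (q.1.2 x)
      have a2 := c_lt (r.1.2 x)
      unfold gx at hx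
      exact ⟨c_inj (by omega), c_inj (by omega)⟩
    simp only [φ, Prod.mk.injEq] at h
    obtain ⟨h1, h2, h4, h8⟩ := h
    apply Subtype.ext
    refine Prod.ext ?_ ?_
    · exact hom_ext (key _ h1).1 (key _ h2).1 (key _ h4).1 (key _ h8).1
    · exact hom_ext (key _ h1).2 (key _ h2).2 (key _ h4).2 (key _ h8).2
  haveI : Fintype {q : (K →+ K) × (K →+ K) // Good (lin a) (lin p) q} := Fintype.ofFinite _
  unfold nn
  rw [Nat.card_eq_fintype_card, ← Finset.card_univ, ← Finset.card_image_of_injective _ hφ]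
  apply le_c15
  intro z hz
  simp only [Finset.mem_image, Finset.mem_univ, true_and] at hz
  obtain ⟨⟨q, hq⟩, rfl⟩ := hz
  have key : ∀ n < 16, n ≠ 0 → (sx (tabN (code a)) (tabN (code p)) n).testBit (gx q (d n)) = true := by
    intro n hn h0
    have := gx_sx a p q hq (d n) (d_ne_zero hn h0)
    rwa [c_d n hn] at this
  have gd : ∀ m < 16, ∀ n < 16, gx q (d m) ^^^ gx q (d n) = gx q (d (m ^^^ n)) := by
    intro m hm n hn
    rw [d_xor hm hn, gx_add]
  refine ⟨⟨gx_lt _ _, gx_lt _ _, gx_lt _ _, gx_lt _ _⟩, ?_⟩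
  simp only [φ]
  rw [gd 2 (by norm_num) 1 (by norm_num), gd 4 (by norm_num) 1 (by norm_num),
    gd 4 (by norm_num) 2 (by norm_num), gd 8 (by norm_num) 1 (by norm_num),
    gd 8 (by norm_num) 2 (by norm_num), gd 8 (by norm_num) 4 (by norm_num)]
  rw [gd (4 ^^^ 2) (by decide) 1 (by norm_num), gd (8 ^^^ 2) (by decide) 1 (by norm_num),
    gd (8 ^^^ 4) (by decide) 1 (by norm_num), gd (8 ^^^ 4) (by decide) 2 (by norm_num),
    gd (8 ^^^ 4 ^^^ 2) (by decide) 1 (by norm_num)]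
  refine ⟨?_, ?_, ?_, ?_, ?_, ?_, ?_, ?_, ?_, ?_, ?_, ?_, ?_, ?_, ?_⟩ <;>
    exact key _ (by decide) (by decide)

end field
end MRD

set_option maxRecDepth 100000
set_option exponentiation.threshold 600
namespace MRD

theorem sum_le_of_surj {α β : Type} [Fintype α] [Fintype β] (F : β → ℕ) (g : α → β)
    (hg : Function.Surjective g) : ∑ b, F b ≤ ∑ a, F (g a) := by
  classical
  have h := Finset.sum_fiberwise (s := (Finset.univ : Finset α)) (g := g) (f := fun a => F (g a))
  rw [← h]
  apply Finset.sum_le_sum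
  intro b _
  obtain ⟨a, rfl⟩ := hg b
  exact Finset.single_le_sum (f := fun a => F (g a)) (fun _ _ => Nat.zero_le _) (by simp)

theorem fin4_cases : ∀ i j k : Fin 4, i ≠ 0 → i ≠ j → i ≠ k → j ≠ k → j ≠ 0 → k ≠ 0 →
    ∀ l : Fin 4, l = 0 ∨ l = i ∨ l = j ∨ l = k := by
  intro i j k h1 h2 h3 h4 h5 h6 l; omega

section field
variable {K : Type} [Field K] [Cod K]
open Cod

noncomputable def MM (p : Fin 4 → K) : ℕ := ∑ a : Fin 4 → K, nn (lin a) (lin p)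

/-- action on coefficients -/
def actV (a b : K) (ρ : K ≃+* K) (p : Fin 4 → K) : Fin 4 → K := fun i => a * ρ (p i) * b ^ (2 ^ (i : ℕ))

theorem lin_actV (a b : K) (ρ : K ≃+* K) (p : Fin 4 → K) :
    lin (actV a b ρ p) = actE a b ρ (lin p) := by
  ext x
  rw [actE_apply, lin_apply, lin_apply]
  simp only [map_add, map_mul, map_pow, RingEquiv.apply_symm_apply, actV]
  norm_num
  ring

theorem MM_act (a b : K) (ρ : K ≃+* K) (ha : a ≠ 0) (hb : b ≠ 0) (p : Fin 4 → K) :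
    MM (actV a b ρ p) ≤ MM p := by
  unfold MM
  have hinj : Function.Injective (actV a b ρ) := by
    intro p q h
    ext i
    have h1 := congrFun h i
    simp only [actV] at h1
    have h2 := mul_right_cancel₀ (pow_ne_zero _ hb) h1
    exact ρ.injective (mul_left_cancel₀ ha h2)
  refine (sum_le_of_surj _ _ (Finite.surjective_of_injective hinj)).trans ?_
  apply Finset.sum_le_sum
  intro q _
  rw [lin_actV, lin_actV]
  exact nn_act _ _ a b ρ ha hb

theorem lin_single0 (t : K) : lin (Pi.single 0 t) = scE t 1 (AddMonoidHom.id K) := by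
  ext x; rw [lin_apply, scE_apply]; simp
theorem lin_smul (s : K) (p : Fin 4 → K) : lin (s • p) = scE s 1 (lin p) := by
  ext x; rw [scE_apply, lin_apply, lin_apply]; simp; ring

theorem nn_shift (t s : K) (w p : Fin 4 → K) :
    nn (lin (w + s • p + Pi.single 0 t)) (lin p) ≤ nn (lin w) (lin p) := by
  rw [lin_add, lin_add, lin_single0, lin_smul]
  exact (nn_id _ _ _).trans (nn_P _ _ _)

theorem nn_smul (m : K) (hm : m ≠ 0) (w p : Fin 4 → K) :
    nn (lin (m • w)) (lin p) ≤ nn (lin w) (lin p) := by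
  rw [lin_smul]; exact nn_mul _ _ m hm

theorem sum_scale (F : K → K → ℕ) (h0 : ∀ m ≠ 0, F 0 m ≤ F 0 1)
    (h1 : ∀ m ≠ 0, ∀ t, F m (m * t) ≤ F 1 t) :
    ∑ x, ∑ y, F x y ≤ F 0 0 + 15 * (F 0 1 + ∑ t, F 1 t) := by
  classical
  have hcard : (Finset.univ.erase (0 : K)).card = 15 := by
    rw [Finset.card_erase_of_mem (Finset.mem_univ _), Finset.card_univ, card_K]
  rw [← Finset.add_sum_erase _ _ (Finset.mem_univ (0 : K))]
  have a : ∑ y, F 0 y ≤ F 0 0 + 15 * F 0 1 := by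
    rw [← Finset.add_sum_erase _ _ (Finset.mem_univ (0 : K))]
    apply Nat.add_le_add_left
    rw [← hcard, ← smul_eq_mul]
    apply Finset.sum_le_card_nsmul
    intro m hm
    exact h0 m (Finset.ne_of_mem_erase hm)
  have b : ∑ x ∈ Finset.univ.erase 0, ∑ y, F x y ≤ 15 * ∑ t, F 1 t := by
    rw [← hcard, ← smul_eq_mul]
    apply Finset.sum_le_card_nsmul
    intro m hm
    have hm := Finset.ne_of_mem_erase hm
    have : ∑ y, F m y = ∑ t, F m (m * t) := by
      rw [← Equiv.sum_comp (Equiv.mulLeft₀ m hm)]; rfl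
    rw [this]
    exact Finset.sum_le_sum fun t _ => h1 m hm t
  omega

theorem sum_K (f : ℕ → ℕ) : ∑ t : K, f (c t) = ∑ i ∈ Finset.range 16, f i := by
  rw [← Fin.sum_univ_eq_sum_range, ← Equiv.sum_comp (codE (K := K))]; rfl

theorem MM_pivot (p : Fin 4 → K) (i j k : Fin 4) (hi : p i ≠ 0) (hi0 : i ≠ 0) (hij : i ≠ j) (hik : i ≠ k)
    (hjk : j ≠ k) (hj0 : j ≠ 0) (hk0 : k ≠ 0) (ej ek : ℕ)
    (hj : ∀ t : K, code (Pi.single j 1 + Pi.single k t : Fin 4 → K) = ej + ek * c t)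
    (hk : code (Pi.single k 1 : Fin 4 → K) = ek) :
    MM p ≤ 256 * (eng 0 (code p) + 15 * (eng ek (code p) +
      ∑ t ∈ Finset.range 16, eng (ej + ek * t) (code p))) := by
  unfold MM
  let Ψ : K × K × K × K → (Fin 4 → K) := fun z =>
    (Pi.single j z.2.2.1 + Pi.single k z.2.2.2) + z.2.1 • p + Pi.single 0 z.1
  have hsurj : Function.Surjective Ψ := by
    intro a
    let s := a i * (p i)⁻¹
    refine ⟨(a 0 - s * p 0, s, a j - s * p j, a k - s * p k), ?_⟩
    have hcases := fin4_cases i j k hi0 hij hik hjk hj0 hk0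
    ext l
    rcases hcases l with rfl | rfl | rfl | rfl
    · simp [Ψ, Pi.single_apply, hj0.symm, hk0.symm]
    · simp [Ψ, Pi.single_apply, hij, hik, hi0, s, hi]
    · simp [Ψ, Pi.single_apply, hjk, hj0]
    · simp [Ψ, Pi.single_apply, hjk.symm, hk0]
  refine (sum_le_of_surj _ Ψ hsurj).trans ?_
  let G : K → K → ℕ := fun x y => nn (lin (Pi.single j x + Pi.single k y)) (lin p)
  have h1 : ∑ z : K × K × K × K, nn (lin (Ψ z)) (lin p) ≤ ∑ z : K × K × K × K, G z.2.2.1 z.2.2.2 :=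
    Finset.sum_le_sum fun z _ => nn_shift _ _ _ _
  refine h1.trans ?_
  have h2 : ∑ z : K × K × K × K, G z.2.2.1 z.2.2.2 = 256 * ∑ x, ∑ y, G x y := by
    rw [Fintype.sum_prod_type]
    simp only [Fintype.sum_prod_type, Finset.sum_const, Finset.card_univ, card_K, smul_eq_mul]
    ring
  rw [h2]
  apply Nat.mul_le_mul_left
  refine (sum_scale G ?_ ?_).trans ?_
  · intro m hm
    have := nn_smul m hm (Pi.single j 0 + Pi.single k 1) p
    rwa [smul_add, ← Pi.single_smul, ← Pi.single_smul, smul_zero, smul_eq_mul, mul_one] at this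
  · intro m hm t
    have := nn_smul m hm (Pi.single j 1 + Pi.single k t) p
    rwa [smul_add, ← Pi.single_smul, ← Pi.single_smul, smul_eq_mul, smul_eq_mul, mul_one] at this
  · have e0 : code (0 : Fin 4 → K) = 0 := by simp [code, c_zero]
    have g0 : G 0 0 ≤ eng 0 (code p) := by
      have := nn_le_eng (0 : Fin 4 → K) p
      rw [e0] at this
      simpa [G] using this
    have g1 : G 0 1 ≤ eng ek (code p) := by
      have := nn_le_eng (Pi.single k 1 : Fin 4 → K) p
      rw [hk] at this
      simpa [G] using this
    have g2 : ∑ t, G 1 t ≤ ∑ t ∈ Finset.range 16, eng (ej + ek * t) (code p) := by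
      rw [← sum_K (K := K) (fun t => eng (ej + ek * t) (code p))]
      apply Finset.sum_le_sum
      intro t _
      rw [← hj]
      exact nn_le_eng _ _
    gcongr

theorem MM_id : MM (Pi.single 0 1 : Fin 4 → K) ≤ 16 * ((eng 0 1 + 15 * (eng 4096 1 +
      ∑ t ∈ Finset.range 16, eng (256 + 4096 * t) 1)) + 15 *
        ∑ s ∈ Finset.range 16, ∑ t ∈ Finset.range 16, eng (16 + 256 * s + 4096 * t) 1) := by
  classical
  unfold MM
  set p : Fin 4 → K := Pi.single 0 1 with hp
  have hcp : code p = 1 := by simp [code, hp, c_zero, c_one]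
  let Ψ : K × K × K × K → (Fin 4 → K) := fun z =>
    (![0, z.2.1, z.2.2.1, z.2.2.2]) + (0 : K) • p + Pi.single 0 z.1
  have hsurj : Function.Surjective Ψ := by
    intro a
    refine ⟨(a 0, a 1, a 2, a 3), ?_⟩
    ext l
    fin_cases l <;> simp [Ψ, Pi.single_apply, Matrix.vecHead, Matrix.vecTail]
  refine (sum_le_of_surj _ Ψ hsurj).trans ?_
  let G : K → K → K → ℕ := fun x y z => nn (lin ![0, x, y, z]) (lin p)
  have hsc : ∀ m ≠ 0, ∀ x y z, G (m * x) (m * y) (m * z) ≤ G x y z := by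
    intro m hm x y z
    have := nn_smul m hm ![0, x, y, z] p
    simpa [G, Matrix.smul_cons] using this
  have h1 : ∑ z : K × K × K × K, nn (lin (Ψ z)) (lin p) ≤
      ∑ z : K × K × K × K, G z.2.1 z.2.2.1 z.2.2.2 :=
    Finset.sum_le_sum fun z _ => nn_shift _ _ _ _
  refine h1.trans ?_
  have h2 : ∑ z : K × K × K × K, G z.2.1 z.2.2.1 z.2.2.2 = 16 * ∑ x, ∑ y, ∑ z, G x y z := by
    rw [Fintype.sum_prod_type]
    simp only [Fintype.sum_prod_type, Finset.sum_const, Finset.card_univ, card_K, smul_eq_mul]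
  rw [h2]
  apply Nat.mul_le_mul_left
  have hG : ∀ x y z, G x y z ≤ eng (16 * c x + 256 * c y + 4096 * c z) 1 := by
    intro x y z
    have := nn_le_eng ![0, x, y, z] p
    rw [hcp] at this
    simpa [G, code, c_zero] using this
  have hcard : (Finset.univ.erase (0 : K)).card = 15 := by
    rw [Finset.card_erase_of_mem (Finset.mem_univ _), Finset.card_univ, card_K]
  rw [← Finset.add_sum_erase _ _ (Finset.mem_univ (0 : K))]
  apply Nat.add_le_add
  · refine (sum_scale (G 0) ?_ ?_).trans ?_
    · intro m hm
      have := hsc m hm 0 0 1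
      simpa using this
    · intro m hm t
      have := hsc m hm 0 1 t
      simpa using this
    · have g0 := hG 0 0 0
      have g1 := hG 0 0 1
      simp only [c_zero, c_one] at g0 g1
      have g2 : ∑ t, G 0 1 t ≤ ∑ t ∈ Finset.range 16, eng (256 + 4096 * t) 1 := by
        rw [← sum_K (K := K) (fun t => eng (256 + 4096 * t) 1)]
        apply Finset.sum_le_sum
        intro t _
        have := hG 0 1 t
        simpa [c_zero, c_one] using this
      gcongr <;> assumption
  · rw [← hcard, ← smul_eq_mul]
    apply Finset.sum_le_card_nsmul
    intro m hm
    have hm := Finset.ne_of_mem_erase hm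
    have e1 : ∑ y, ∑ z, G m y z = ∑ y, ∑ z, G m (m * y) (m * z) := by
      rw [← Equiv.sum_comp (Equiv.mulLeft₀ m hm)]
      apply Finset.sum_congr rfl
      intro y _
      rw [← Equiv.sum_comp (Equiv.mulLeft₀ m hm)]; rfl
    rw [e1, ← sum_K (K := K) (fun s => ∑ t ∈ Finset.range 16, eng (16 + 256 * s + 4096 * t) 1)]
    apply Finset.sum_le_sum
    intro y _
    rw [← sum_K (K := K) (fun t => eng (16 + 256 * c y + 4096 * t) 1)]
    apply Finset.sum_le_sum
    intro z _
    have a := hsc m hm 1 y z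
    have b := hG 1 y z
    rw [c_one] at b
    rw [mul_one] at a
    exact a.trans b

end field
end MRD

set_option maxRecDepth 100000
set_option exponentiation.threshold 600
namespace MRD

/-! ### the maps `P` up to scaling and automorphisms -/

noncomputable def T15 : List ℕ := [1, 2, 3, 4, 5, 6, 7, 8, 9, 10, 11, 12, 13, 14, 15]
noncomputable def T30 : List ℕ := T15 ++ T15.map (16 + ·)
noncomputable def T60 : List ℕ := T30 ++ T30.map (32 + ·)
noncomputable def PREPS : List (ℕ × List ℕ) := [
   (1, [1]), (16, [1]), (256, [1]), (258, [1, 2, 3, 4, 5, 17, 18, 19, 20, 21]), (273, T15),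
  (281, T60), (4096, [1]), (4113, T15), (4128, [1, 2, 3, 4, 5, 17, 18, 19, 20, 21]), (4130,
  T60), (4353, T15), (4361, T60), (4368, T15), (4374, T30), (4376, T60), (4390, T60), (4393,
  T60), (4399, T60), (4449, T30), (4452, T60), (4458, T60), (4459, T60), (4481, T60), (4484,
  T60), (4486, T60), (4492, T60), (4495, T60), (4496, T60), (4501, T60), (4502, T60), (4509,
  T60), (4510, T60)]

noncomputable def frN (k x : ℕ) : ℕ := Nat.rec (motive := fun _ => ℕ) x (fun _ y => mt y y) k
noncomputable def actN (a t p : ℕ) : ℕ :=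
  (fun k => (fun b => (fun b2 => (fun b4 =>
    Nat.add (mt (mt a (frN k (nib p 0))) b) (Nat.add (Nat.mul 16 (mt (mt a (frN k (nib p 1))) b2))
     (Nat.add (Nat.mul 256 (mt (mt a (frN k (nib p 2))) b4))
       (Nat.mul 4096 (mt (mt a (frN k (nib p 3))) (mt b4 b4)))))) (mt b2 b2)) (mt b b)) (Nat.land t 15))
    (Nat.shiftRight t 4)
noncomputable def lorL {α : Type} (f : α → ℕ) (l : List α) : ℕ := l.foldr (fun x acc => Nat.lor (f x) acc) 0
/-- the leading coefficient -/
noncomputable def leadN (n : ℕ) : ℕ :=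
  (fun z => Bool.rec (motive := fun _ => ℕ) z ((fun z => Bool.rec (motive := fun _ => ℕ) z
    ((fun z => Bool.rec (motive := fun _ => ℕ) z n (Nat.beq z 0)) (Nat.shiftRight n 4)) (Nat.beq z 0))
    (Nat.shiftRight n 8)) (Nat.beq z 0)) (Nat.shiftRight n 12)
noncomputable def COV : ℕ :=
  lorL (fun r : ℕ × List ℕ => lorL (fun t =>
    Nat.shiftLeft 1 (actN (invN (leadN (actN 1 t r.1))) t r.1)) r.2) PREPS
/-- the value of `p₁x + p₂x³ + p₃x⁷` -/
noncomputable def singV (i x : ℕ) : ℕ :=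
  (fun x2 => (fun x3 => Nat.xor (mt (nib i 0) x) (Nat.xor (mt (nib i 1) x3) (mt (nib i 2) (mt (mt x3 x3) x))))
    (mt x2 x)) (mt x x)
noncomputable def singM (i : ℕ) : ℕ := lorN (fun x => Nat.shiftLeft 1 (singV i (Nat.add x 1))) 15
theorem covered : ∀ i < 512, Nat.beq (Nat.shiftRight i 8) 1 = true ∨ Nat.beq (Nat.shiftRight i 4) 1 = true ∨
    Nat.beq i 1 = true →
    Nat.lor (Nat.land (Nat.shiftRight COV (Nat.mul 16 i)) 65535) (singM i) = 65535 := by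
  decide +kernel
theorem covered0 : COV.testBit 1 = true := by decide +kernel

theorem lorL_bit {α : Type} (f : α → ℕ) (l : List α) (j : ℕ) (h : (lorL f l).testBit j = true) :
    ∃ x ∈ l, (f x).testBit j = true := by
  induction l with
  | nil => simp [lorL] at h
  | cons x l ih =>
    have : lorL f (x :: l) = f x ||| lorL f l := rfl
    rw [this, Nat.testBit_or, Bool.or_eq_true] at h
    rcases h with h | h
    · exact ⟨x, by simp, h⟩
    · obtain ⟨y, hy, h⟩ := ih h
      exact ⟨y, by simp [hy], h⟩

theorem one_shl_bit (a j : ℕ) : (Nat.shiftLeft 1 a).testBit j = true ↔ a = j := by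
  change (1 <<< a).testBit j = true ↔ _
  rw [Nat.one_shiftLeft, Nat.testBit_two_pow]; simp

theorem COV_bit (n : ℕ) (h : COV.testBit n = true) :
    ∃ r ∈ PREPS, ∃ t ∈ r.2, ∃ a < 16, actN a t r.1 = n := by
  obtain ⟨r, hr, h3⟩ := lorL_bit _ _ _ h
  obtain ⟨t, ht, h4⟩ := lorL_bit _ _ _ h3
  exact ⟨r, hr, t, ht, _, invN_lt _, (one_shl_bit _ _).1 h4⟩

theorem cov_dich (i n : ℕ) (hi : i / 256 = 1 ∨ i / 16 = 1 ∨ i = 1) (hn : n < 16) :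
    (∃ r ∈ PREPS, ∃ t ∈ r.2, ∃ a < 16, actN a t r.1 = 16 * i + n) ∨ ∃ x < 15, singV i (x + 1) = n := by
  have hi' : Nat.beq (Nat.shiftRight i 8) 1 = true ∨ Nat.beq (Nat.shiftRight i 4) 1 = true ∨
      Nat.beq i 1 = true := by
    rw [Nat.beq_eq, Nat.beq_eq, Nat.beq_eq]
    change i >>> 8 = 1 ∨ i >>> 4 = 1 ∨ _
    rw [Nat.shiftRight_eq_div_pow, Nat.shiftRight_eq_div_pow]
    exact hi
  have h := covered i (by omega) hi'
  have h2 : (Nat.lor (Nat.land (Nat.shiftRight COV (Nat.mul 16 i)) 65535) (singM i)).testBit n = true := by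
    rw [h]
    have : (65535 : ℕ) = 2 ^ 16 - 1 := by norm_num
    rw [this, Nat.testBit_two_pow_sub_one]; simpa
  change ((((COV >>> (16 * i)) &&& 65535) ||| singM i)).testBit n = true at h2
  rw [Nat.testBit_or, Bool.or_eq_true, Nat.testBit_and, Bool.and_eq_true, Nat.testBit_shiftRight] at h2
  rcases h2 with ⟨h2, -⟩ | h2
  · exact Or.inl (COV_bit _ h2)
  · right
    obtain ⟨x, hx, h3⟩ := (lorN_bit _ _ _).1 h2
    exact ⟨x, hx, (one_shl_bit _ _).1 h3⟩

theorem sum_le_cover {β : Type} [Fintype β] (F : β → ℕ) (l : List (β × ℕ))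
    (h : ∀ b, F b = 0 ∨ ∃ w, (b, w) ∈ l ∧ F b ≤ w) : ∑ b, F b ≤ (l.map Prod.snd).sum := by
  classical
  have key : ∀ (l : List (β × ℕ)) (s : Finset β), (∀ b ∈ s, ∃ w, (b, w) ∈ l ∧ F b ≤ w) →
      ∑ b ∈ s, F b ≤ (l.map Prod.snd).sum := by
    intro l
    induction l with
    | nil =>
      intro s hs
      have : s = ∅ := Finset.eq_empty_of_forall_notMem fun b hb => by
        obtain ⟨w, hw, -⟩ := hs b hb; simp at hw
      simp [this]
    | cons x l ih =>
      intro s hs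
      obtain ⟨y, v⟩ := x
      have h1 := ih (s.filter fun b => ¬ (b = y ∧ F b ≤ v)) (by
        intro b hb
        obtain ⟨hb, hb2⟩ := Finset.mem_filter.1 hb
        obtain ⟨w, hw, hle⟩ := hs b hb
        rcases List.mem_cons.1 hw with h | h
        · obtain ⟨rfl, rfl⟩ := Prod.mk.inj h; exact absurd ⟨rfl, hle⟩ hb2
        · exact ⟨w, h, hle⟩)
      have h2 : ∑ b ∈ s.filter (fun b => b = y ∧ F b ≤ v), F b ≤ v := by
        have : s.filter (fun b => b = y ∧ F b ≤ v) ⊆ {y} := fun b hb => by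
          simp at hb ⊢; exact hb.2.1
        rcases Finset.subset_singleton_iff.1 this with h | h
        · simp [h]
        · rw [h, Finset.sum_singleton]
          have hy : y ∈ s.filter (fun b => b = y ∧ F b ≤ v) := by rw [h]; simp
          exact (Finset.mem_filter.1 hy).2.2
      rw [← Finset.sum_filter_add_sum_filter_not s (fun b => b = y ∧ F b ≤ v)]
      simp only [List.map_cons, List.sum_cons]
      omega
  have := key l (Finset.univ.filter fun b => F b ≠ 0) (by
    intro b hb
    rcases h b with h | h
    · simp [h] at hb
    · exact h)
  rwa [Finset.sum_filter_ne_zero] at this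

theorem sum_flat {β : Type} (f : ℕ → ℕ → β) (w : ℕ) (l : List ℕ) :
    ((l.flatMap fun t => (List.range 15).map fun a => (f t a, w)).map Prod.snd).sum = l.length * (15 * w) := by
  have h15 : (List.range 15).length = 15 := List.length_range
  generalize List.range 15 = R at h15
  induction l with
  | nil => simp
  | cons t l ih =>
    rw [List.flatMap_cons, List.map_append, List.sum_append, ih, List.length_cons, List.map_map]
    have : (Prod.snd ∘ fun a => (f t a, w)) = fun _ => w := rfl
    rw [this, List.map_const', h15, List.sum_replicate, smul_eq_mul]
    ring

section field
variable {K : Type} [Field K] [Cod K]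
open Cod

noncomputable def frobE : K ≃+* K := RingEquiv.ofBijective (frobenius K 2)
  ⟨frobenius_inj K 2, Finite.surjective_of_injective (frobenius_inj K 2)⟩
theorem frobE_apply (x : K) : frobE x = x * x := by
  change frobenius K 2 x = _; rw [frobenius_def, sq]
theorem c_frobE (k : ℕ) (x : K) : c ((frobE ^ k : K ≃+* K) x) = frN k (c x) := by
  induction k with
  | zero => rfl
  | succ k ih =>
    have : frN (k + 1) (c x) = mt (frN k (c x)) (frN k (c x)) := rfl
    rw [this, pow_succ', RingAut.mul_apply, frobE_apply, c_mul, ih]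

noncomputable def dec (n : ℕ) : Fin 4 → K := fun i => d (nib n i)

theorem dec_code (a : Fin 4 → K) : dec (code a) = a := by
  obtain ⟨h0, h1, h2, h3⟩ := nib_code a
  ext l; unfold dec
  fin_cases l
  · change d (nib _ 0) = a 0; rw [h0, d_c]
  · change d (nib _ 1) = a 1; rw [h1, d_c]
  · change d (nib _ 2) = a 2; rw [h2, d_c]
  · change d (nib _ 3) = a 3; rw [h3, d_c]
theorem code_inj {a b : Fin 4 → K} (h : code a = code b) : a = b := by
  rw [← dec_code a, ← dec_code b, h]
theorem c_dec (n : ℕ) (i : Fin 4) : c (dec (K := K) n i) = nib n i := c_d _ (nib_lt _ _)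

theorem code_act (a t p : ℕ) (ha : a < 16) :
    code (actV (d a) (d (t &&& 15)) (frobE ^ (t >>> 4)) (dec p) : Fin 4 → K) = actN a t p := by
  have hb : t &&& 15 < 16 := lt_of_le_of_lt Nat.and_le_right (by norm_num)
  have h2 : ∀ b : K, b ^ 2 = b * b := fun b => sq b
  have h4 : ∀ b : K, b ^ 4 = b * b * (b * b) := fun b => by ring
  have h8 : ∀ b : K, b ^ 8 = b * b * (b * b) * (b * b * (b * b)) := fun b => by ring
  have e0 : ((0 : Fin 4) : ℕ) = 0 := rfl
  have e1 : ((1 : Fin 4) : ℕ) = 1 := rfl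
  have e2 : ((2 : Fin 4) : ℕ) = 2 := rfl
  have e3 : ((3 : Fin 4) : ℕ) = 3 := rfl
  have n1 : (2 : ℕ) ^ 0 = 1 := rfl
  have n2 : (2 : ℕ) ^ 1 = 2 := rfl
  have n4 : (2 : ℕ) ^ 2 = 4 := rfl
  have n8 : (2 : ℕ) ^ 3 = 8 := rfl
  simp only [code, actV, c_mul, c_frobE, c_dec, e0, e1, e2, e3, n1, n2, n4, n8, pow_one, h2, h4, h8,
    c_d _ ha, c_d _ hb]
  change _ = _ + (16 * _ + (256 * _ + 4096 * _))
  ring_nf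
  rfl

theorem code_lt (a : Fin 4 → K) : ∃ i < 4096, code a = 16 * i + c (a 0) ∧
    nib i 0 = c (a 1) ∧ nib i 1 = c (a 2) ∧ nib i 2 = c (a 3) := by
  have h1 := c_lt (a 1); have h2 := c_lt (a 2); have h3 := c_lt (a 3)
  refine ⟨c (a 1) + 16 * c (a 2) + 256 * c (a 3), by omega, by unfold code; ring, ?_⟩
  have hn : ∀ t y, nib t y = t / 2 ^ (4 * y) % 16 := by
    intro t y
    change (t >>> (4 * y)) &&& 15 = _
    rw [Nat.shiftRight_eq_div_pow, show (15 : ℕ) = 2 ^ 4 - 1 by norm_num, Nat.and_two_pow_sub_one_eq_mod]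
  rw [hn, hn, hn]
  norm_num
  omega

theorem MM_sing (p : Fin 4 → K) (x : K) (hx : x ≠ 0) (h : lin p x = 0) : MM p = 0 := by
  unfold MM
  exact Finset.sum_eq_zero fun a _ => nn_sing _ _ x hx h

/-- `p` is in the orbit of a representative -/
def Cvd (p : Fin 4 → K) : Prop := ∃ r ∈ PREPS, ∃ t ∈ r.2, ∃ a : K, a ≠ 0 ∧
    p = actV a (d (t &&& 15)) (frobE ^ (t >>> 4)) (dec r.1)

theorem Cvd_of_code (p : Fin 4 → K) (hp : p ≠ 0)
    (h : ∃ r ∈ PREPS, ∃ t ∈ r.2, ∃ a < 16, actN a t r.1 = code p) : Cvd p := by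
  obtain ⟨r, hr, t, ht, a, ha, h⟩ := h
  have h' := code_act (K := K) a t r.1 ha
  rw [h] at h'
  have h2 := code_inj h'
  refine ⟨r, hr, t, ht, d a, ?_, h2.symm⟩
  intro h0
  apply hp
  rw [← h2, h0]
  ext l; simp [actV]

theorem MM_norm (p : Fin 4 → K) (hn : (p 3 = 1) ∨ (p 3 = 0 ∧ p 2 = 1) ∨ (p 3 = 0 ∧ p 2 = 0 ∧ p 1 = 1)) :
    (∃ x ≠ 0, lin p x = 0) ∨ Cvd p := by
  have hp : p ≠ 0 := by rintro rfl; simp at hn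
  obtain ⟨i, hi, h0, h1, h2, h3⟩ := code_lt p
  have hi' : i / 256 = 1 ∨ i / 16 = 1 ∨ i = 1 := by
    have e : 16 * i = 16 * c (p 1) + 256 * c (p 2) + 4096 * c (p 3) := by unfold code at h0; omega
    have l1 := c_lt (p 1); have l2 := c_lt (p 2)
    rcases hn with h | ⟨h, h'⟩ | ⟨h, h', h''⟩
    · rw [h, c_one] at e; omega
    · rw [h, h', c_one, c_zero] at e; omega
    · rw [h, h', h'', c_one, c_zero] at e; omega
  rcases cov_dich i (c (p 0)) hi' (c_lt _) with h | ⟨x, hx, h⟩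
  · right; rw [← h0] at h; exact Cvd_of_code p hp h
  · left
    have hx' : d (x + 1) ≠ (0 : K) := d_ne_zero (by omega) (by omega)
    refine ⟨d (x + 1), hx', ?_⟩
    have hc : c (d (x + 1) : K) = x + 1 := c_d _ (by omega)
    have e : p 1 * d (x + 1) + (p 2 * (d (x + 1) * d (x + 1) * d (x + 1)) +
        p 3 * (d (x + 1) * d (x + 1) * d (x + 1) * (d (x + 1) * d (x + 1) * d (x + 1)) * d (x + 1))) = p 0 := by
      apply c_inj
      rw [← h]
      simp only [c_add, c_mul, hc, ← h1, ← h2, ← h3]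
      rfl
    rw [lin_apply, ← e]
    have : ∀ y z : K, y = z → y + z = 0 := fun y z h => by rw [h, add_self]
    rw [add_assoc, add_assoc]
    apply this
    ring

theorem MM_dich (p : Fin 4 → K) : MM p = 0 ∨ Cvd p := by
  have key : ∀ m : K, m ≠ 0 → ((∃ x ≠ 0, lin (m • p) x = 0) ∨ Cvd (m • p)) → MM p = 0 ∨ Cvd p := by
    intro m hm h
    rcases h with ⟨x, hx, h⟩ | ⟨r, hr, t, ht, a, ha, h⟩
    · left
      refine MM_sing p x hx ?_
      rw [lin_smul, scE_apply, one_mul] at h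
      exact (mul_eq_zero.1 h).resolve_left hm
    · right
      refine ⟨r, hr, t, ht, m⁻¹ * a, mul_ne_zero (inv_ne_zero hm) ha, ?_⟩
      ext l
      have := congrFun h l
      simp only [actV, Pi.smul_apply, smul_eq_mul] at this ⊢
      rw [mul_assoc, mul_assoc, ← mul_assoc a, ← this, inv_mul_cancel_left₀ hm]
  by_cases h3 : p 3 = 0
  · by_cases h2 : p 2 = 0
    · by_cases h1 : p 1 = 0
      · by_cases h0 : p 0 = 0
        · left; refine MM_sing p 1 one_ne_zero ?_
          rw [lin_apply, h0, h1, h2, h3]; ring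
        · apply key (p 0)⁻¹ (inv_ne_zero h0)
          right
          apply Cvd_of_code
          · intro h; have := congrFun h 0; simp [h0] at this
          · have : code ((p 0)⁻¹ • p) = 1 := by
              simp [code, h0, h1, h2, h3, c_zero, c_one]
            rw [this]; exact COV_bit _ covered0
      · apply key (p 1)⁻¹ (inv_ne_zero h1); apply MM_norm; simp [h1, h2, h3]
    · apply key (p 2)⁻¹ (inv_ne_zero h2); apply MM_norm; simp [h2, h3]
  · apply key (p 3)⁻¹ (inv_ne_zero h3); apply MM_norm; simp [h3]

theorem PREPS_pos : ∀ r ∈ PREPS, ∀ t ∈ r.2, t &&& 15 ≠ 0 := by decide +kernel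

theorem sum_MM_le : ∑ p : Fin 4 → K, MM p ≤
    (PREPS.map fun r => r.2.length * (15 * MM (dec r.1 : Fin 4 → K))).sum := by
  let l : List ((Fin 4 → K) × ℕ) := PREPS.flatMap fun r => r.2.flatMap fun t => (List.range 15).map fun a =>
    (actV (d (a + 1)) (d (t &&& 15)) (frobE ^ (t >>> 4)) (dec r.1), MM (dec r.1 : Fin 4 → K))
  have h := sum_le_cover (MM (K := K)) l (by
    intro p
    rcases MM_dich p with h | ⟨r, hr, t, ht, a, ha, h⟩
    · exact Or.inl h
    · right
      refine ⟨MM (dec r.1 : Fin 4 → K), ?_, ?_⟩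
      · simp only [l, List.mem_flatMap, List.mem_map, List.mem_range]
        have h1 := c_lt a
        have h2 := c_ne_zero ha
        refine ⟨r, hr, t, ht, c a - 1, by omega, ?_⟩
        rw [Nat.sub_add_cancel (by omega), d_c, h]
      · rw [h]
        exact MM_act _ _ _ ha
          (d_ne_zero (lt_of_le_of_lt Nat.and_le_right (by norm_num)) (PREPS_pos r hr t ht)) _)
  refine h.trans (le_of_eq ?_)
  have e := fun r : ℕ × List ℕ => sum_flat (fun t a => (actV (d (a + 1)) (d (t &&& 15)) (frobE ^ (t >>> 4)) (dec r.1) : Fin 4 → K)) (MM (dec r.1 : Fin 4 → K)) r.2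
  simp only [l]
  generalize PREPS = L
  induction L with
  | nil => simp
  | cons r L ih =>
    rw [List.flatMap_cons, List.map_append, List.sum_append, ih, e, List.map_cons, List.sum_cons]

end field

end MRD

set_option maxRecDepth 100000
set_option exponentiation.threshold 600
namespace MRD

/-! ### evaluation of the counts -/

noncomputable def partA (p ej ek : ℕ) : ℕ := Nat.add (eng 0 p) (Nat.mul 15 (Nat.add (eng ek p) (chunk p ej ek 4)))
abbrev W (p ej ek v1 v2 v3 : ℕ) : Prop :=
  partA p ej ek = v1 ∧ chunk p (Nat.add ej (Nat.mul 4 ek)) ek 6 = v2 ∧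
    chunk p (Nat.add ej (Nat.mul 10 ek)) ek 6 = v3
abbrev V (e v1 v2 v3 : ℕ) : Prop :=
  chunk 1 e 4096 5 = v1 ∧ chunk 1 (Nat.add e 20480) 4096 5 = v2 ∧ chunk 1 (Nat.add e 40960) 4096 6 = v3

theorem W_sum {p ej ek v1 v2 v3 : ℕ} (h : W p ej ek v1 v2 v3) :
    eng 0 p + 15 * (eng ek p + ∑ t ∈ Finset.range 16, eng (ej + ek * t) p) = v1 + 15 * v2 + 15 * v3 := by
  obtain ⟨h1, h2, h3⟩ := h
  rw [← h1, ← h2, ← h3]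
  change _ = (eng 0 p + 15 * (eng ek p + chunk p ej ek 4)) + 15 * chunk p (ej + 4 * ek) ek 6 +
    15 * chunk p (ej + 10 * ek) ek 6
  simp only [chunk, sumN_eq, Finset.sum_range_succ, Finset.sum_range_zero]
  simp only [Nat.add_eq, Nat.mul_eq]
  ring_nf

theorem V_sum {e v1 v2 v3 : ℕ} (h : V e v1 v2 v3) (s : ℕ) (he : e = 16 + 256 * s) :
    ∑ t ∈ Finset.range 16, eng (16 + 256 * s + 4096 * t) 1 = v1 + v2 + v3 := by
  rw [← he]
  obtain ⟨h1, h2, h3⟩ := h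
  rw [← h1, ← h2, ← h3]
  change _ = chunk 1 e 4096 5 + chunk 1 (e + 20480) 4096 5 + chunk 1 (e + 40960) 4096 6
  simp only [chunk, sumN_eq, Finset.sum_range_succ, Finset.sum_range_zero]
  simp only [Nat.add_eq, Nat.mul_eq]
  ring_nf

theorem eng_values :
    W 1 256 4096 52320 3120 3120 ∧
    W 16 256 4096 61850 3204 3204 ∧
    W 256 16 4096 35052 3120 3744 ∧
    W 258 16 4096 41511 3405 2934 ∧
    W 273 256 4096 36780 2852 2862 ∧
    W 281 256 4096 35490 2981 3025 ∧
    W 4096 16 256 61850 3204 3204 ∧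
    W 4113 256 4096 36000 3006 3138 ∧
    W 4128 256 4096 53586 2988 3388 ∧
    W 4130 256 4096 38760 2943 2931 ∧
    W 4353 16 4096 36750 2851 2865 ∧
    W 4361 16 4096 37275 2994 2893 ∧
    W 4368 256 4096 44160 3079 2925 ∧
    W 4374 256 4096 48930 2861 3071 ∧
    W 4376 256 4096 40830 3130 3030 ∧
    W 4390 256 4096 38295 2999 2866 ∧
    W 4393 256 4096 36555 3052 2929 ∧
    W 4399 256 4096 39903 3189 3323 ∧
    W 4449 256 4096 37170 3126 3228 ∧
    W 4452 256 4096 39280 3035 3033 ∧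
    W 4458 256 4096 36945 3103 3112 ∧
    W 4459 256 4096 36570 2962 3058 ∧
    W 4481 256 4096 36315 3026 2955 ∧
    W 4484 256 4096 36260 3109 3136 ∧
    W 4486 256 4096 37565 3090 3068 ∧
    W 4492 256 4096 38145 3160 3135 ∧
    W 4495 256 4096 37245 3003 2916 ∧
    W 4496 256 4096 38583 3115 2934 ∧
    W 4501 256 4096 35565 3079 2876 ∧
    W 4502 256 4096 39000 2916 2856 ∧
    W 4509 256 4096 38238 3033 3039 ∧
    W 4510 256 4096 34980 3009 3031 ∧
    V 16 5928 7632 7560 ∧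
    V 272 4744 5920 7728 ∧
    V 528 5072 6272 7048 ∧
    V 784 5080 5560 7752 ∧
    V 1040 5424 5216 7752 ∧
    V 1296 5080 5912 7400 ∧
    V 1552 4744 5920 7728 ∧
    V 1808 4744 5920 7728 ∧
    V 2064 5080 5912 7400 ∧
    V 2320 5080 5560 7752 ∧
    V 2576 5080 5560 7752 ∧
    V 2832 5424 5216 7752 ∧
    V 3088 5072 6272 7048 ∧
    V 3344 5080 5912 7400 ∧
    V 3600 5072 6272 7048 ∧
    V 3856 5424 5216 7752 := by
  refine ⟨⟨?_, ?_, ?_⟩, ⟨?_, ?_, ?_⟩, ⟨?_, ?_, ?_⟩, ⟨?_, ?_, ?_⟩, ⟨?_, ?_, ?_⟩, ⟨?_, ?_, ?_⟩, ⟨?_, ?_, ?_⟩, ⟨?_, ?_, ?_⟩, ⟨?_, ?_, ?_⟩, ⟨?_, ?_, ?_⟩, ⟨?_, ?_, ?_⟩, ⟨?_, ?_, ?_⟩, ⟨?_, ?_, ?_⟩, ⟨?_, ?_, ?_⟩, ⟨?_, ?_, ?_⟩, ⟨?_, ?_, ?_⟩, ⟨?_, ?_, ?_⟩, ⟨?_,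 ?_, ?_⟩, ⟨?_, ?_, ?_⟩, ⟨?_, ?_, ?_⟩, ⟨?_, ?_, ?_⟩, ⟨?_, ?_, ?_⟩, ⟨?_, ?_, ?_⟩, ⟨?_, ?_, ?_⟩, ⟨?_, ?_, ?_⟩, ⟨?_, ?_, ?_⟩, ⟨?_, ?_, ?_⟩, ⟨?_, ?_, ?_⟩, ⟨?_, ?_, ?_⟩, ⟨?_, ?_, ?_⟩, ⟨?_, ?_, ?_⟩, ⟨?_, ?_, ?_⟩, ⟨?_, ?_, ?_⟩, ⟨?_, ?_, ?_⟩, ⟨?_, ?_, ?_⟩, ⟨?_, ?_, ?_⟩, ⟨?_, ?_, ?_⟩, ⟨?_, ?_, ?_⟩, ⟨?_, ?_, ?_⟩, ⟨?_, ?_, ?_⟩, ⟨?_, ?_, ?_⟩, ⟨?_, ?_, ?_⟩, ⟨?_, ?_, ?_⟩, ⟨?_, ?_, ?_⟩, ⟨?_, ?_, ?_⟩, ⟨?_, ?_, ?_⟩, ⟨?_, ?_, ?_⟩, ⟨?_, ?_, ?_⟩⟩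
  all_goals decide +kernel

end MRD

set_option maxRecDepth 100000
set_option exponentiation.threshold 600
namespace MRD

section field
variable {K : Type} [Field K] [Cod K]
open Cod
attribute [local irreducible] eng chunk partA

theorem code_dec (n : ℕ) (hn : n < 65536) : code (dec n : Fin 4 → K) = n := by
  have hb : ∀ t y, nib t y = t / 2 ^ (4 * y) % 16 := by
    intro t y
    change (t >>> (4 * y)) &&& 15 = _
    rw [Nat.shiftRight_eq_div_pow, show (15 : ℕ) = 2 ^ 4 - 1 by norm_num, Nat.and_two_pow_sub_one_eq_mod]
  unfold code
  rw [c_dec, c_dec, c_dec, c_dec, hb, hb, hb, hb]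
  change n / 2 ^ (4 * 0) % 16 + 16 * (n / 2 ^ (4 * 1) % 16) + 256 * (n / 2 ^ (4 * 2) % 16) +
    4096 * (n / 2 ^ (4 * 3) % 16) = n
  norm_num
  omega

theorem code4 (w x y z : K) : code ![w, x, y, z] = c w + 16 * c x + 256 * c y + 4096 * c z := rfl

theorem MM_W {n ej ek v1 v2 v3 : ℕ} (i j k : Fin 4) (hW : W n ej ek v1 v2 v3)
    (hej : ej = 16 ^ (j : ℕ)) (hek : ek = 16 ^ (k : ℕ)) (hn : n < 65536)
    (hi : nib n i ≠ 0) (hi0 : i ≠ 0) (hij : i ≠ j) (hik : i ≠ k)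
    (hjk : j ≠ k) (hj0 : j ≠ 0) (hk0 : k ≠ 0) :
    MM (dec n : Fin 4 → K) ≤ 256 * (v1 + 15 * v2 + 15 * v3) := by
  subst hej hek
  have hs : ∀ (l : Fin 4) (t : K), l ≠ 0 → code (Pi.single l t : Fin 4 → K) = 16 ^ (l : ℕ) * c t := by
    intro l t hl
    fin_cases l <;> simp_all [code, Pi.single_apply, c_zero]
  have h := MM_pivot (dec n : Fin 4 → K) i j k (d_ne_zero (nib_lt _ _) hi) hi0 hij hik hjk hj0 hk0
    (16 ^ (j : ℕ)) (16 ^ (k : ℕ)) (by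
      intro t
      fin_cases j <;> fin_cases k <;> simp_all [code, Pi.single_apply, c_zero, c_one, Nat.add_comm]) (by
      rw [hs k 1 hk0, c_one, mul_one])
  rw [code_dec n hn, W_sum hW] at h
  exact h

theorem id_fin (E : ℕ → ℕ) (M : ℕ) (hM : M ≤ 16 * ((E 0 + 15 * (E 4096 +
      ∑ t ∈ Finset.range 16, E (256 + 4096 * t))) + 15 *
        ∑ s ∈ Finset.range 16, ∑ t ∈ Finset.range 16, E (16 + 256 * s + 4096 * t)))
    (hA : E 0 + 15 * (E 4096 + ∑ t ∈ Finset.range 16, E (256 + 4096 * t)) = 52320 + 15 * 3120 + 15 * 3120)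
    (h0 : ∑ t ∈ Finset.range 16, E (16 + 256 * 0 + 4096 * t) = 5928 + 7632 + 7560)
    (h1 : ∑ t ∈ Finset.range 16, E (16 + 256 * 1 + 4096 * t) = 4744 + 5920 + 7728)
    (h2 : ∑ t ∈ Finset.range 16, E (16 + 256 * 2 + 4096 * t) = 5072 + 6272 + 7048)
    (h3 : ∑ t ∈ Finset.range 16, E (16 + 256 * 3 + 4096 * t) = 5080 + 5560 + 7752)
    (h4 : ∑ t ∈ Finset.range 16, E (16 + 256 * 4 + 4096 * t) = 5424 + 5216 + 7752)
    (h5 : ∑ t ∈ Finset.range 16, E (16 + 256 * 5 + 4096 * t) = 5080 + 5912 + 7400)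
    (h6 : ∑ t ∈ Finset.range 16, E (16 + 256 * 6 + 4096 * t) = 4744 + 5920 + 7728)
    (h7 : ∑ t ∈ Finset.range 16, E (16 + 256 * 7 + 4096 * t) = 4744 + 5920 + 7728)
    (h8 : ∑ t ∈ Finset.range 16, E (16 + 256 * 8 + 4096 * t) = 5080 + 5912 + 7400)
    (h9 : ∑ t ∈ Finset.range 16, E (16 + 256 * 9 + 4096 * t) = 5080 + 5560 + 7752)
    (h10 : ∑ t ∈ Finset.range 16, E (16 + 256 * 10 + 4096 * t) = 5080 + 5560 + 7752)
    (h11 : ∑ t ∈ Finset.range 16, E (16 + 256 * 11 + 4096 * t) = 5424 + 5216 + 7752)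
    (h12 : ∑ t ∈ Finset.range 16, E (16 + 256 * 12 + 4096 * t) = 5072 + 6272 + 7048)
    (h13 : ∑ t ∈ Finset.range 16, E (16 + 256 * 13 + 4096 * t) = 5080 + 5912 + 7400)
    (h14 : ∑ t ∈ Finset.range 16, E (16 + 256 * 14 + 4096 * t) = 5072 + 6272 + 7048)
    (h15 : ∑ t ∈ Finset.range 16, E (16 + 256 * 15 + 4096 * t) = 5424 + 5216 + 7752)
    : M ≤ 16 * 4600920 := by
  refine hM.trans ?_
  apply Nat.mul_le_mul_left
  rw [hA]
  generalize hG : (fun s => ∑ t ∈ Finset.range 16, E (16 + 256 * s + 4096 * t)) = G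
  have e : ∀ s, ∑ t ∈ Finset.range 16, E (16 + 256 * s + 4096 * t) = G s := fun s => congrFun hG s
  rw [e] at h0 h1 h2 h3 h4 h5 h6 h7 h8 h9 h10 h11 h12 h13 h14 h15
  clear hG e hA hM
  simp only [Finset.sum_range_succ, Finset.sum_range_zero, h0, h1, h2, h3, h4, h5, h6, h7, h8, h9, h10, h11, h12, h13, h14, h15]
  norm_num

abbrev okpiv (n ej ek : ℕ) (i j k : Fin 4) : Prop := ej = 16 ^ (j : ℕ) ∧ ek = 16 ^ (k : ℕ) ∧ n < 65536 ∧
  n / 16 ^ (i : ℕ) % 16 ≠ 0 ∧ i ≠ 0 ∧ i ≠ j ∧ i ≠ k ∧ j ≠ k ∧ j ≠ 0 ∧ k ≠ 0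
theorem MM_W' {n ej ek v1 v2 v3 M : ℕ} (i j k : Fin 4) (hW : W n ej ek v1 v2 v3)
    (h : okpiv n ej ek i j k ∧ v1 + 15 * v2 + 15 * v3 = M) : MM (dec n : Fin 4 → K) ≤ 256 * M := by
  obtain ⟨⟨h1, h2, h3, h4, h5, h6, h7, h8, h9, h10⟩, h11⟩ := h
  rw [← h11]
  refine MM_W i j k hW h1 h2 h3 ?_ h5 h6 h7 h8 h9 h10
  have hb : nib n i = n / 2 ^ (4 * (i : ℕ)) % 16 := by
    change (n >>> (4 * (i : ℕ))) &&& 15 = _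
    rw [Nat.shiftRight_eq_div_pow, show (15 : ℕ) = 2 ^ 4 - 1 by norm_num, Nat.and_two_pow_sub_one_eq_mod]
  rwa [hb, pow_mul]

theorem MM_one : MM (dec 1 : Fin 4 → K) ≤ 16 * 4600920 := by
  obtain ⟨w0, w1, w2, w3, w4, w5, w6, w7, w8, w9, w10, w11, w12, w13, w14, w15, w16, w17, w18, w19, w20, w21, w22, w23, w24, w25, w26, w27, w28, w29, w30, w31,
    z0, z1, z2, z3, z4, z5, z6, z7, z8, z9, z10, z11, z12, z13, z14, z15⟩ := eng_values
  have e : (dec 1 : Fin 4 → K) = Pi.single 0 1 := code_inj (by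
    rw [code_dec 1 (by norm_num)]; simp [code, c_zero, c_one])
  rw [e]
  obtain ⟨E, hE⟩ : ∃ E : ℕ → ℕ, ∀ a, eng a 1 = E a := ⟨_, fun _ => rfl⟩
  have hM := MM_id (K := K)
  have hA := W_sum w0
  have v0 := V_sum z0 0 rfl
  have v1 := V_sum z1 1 rfl
  have v2 := V_sum z2 2 rfl
  have v3 := V_sum z3 3 rfl
  have v4 := V_sum z4 4 rfl
  have v5 := V_sum z5 5 rfl
  have v6 := V_sum z6 6 rfl
  have v7 := V_sum z7 7 rfl
  have v8 := V_sum z8 8 rfl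
  have v9 := V_sum z9 9 rfl
  have v10 := V_sum z10 10 rfl
  have v11 := V_sum z11 11 rfl
  have v12 := V_sum z12 12 rfl
  have v13 := V_sum z13 13 rfl
  have v14 := V_sum z14 14 rfl
  have v15 := V_sum z15 15 rfl
  simp only [hE] at hM hA v0 v1 v2 v3 v4 v5 v6 v7 v8 v9 v10 v11 v12 v13 v14 v15
  exact id_fin E _ hM hA v0 v1 v2 v3 v4 v5 v6 v7 v8 v9 v10 v11 v12 v13 v14 v15

theorem MM_reps : MM (dec 16 : Fin 4 → K) ≤ 256 * 157970 ∧
    MM (dec 256 : Fin 4 → K) ≤ 256 * 138012 ∧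
    MM (dec 258 : Fin 4 → K) ≤ 256 * 136596 ∧
    MM (dec 273 : Fin 4 → K) ≤ 256 * 122490 ∧
    MM (dec 281 : Fin 4 → K) ≤ 256 * 125580 ∧
    MM (dec 4096 : Fin 4 → K) ≤ 256 * 157970 ∧
    MM (dec 4113 : Fin 4 → K) ≤ 256 * 128160 ∧
    MM (dec 4128 : Fin 4 → K) ≤ 256 * 149226 ∧
    MM (dec 4130 : Fin 4 → K) ≤ 256 * 126870 ∧
    MM (dec 4353 : Fin 4 → K) ≤ 256 * 122490 ∧
    MM (dec 4361 : Fin 4 → K) ≤ 256 * 125580 ∧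
    MM (dec 4368 : Fin 4 → K) ≤ 256 * 134220 ∧
    MM (dec 4374 : Fin 4 → K) ≤ 256 * 137910 ∧
    MM (dec 4376 : Fin 4 → K) ≤ 256 * 133230 ∧
    MM (dec 4390 : Fin 4 → K) ≤ 256 * 126270 ∧
    MM (dec 4393 : Fin 4 → K) ≤ 256 * 126270 ∧
    MM (dec 4399 : Fin 4 → K) ≤ 256 * 137583 ∧
    MM (dec 4449 : Fin 4 → K) ≤ 256 * 132480 ∧
    MM (dec 4452 : Fin 4 → K) ≤ 256 * 130300 ∧
    MM (dec 4458 : Fin 4 → K) ≤ 256 * 130170 ∧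
    MM (dec 4459 : Fin 4 → K) ≤ 256 * 126870 ∧
    MM (dec 4481 : Fin 4 → K) ≤ 256 * 126030 ∧
    MM (dec 4484 : Fin 4 → K) ≤ 256 * 129935 ∧
    MM (dec 4486 : Fin 4 → K) ≤ 256 * 129935 ∧
    MM (dec 4492 : Fin 4 → K) ≤ 256 * 132570 ∧
    MM (dec 4495 : Fin 4 → K) ≤ 256 * 126030 ∧
    MM (dec 4496 : Fin 4 → K) ≤ 256 * 129318 ∧
    MM (dec 4501 : Fin 4 → K) ≤ 256 * 124890 ∧
    MM (dec 4502 : Fin 4 → K) ≤ 256 * 125580 ∧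
    MM (dec 4509 : Fin 4 → K) ≤ 256 * 129318 ∧
    MM (dec 4510 : Fin 4 → K) ≤ 256 * 125580 := by
  obtain ⟨w0, w1, w2, w3, w4, w5, w6, w7, w8, w9, w10, w11, w12, w13, w14, w15, w16, w17, w18, w19, w20, w21, w22, w23, w24, w25, w26, w27, w28, w29, w30, w31,
    z0, z1, z2, z3, z4, z5, z6, z7, z8, z9, z10, z11, z12, z13, z14, z15⟩ := eng_values
  refine ⟨MM_W' 1 2 3 w1 (by decide),
    MM_W' 2 1 3 w2 (by decide),
    MM_W' 2 1 3 w3 (by decide),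
    MM_W' 1 2 3 w4 (by decide),
    MM_W' 1 2 3 w5 (by decide),
    MM_W' 3 1 2 w6 (by decide),
    MM_W' 1 2 3 w7 (by decide),
    MM_W' 1 2 3 w8 (by decide),
    MM_W' 1 2 3 w9 (by decide),
    MM_W' 2 1 3 w10 (by decide),
    MM_W' 2 1 3 w11 (by decide),
    MM_W' 1 2 3 w12 (by decide),
    MM_W' 1 2 3 w13 (by decide),
    MM_W' 1 2 3 w14 (by decide),
    MM_W' 1 2 3 w15 (by decide),
    MM_W' 1 2 3 w16 (by decide),
    MM_W' 1 2 3 w17 (by decide),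
    MM_W' 1 2 3 w18 (by decide),
    MM_W' 1 2 3 w19 (by decide),
    MM_W' 1 2 3 w20 (by decide),
    MM_W' 1 2 3 w21 (by decide),
    MM_W' 1 2 3 w22 (by decide),
    MM_W' 1 2 3 w23 (by decide),
    MM_W' 1 2 3 w24 (by decide),
    MM_W' 1 2 3 w25 (by decide),
    MM_W' 1 2 3 w26 (by decide),
    MM_W' 1 2 3 w27 (by decide),
    MM_W' 1 2 3 w28 (by decide),
    MM_W' 1 2 3 w29 (by decide),
    MM_W' 1 2 3 w30 (by decide),
    MM_W' 1 2 3 w31 (by decide)⟩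

theorem sum_reps (g : ℕ → ℕ) (h1 : g 1 ≤ 16 * 4600920) (h : g 16 ≤ 256 * 157970 ∧
    g 256 ≤ 256 * 138012 ∧
    g 258 ≤ 256 * 136596 ∧
    g 273 ≤ 256 * 122490 ∧
    g 281 ≤ 256 * 125580 ∧
    g 4096 ≤ 256 * 157970 ∧
    g 4113 ≤ 256 * 128160 ∧
    g 4128 ≤ 256 * 149226 ∧
    g 4130 ≤ 256 * 126870 ∧
    g 4353 ≤ 256 * 122490 ∧
    g 4361 ≤ 256 * 125580 ∧
    g 4368 ≤ 256 * 134220 ∧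
    g 4374 ≤ 256 * 137910 ∧
    g 4376 ≤ 256 * 133230 ∧
    g 4390 ≤ 256 * 126270 ∧
    g 4393 ≤ 256 * 126270 ∧
    g 4399 ≤ 256 * 137583 ∧
    g 4449 ≤ 256 * 132480 ∧
    g 4452 ≤ 256 * 130300 ∧
    g 4458 ≤ 256 * 130170 ∧
    g 4459 ≤ 256 * 126870 ∧
    g 4481 ≤ 256 * 126030 ∧
    g 4484 ≤ 256 * 129935 ∧
    g 4486 ≤ 256 * 129935 ∧
    g 4492 ≤ 256 * 132570 ∧
    g 4495 ≤ 256 * 126030 ∧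
    g 4496 ≤ 256 * 129318 ∧
    g 4501 ≤ 256 * 124890 ∧
    g 4502 ≤ 256 * 125580 ∧
    g 4509 ≤ 256 * 129318 ∧
    g 4510 ≤ 256 * 125580) :
    (PREPS.map fun r => r.2.length * (15 * g r.1)).sum ≤ 665842058880 := by
  have l15 : T15.length = 15 := by decide +kernel
  have l30 : T30.length = 30 := by decide +kernel
  have l60 : T60.length = 60 := by decide +kernel
  simp only [PREPS, List.map_cons, List.map_nil, List.sum_cons, List.sum_nil, l15, l30, l60, List.length_cons,
    List.length_nil]
  obtain ⟨h2, h3, h4, h5, h6, h7, h8, h9, h10, h11, h12, h13, h14, h15, h16, h17, h18, h19, h20, h21, h22, h23, h24, h25, h26, h27, h28, h29, h30, h31, h32⟩ := h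
  exact (Nat.add_le_add (Nat.mul_le_mul_left _ (Nat.mul_le_mul_left _ h1)) (Nat.add_le_add (Nat.mul_le_mul_left _ (Nat.mul_le_mul_left _ h2)) (Nat.add_le_add (Nat.mul_le_mul_left _ (Nat.mul_le_mul_left _ h3)) (Nat.add_le_add (Nat.mul_le_mul_left _ (Nat.mul_le_mul_left _ h4)) (Nat.add_le_add (Nat.mul_le_mul_left _ (Nat.mul_le_mul_left _ h5)) (Nat.add_le_add (Nat.mul_le_mul_left _ (Nat.mul_le_mul_left _ h6)) (Nat.add_le_add (Nat.mul_le_mul_left _ (Nat.mul_le_mul_left _ h7)) (Nat.add_le_add (Nat.mul_le_mul_left _ (Nat.mul_le_mul_left _ h8)) (Nat.add_le_add (Nat.mul_le_mul_left _ (Nat.mul_le_mul_left _ h9)) (Nat.add_le_add (Nat.mul_le_mul_left _ (Nat.mul_le_mul_left _ h10)) (Nat.add_le_add (Nat.mul_le_mul_left _ (Nat.mul_le_mul_left _ h11)) (Nat.add_le_add (Nat.mul_le_mul_left _ (Nat.mul_le_mul_left _ h12)) (Nat.add_le_add (Nat.mul_le_mul_left _ (Nat.mul_le_mul_left _ h13))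 (Nat.add_le_add (Nat.mul_le_mul_left _ (Nat.mul_le_mul_left _ h14)) (Nat.add_le_add (Nat.mul_le_mul_left _ (Nat.mul_le_mul_left _ h15)) (Nat.add_le_add (Nat.mul_le_mul_left _ (Nat.mul_le_mul_left _ h16)) (Nat.add_le_add (Nat.mul_le_mul_left _ (Nat.mul_le_mul_left _ h17)) (Nat.add_le_add (Nat.mul_le_mul_left _ (Nat.mul_le_mul_left _ h18)) (Nat.add_le_add (Nat.mul_le_mul_left _ (Nat.mul_le_mul_left _ h19)) (Nat.add_le_add (Nat.mul_le_mul_left _ (Nat.mul_le_mul_left _ h20)) (Nat.add_le_add (Nat.mul_le_mul_left _ (Nat.mul_le_mul_left _ h21)) (Nat.add_le_add (Nat.mul_le_mul_left _ (Nat.mul_le_mul_left _ h22)) (Nat.add_le_add (Nat.mul_le_mul_left _ (Nat.mul_le_mul_left _ h23)) (Nat.add_le_add (Nat.mul_le_mul_left _ (Nat.mul_le_mul_left _ h24)) (Nat.add_le_add (Nat.mul_le_mul_left _ (Nat.mul_le_mul_left _ h25)) (Nat.add_le_add (Nat.mul_le_mul_left _ (Nat.mul_le_mul_left _ h26)) (Nat.add_le_add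 (Nat.mul_le_mul_left _ (Nat.mul_le_mul_left _ h27)) (Nat.add_le_add (Nat.mul_le_mul_left _ (Nat.mul_le_mul_left _ h28)) (Nat.add_le_add (Nat.mul_le_mul_left _ (Nat.mul_le_mul_left _ h29)) (Nat.add_le_add (Nat.mul_le_mul_left _ (Nat.mul_le_mul_left _ h30)) (Nat.add_le_add (Nat.mul_le_mul_left _ (Nat.mul_le_mul_left _ h31)) (Nat.add_le_add (Nat.mul_le_mul_left _ (Nat.mul_le_mul_left _ h32)) (le_refl 0))))))))))))))))))))))))))))))))).trans (by norm_num)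

theorem sum_MM_bound : ∑ p : Fin 4 → K, MM p ≤ 665842058880 :=
  sum_MM_le.trans (sum_reps (fun n => MM (dec n : Fin 4 → K)) MM_one MM_reps)

end field
end MRD

set_option maxRecDepth 100000
set_option exponentiation.threshold 600
namespace MRD
open Cod

abbrev Mat := Matrix (Fin 2) (Fin 2) F16

theorem isUnit_iff_det (M : Mat) : IsUnit M ↔ M 0 0 * M 1 1 + M 0 1 * M 1 0 ≠ 0 := by
  rw [Matrix.isUnit_iff_isUnit_det, isUnit_iff_ne_zero, Matrix.det_fin_two, CharTwo.sub_eq_add]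

/-- first row -/
def row0 : Mat →+ F16 × F16 where
  toFun M := (M 0 0, M 0 1)
  map_zero' := rfl
  map_add' _ _ := rfl
/-- second row -/
def row1 (j : Fin 2) : Mat →+ F16 where
  toFun M := M 1 j
  map_zero' := rfl
  map_add' _ _ := rfl

instance finMat : Finite Mat := inferInstanceAs (Finite (Fin 2 → Fin 2 → F16))
instance finSub : Finite (Submodule (ZMod 2) Mat) :=
  Finite.of_injective (fun C => (C : Set Mat)) SetLike.coe_injective

theorem card_of_mem {C : Submodule (ZMod 2) Mat} (h : Module.finrank (ZMod 2) C = 8) : Nat.card C = 256 := by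
  have := Module.natCard_eq_pow_finrank (K := ZMod 2) (V := C)
  rw [this, h, Nat.card_zmod]; norm_num

theorem graph_exists (C : Submodule (ZMod 2) Mat) (hC : C ∈ mrdSet) :
    ∃ (p a : Fin 4 → F16) (q : (F16 →+ F16) × (F16 →+ F16)), Good (lin a) (lin p) q ∧
      ∀ M : Mat, M ∈ C ↔ (M 1 0 = lin a (M 0 0) + q.2 (M 0 1) ∧ M 1 1 = lin p (M 0 0) + q.1 (M 0 1)) := by
  obtain ⟨hd, hu⟩ := hC
  let g : C →+ F16 × F16 := row0.comp C.toAddSubgroup.subtype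
  have hg : Function.Injective g := by
    rw [injective_iff_map_eq_zero]
    intro M hM
    by_contra hne
    have h1 := hu M.1 M.2 (fun h => hne (Subtype.ext h))
    rw [isUnit_iff_det] at h1
    have h2 : M.1 0 0 = 0 := congrArg Prod.fst hM
    have h3 : M.1 0 1 = 0 := congrArg Prod.snd hM
    rw [h2, h3] at h1; simp at h1
  have hb : Function.Bijective g := by
    rw [Nat.bijective_iff_injective_and_card]
    refine ⟨hg, ?_⟩
    rw [card_of_mem hd, Nat.card_prod, natcard_K]
  let e : C ≃+ F16 × F16 := AddEquiv.ofBijective g hb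
  let r : Fin 2 → (F16 × F16 →+ F16) := fun j => ((row1 j).comp C.toAddSubgroup.subtype).comp e.symm.toAddMonoidHom
  have hr : ∀ M : C, ∀ j, r j (M.1 0 0, M.1 0 1) = M.1 1 j := by
    intro M j
    have : e.symm (e M) = M := e.symm_apply_apply M
    change (e.symm (e M)).1 1 j = _
    rw [this]
  have hr2 : ∀ j (u x : F16), r j (u, x) = r j (u, 0) + r j (0, x) := by
    intro j u x; rw [← map_add]; simp
  obtain ⟨a, ha⟩ := lin_bij.2 ((r 0).comp (AddMonoidHom.inl F16 F16))
  obtain ⟨p, hp⟩ := lin_bij.2 ((r 1).comp (AddMonoidHom.inl F16 F16))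
  have hmem : ∀ M : Mat, M ∈ C ↔ (M 1 0 = r 0 (M 0 0, M 0 1) ∧ M 1 1 = r 1 (M 0 0, M 0 1)) := by
    intro M
    constructor
    · intro h; exact ⟨(hr ⟨M, h⟩ 0).symm, (hr ⟨M, h⟩ 1).symm⟩
    · rintro ⟨h1, h2⟩
      obtain ⟨N, hN⟩ := hb.2 (M 0 0, M 0 1)
      have e1 : N.1 0 0 = M 0 0 := congrArg Prod.fst hN
      have e2 : N.1 0 1 = M 0 1 := congrArg Prod.snd hN
      have : N.1 = M := by
        ext i j
        fin_cases i <;> fin_cases j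
        · exact e1
        · exact e2
        · change N.1 1 0 = M 1 0; rw [h1, ← hr N 0, e1, e2]
        · change N.1 1 1 = M 1 1; rw [h2, ← hr N 1, e1, e2]
      rw [← this]; exact N.2
  refine ⟨p, a, ((r 1).comp (AddMonoidHom.inr F16 F16), (r 0).comp (AddMonoidHom.inr F16 F16)), ?_, ?_⟩
  · intro u x hux
    rw [ha, hp]
    change u * r 1 (u, 0) + x * r 0 (u, 0) + u * r 1 (0, x) + x * r 0 (0, x) ≠ 0
    let M : Mat := !![u, x; r 0 (u, x), r 1 (u, x)]
    have hM : M ∈ C := (hmem M).2 ⟨rfl, rfl⟩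
    have hne : M ≠ 0 := fun h => hux ⟨congrFun (congrFun h 0) 0, congrFun (congrFun h 0) 1⟩
    have := hu M hM hne
    rw [isUnit_iff_det] at this
    have e : M 0 0 * M 1 1 + M 0 1 * M 1 0 = u * r 1 (u, x) + x * r 0 (u, x) := rfl
    rw [e, hr2 1, hr2 0] at this
    convert this using 1; ring
  · intro M
    rw [hmem, ha, hp, hr2 0, hr2 1]; rfl

theorem card_mrdSet_le : Nat.card mrdSet ≤ 665842058880 := by
  choose p a q hq hC using graph_exists
  let Φ : mrdSet → Σ p : Fin 4 → F16, Σ a : Fin 4 → F16, {q // Good (lin a) (lin p) q} :=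
    fun C => ⟨p C.1 C.2, a C.1 C.2, q C.1 C.2, hq C.1 C.2⟩
  have hi : Function.Injective Φ := by
    intro C C' h
    have h1 : p C.1 C.2 = p C'.1 C'.2 := congrArg (fun z => z.1) h
    have h2 : a C.1 C.2 = a C'.1 C'.2 := congrArg (fun z => z.2.1) h
    have h3 : q C.1 C.2 = q C'.1 C'.2 := congrArg (fun z => z.2.2.1) h
    apply Subtype.ext
    ext M
    rw [hC C.1 C.2, hC C'.1 C'.2, h1, h2, h3]
  have h1 := Nat.card_le_card_of_injective Φ hi
  refine h1.trans ?_
  rw [Nat.card_sigma]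
  simp only [Nat.card_sigma]
  exact sum_MM_bound (K := F16)

end MRD

set_option maxRecDepth 100000
set_option exponentiation.threshold 600
namespace MRD

/-! ### kernel side of the search for equivalences -/

noncomputable def xorN (f : ℕ → ℕ) (n : ℕ) : ℕ :=
  Nat.rec (motive := fun _ => ℕ) 0 (fun i acc => Nat.xor acc (f i)) n
noncomputable def bit (n i : ℕ) : ℕ := Nat.land (Nat.shiftRight n i) 1
/-- the byte belonging to the `i`th basis vector -/
noncomputable def byt (f i : ℕ) : ℕ := Nat.land (Nat.shiftRight f (Nat.mul 8 i)) 255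
/-- second row (as a byte) of the matrix with first row `w` -/
noncomputable def rowN (f w : ℕ) : ℕ := xorN (fun i => Nat.mul (bit w i) (byt f i)) 8
/-- determinant of the matrix with first row `w` and second row `r` -/
noncomputable def detN (w r : ℕ) : ℕ :=
  Nat.xor (mt (Nat.land w 15) (Nat.shiftRight r 4)) (mt (Nat.shiftRight w 4) (Nat.land r 15))
noncomputable def qN (f w : ℕ) : ℕ := detN w (rowN f w)

/-- bit planes of the second row -/
noncomputable def plane (f k : ℕ) : ℕ :=
  Nat.xor (Nat.xor (Nat.xor (Nat.mul (bit f k) (mc 0)) (Nat.mul (bit f (Nat.add 8 k)) (mc 1)))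
      (Nat.xor (Nat.mul (bit f (Nat.add 16 k)) (mc 2)) (Nat.mul (bit f (Nat.add 24 k)) (mc 3))))
    (Nat.xor (Nat.xor (Nat.mul (bit f (Nat.add 32 k)) (mc 4)) (Nat.mul (bit f (Nat.add 40 k)) (mc 5)))
      (Nat.xor (Nat.mul (bit f (Nat.add 48 k)) (mc 6)) (Nat.mul (bit f (Nat.add 56 k)) (mc 7))))
noncomputable def lit' (p b : ℕ) : ℕ := Bool.rec (motive := fun _ => ℕ) (Nat.xor FULL p) p (Nat.beq b 1)
/-- the set of the first rows with determinant `x` -/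
noncomputable def clsD (p0 p1 p2 p3 x : ℕ) : ℕ :=
  Nat.land (Nat.land (lit' p0 (bit x 0)) (lit' p1 (bit x 1))) (Nat.land (lit' p2 (bit x 2)) (lit' p3 (bit x 3)))
noncomputable def packD (p0 p1 p2 p3 : ℕ) : ℕ :=
  lorN (fun x => Nat.shiftLeft (clsD p0 p1 p2 p3 x) (Nat.mul 256 x)) 16
/-- reduction of a polynomial of degree six -/
noncomputable def redD (c0 c1 c2 c3 c4 c5 c6 : ℕ) : ℕ :=
  packD (Nat.xor c0 c4) (Nat.xor c1 (Nat.xor c4 c5)) (Nat.xor c2 (Nat.xor c5 c6)) (Nat.xor c3 c6)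
noncomputable def an2 (a b c d : ℕ) : ℕ := Nat.xor (Nat.land (mc a) b) (Nat.land (mc c) d)
noncomputable def mulD (r0 r1 r2 r3 r4 r5 r6 r7 : ℕ) : ℕ :=
  redD (an2 0 r4 4 r0) (Nat.xor (an2 0 r5 4 r1) (an2 1 r4 5 r0))
    (Nat.xor (Nat.xor (an2 0 r6 4 r2) (an2 1 r5 5 r1)) (an2 2 r4 6 r0))
    (Nat.xor (Nat.xor (an2 0 r7 4 r3) (an2 1 r6 5 r2)) (Nat.xor (an2 2 r5 6 r1) (an2 3 r4 7 r0)))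
    (Nat.xor (Nat.xor (an2 1 r7 5 r3) (an2 2 r6 6 r2)) (an2 3 r5 7 r1))
    (Nat.xor (an2 2 r7 6 r3) (an2 3 r6 7 r2)) (an2 3 r7 7 r3)
noncomputable def CB (f : ℕ) : ℕ :=
  mulD (plane f 0) (plane f 1) (plane f 2) (plane f 3) (plane f 4) (plane f 5) (plane f 6) (plane f 7)
noncomputable def cl (B x : ℕ) : ℕ := Nat.land (Nat.shiftRight B (Nat.mul 256 x)) FULL
noncomputable def M16 : ℕ := Nat.div FULL 65535
noncomputable def pop (v : ℕ) : ℕ :=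
  Nat.mod (sumN (fun s => Nat.land (Nat.shiftRight v s) M16) 16) 65535
/-- sizes of the classes -/
noncomputable def HB (B : ℕ) : ℕ := lorN (fun x => Nat.shiftLeft (pop (cl B x)) (Nat.mul 16 x)) 16
noncomputable def hh (H x : ℕ) : ℕ := Nat.land (Nat.shiftRight H (Nat.mul 16 x)) 65535
noncomputable def keyN (H : ℕ) : ℕ :=
  Nat.mod (sumN (fun x => Nat.pow 2 (Nat.mul 4 (hh H (Nat.succ x)))) 15) 10019
noncomputable def vr (n r x : ℕ) : ℕ := mt n (frN r x)
noncomputable def histok (Hi Hj n r : ℕ) : Bool :=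
  Nat.rec (motive := fun _ => Bool) true (fun x ih =>
    Bool.rec (motive := fun _ => Bool) false ih
      (Nat.beq (hh Hi (Nat.succ x)) (hh Hj (vr n r (Nat.succ x))))) 15
/-- translate of a set -/
noncomputable def trW (w x : ℕ) : ℕ :=
  Nat.rec (motive := fun _ => ℕ) x (fun k acc =>
    Bool.rec (motive := fun _ => ℕ) acc (cswap k (lm k) acc) (Nat.beq (bit w k) 1)) 8
/-- sum over the elements of a set -/
noncomputable def so (F : ℕ → ℕ) (k : ℕ) : ℕ → ℕ → ℕ :=
  Nat.rec (motive := fun _ => ℕ → ℕ → ℕ)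
    (fun base s => Bool.rec (motive := fun _ => ℕ) (F base) 0 (Nat.beq s 0))
    (fun k ih base s => Bool.rec (motive := fun _ => ℕ)
      (Nat.add (ih base (Nat.mod s (Nat.pow 2 (Nat.pow 2 k))))
        (ih (Nat.add base (Nat.pow 2 k)) (Nat.shiftRight s (Nat.pow 2 k)))) 0 (Nat.beq s 0)) k
noncomputable def cand (tgt : ℕ → ℕ) (b : ℕ) (prev : List (ℕ × ℕ)) : ℕ :=
  List.rec (motive := fun _ => ℕ) (tgt b) (fun p _ s =>
    Bool.rec (motive := fun _ => ℕ) (Nat.land s (trW p.2 (tgt (Nat.xor b p.1)))) 0 (Nat.beq s 0)) prev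
noncomputable def dfs (tgt : ℕ → ℕ) (leaf : List (ℕ × ℕ) → ℕ) (bs : List ℕ) : List (ℕ × ℕ) → ℕ :=
  List.rec (motive := fun _ => List (ℕ × ℕ) → ℕ) leaf
    (fun b _ ih prev => so (fun w => ih (List.cons (Prod.mk b w) prev)) 8 0 (cand tgt b prev)) bs

/-- entries of the product `A · adj B`, as one number -/
noncomputable def madj (w r w' r' : ℕ) : ℕ :=
  (fun a b c d e f g h => Nat.add (Nat.add (Nat.xor (mt a h) (mt b g)) (Nat.mul 16 (Nat.xor (mt a f) (mt b e))))
     (Nat.add (Nat.mul 256 (Nat.xor (mt c h) (mt d g))) (Nat.mul 4096 (Nat.xor (mt c f) (mt d e)))))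
    (nib w 0) (nib w 1) (nib r 0) (nib r 1) (nib w' 0) (nib w' 1) (nib r' 0) (nib r' 1)
/-- trace of the product -/
noncomputable def trm (m n : ℕ) : ℕ :=
  Nat.xor (Nat.xor (mt (nib m 0) (nib n 0)) (mt (nib m 1) (nib n 2)))
    (Nat.xor (mt (nib m 2) (nib n 1)) (mt (nib m 3) (nib n 3)))
noncomputable def ttN (f w1 w2 w3 w4 : ℕ) : ℕ :=
  trm (madj w1 (rowN f w1) w2 (rowN f w2)) (madj w3 (rowN f w3) w4 (rowN f w4))
noncomputable def getw (l : List (ℕ × ℕ)) (b : ℕ) : ℕ :=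
  List.rec (motive := fun _ => ℕ) 0 (fun p _ ih => Bool.rec (motive := fun _ => ℕ) ih p.2 (Nat.beq p.1 b)) l
noncomputable def leafN (fj tgt : ℕ) (l : List (ℕ × ℕ)) : ℕ :=
  Bool.rec (motive := fun _ => ℕ) 0 1
    (Nat.beq (ttN fj (getw l 1) (getw l 16) (getw l 2) (getw l 32)) tgt)
noncomputable def Snr (ord : List ℕ) (fi fj n r : ℕ) : ℕ :=
  dfs (fun b => cl (CB fj) (vr n r (qN fi b))) (leafN fj (mt (mt n n) (frN r (ttN fi 1 16 2 32)))) ord []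
noncomputable def SS (ord : List ℕ) (fi fj : ℕ) : ℕ :=
  sumN (fun r => sumN (fun m => Bool.rec (motive := fun _ => ℕ) 0 (Snr ord fi fj (Nat.succ m) r)
    (histok (HB (CB fi)) (HB (CB fj)) (Nat.succ m) r)) 15) 4
/-- the matrices with first rows `1, 16, 2, 32` span -/
noncomputable def spanN (f : ℕ) : ℕ :=
  (fun a b => detN a b) (Nat.xor (byt f 1) (Nat.add (mt 2 (nib (byt f 0) 0)) (Nat.mul 16 (mt 2 (nib (byt f 0) 1)))))
    (Nat.xor (byt f 5) (Nat.add (mt 2 (nib (byt f 4) 0)) (Nat.mul 16 (mt 2 (nib (byt f 4) 1)))))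

/-- the code is admissible, spanning, has the given key and at most `s` self-equivalences -/
noncomputable def okSelf (k f s : ℕ) : Bool :=
  and (Nat.beq (cl (CB f) 0) 1) (and (not (Nat.beq (spanN f) 0))
    (and (Nat.beq (keyN (HB (CB f))) k) (Nat.ble (SS [1, 16, 2, 32, 4] f f) s)))
noncomputable def okPair (f g : ℕ) : Bool := Nat.beq (SS [1, 16, 2, 32, 4, 64, 8, 128] f g) 0
noncomputable def okGroup (k : ℕ) (l : List (ℕ × ℕ)) : Bool :=
  List.rec (motive := fun _ => Bool) true (fun p t ih =>
    and (okSelf k p.1 p.2) (and (List.rec (motive := fun _ => Bool) true (fun q _ ih => and (okPair p.1 q.1) ih) t) ih)) l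
noncomputable def okAll (L : List (ℕ × List (ℕ × ℕ))) : Bool :=
  List.rec (motive := fun _ => Bool) true (fun p _ ih => and (okGroup p.1 p.2) ih) L
end MRD

set_option maxRecDepth 100000
set_option exponentiation.threshold 600
namespace MRD

/-! ### what the kernel functions compute -/

theorem bit_eq (n i : ℕ) : bit n i = (n.testBit i).toNat := by
  change (n >>> i) &&& 1 = _
  rw [Nat.and_one_is_mod, Nat.toNat_testBit, Nat.shiftRight_eq_div_pow]

theorem bit_mul_bit (b : Bool) (x k : ℕ) : (Nat.mul b.toNat x).testBit k = (b && x.testBit k) := by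
  change (b.toNat * x).testBit k = _
  cases b <;> simp

theorem byt_bit (f i k : ℕ) (hk : k < 8) : (byt f i).testBit k = f.testBit (8 * i + k) := by
  change ((f >>> (8 * i)) &&& 255).testBit k = _
  rw [Nat.testBit_and, Nat.testBit_shiftRight, show 255 = 2 ^ 8 - 1 by norm_num, Nat.testBit_two_pow_sub_one]
  simp [hk]

theorem xor_bit (a b k : ℕ) : (Nat.xor a b).testBit k = (a.testBit k ^^ b.testBit k) := Nat.testBit_xor ..
theorem land_bit (a b k : ℕ) : (Nat.land a b).testBit k = (a.testBit k && b.testBit k) := Nat.testBit_and ..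

theorem xorN_succ (g : ℕ → ℕ) (n : ℕ) : xorN g (n + 1) = Nat.xor (xorN g n) (g n) := rfl
theorem xorN_zero (g : ℕ → ℕ) : xorN g 0 = 0 := rfl

theorem byt_lt (f i : ℕ) : byt f i < 256 := lt_of_le_of_lt Nat.and_le_right (by norm_num)

theorem xorN_lt (g : ℕ → ℕ) (h : ∀ i, g i < 256) (n : ℕ) : xorN g n < 256 := by
  induction n with
  | zero => rw [xorN_zero]; norm_num
  | succ n ih => rw [xorN_succ]; exact xor_lt_256 ih (h n)

theorem rowN_lt (f w : ℕ) : rowN f w < 256 := by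
  apply xorN_lt
  intro i
  rw [bit_eq]
  change (w.testBit i).toNat * byt f i < 256
  have := byt_lt f i
  cases w.testBit i <;> simp [this]

theorem rowN_bit (f w k : ℕ) (hk : k < 8) : (rowN f w).testBit k =
    ((((((((w.testBit 0 && f.testBit k) ^^ (w.testBit 1 && f.testBit (8 + k))) ^^
    (w.testBit 2 && f.testBit (16 + k))) ^^ (w.testBit 3 && f.testBit (24 + k))) ^^
    (w.testBit 4 && f.testBit (32 + k))) ^^ (w.testBit 5 && f.testBit (40 + k))) ^^
    (w.testBit 6 && f.testBit (48 + k))) ^^ (w.testBit 7 && f.testBit (56 + k))) := by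
  unfold rowN
  simp only [xorN_succ, xorN_zero, xor_bit, bit_eq, bit_mul_bit, byt_bit _ _ _ hk, Nat.zero_testBit,
    Bool.false_xor]
  norm_num

theorem plane_bit (f w k : ℕ) (hw : w < 256) (hk : k < 8) : (plane f k).testBit w = (rowN f w).testBit k := by
  rw [rowN_bit f w k hk]
  unfold plane
  simp only [xor_bit, bit_eq, bit_mul_bit]
  rw [mc_bit 0 (by norm_num) w hw, mc_bit 1 (by norm_num) w hw, mc_bit 2 (by norm_num) w hw,
    mc_bit 3 (by norm_num) w hw, mc_bit 4 (by norm_num) w hw, mc_bit 5 (by norm_num) w hw,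
    mc_bit 6 (by norm_num) w hw, mc_bit 7 (by norm_num) w hw]
  simp only [Nat.add_eq, Bool.xor_assoc, Bool.and_comm]

theorem mt_bits : ∀ a < 16, ∀ b < 16,
    (mt a b).testBit 0 = ((a.testBit 0 && b.testBit 0) ^^ ((a.testBit 1 && b.testBit 3) ^^
      (a.testBit 2 && b.testBit 2) ^^ (a.testBit 3 && b.testBit 1))) ∧
    (mt a b).testBit 1 = (((a.testBit 0 && b.testBit 1) ^^ (a.testBit 1 && b.testBit 0)) ^^
      ((a.testBit 1 && b.testBit 3) ^^ (a.testBit 2 && b.testBit 2) ^^ (a.testBit 3 && b.testBit 1)) ^^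
      ((a.testBit 2 && b.testBit 3) ^^ (a.testBit 3 && b.testBit 2))) ∧
    (mt a b).testBit 2 = (((a.testBit 0 && b.testBit 2) ^^ (a.testBit 1 && b.testBit 1) ^^
      (a.testBit 2 && b.testBit 0)) ^^
      ((a.testBit 2 && b.testBit 3) ^^ (a.testBit 3 && b.testBit 2)) ^^ (a.testBit 3 && b.testBit 3)) ∧
    (mt a b).testBit 3 = (((a.testBit 0 && b.testBit 3) ^^ (a.testBit 1 && b.testBit 2) ^^
      (a.testBit 2 && b.testBit 1) ^^ (a.testBit 3 && b.testBit 0)) ^^ (a.testBit 3 && b.testBit 3)) := by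
  decide +kernel

theorem lo_bit (w k : ℕ) (hk : k < 4) : (Nat.land w 15).testBit k = w.testBit k := by
  rw [land_bit, show 15 = 2 ^ 4 - 1 by norm_num, Nat.testBit_two_pow_sub_one]; simp [hk]
theorem hi_bit (w k : ℕ) : (Nat.shiftRight w 4).testBit k = w.testBit (4 + k) := Nat.testBit_shiftRight ..
theorem lo_lt (w : ℕ) : Nat.land w 15 < 16 := lt_of_le_of_lt Nat.and_le_right (by norm_num)
theorem hi_lt {w : ℕ} (hw : w < 256) : Nat.shiftRight w 4 < 16 := by
  change w >>> 4 < 16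
  rw [Nat.shiftRight_eq_div_pow]; omega

theorem detN_lt (w r : ℕ) : detN w r < 16 := xor_lt16 (mt_lt _ _) (mt_lt _ _)
theorem qN_lt (f w : ℕ) : qN f w < 16 := detN_lt _ _

theorem bits_eq_iff : ∀ x < 16, ∀ y < 16, (x = y ↔ (x.testBit 0 = y.testBit 0 ∧ x.testBit 1 = y.testBit 1 ∧
    x.testBit 2 = y.testBit 2 ∧ x.testBit 3 = y.testBit 3)) := by decide +kernel

theorem FULL_eq : FULL = 2 ^ 256 - 1 := rfl

theorem lit_bit (p : ℕ) (b : Bool) (w : ℕ) (hw : w < 256) :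
    (lit' p b.toNat).testBit w = (p.testBit w == b) := by
  cases b
  · change (Nat.xor FULL p).testBit w = _
    rw [xor_bit, FULL_eq, Nat.testBit_two_pow_sub_one]
    simp [hw]
  · change p.testBit w = _
    simp

theorem clsD_bit (p0 p1 p2 p3 x w : ℕ) (hw : w < 256) : (clsD p0 p1 p2 p3 x).testBit w =
    (((p0.testBit w == x.testBit 0) && (p1.testBit w == x.testBit 1)) &&
      ((p2.testBit w == x.testBit 2) && (p3.testBit w == x.testBit 3))) := by
  unfold clsD
  simp only [land_bit, bit_eq, lit_bit _ _ _ hw]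

theorem land_lt {a b n : ℕ} (h : a < n) : Nat.land a b < n := lt_of_le_of_lt Nat.and_le_left h

theorem lit_lt {p : ℕ} (hp : p < 2 ^ 256) (b : ℕ) : lit' p b < 2 ^ 256 := by
  unfold lit'
  cases Nat.beq b 1
  · exact Nat.xor_lt_two_pow FULL_lt hp
  · exact hp

/-- extraction of a field from a packed number -/
theorem unpack (g : ℕ → ℕ) (m n x : ℕ) (hg : ∀ i < n, g i < 2 ^ m) (hx : x < n) :
    Nat.land (Nat.shiftRight (lorN (fun i => Nat.shiftLeft (g i) (Nat.mul m i)) n) (Nat.mul m x)) (2 ^ m - 1)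
      = g x := by
  apply Nat.eq_of_testBit_eq
  intro j
  rw [land_bit, Nat.testBit_two_pow_sub_one]
  change ((lorN (fun i => Nat.shiftLeft (g i) (Nat.mul m i)) n >>> (m * x)).testBit j && _) = _
  rw [Nat.testBit_shiftRight]
  by_cases hj : j < m
  · simp only [hj, decide_true, Bool.and_true]
    rw [Bool.eq_iff_iff, lorN_bit]
    constructor
    · rintro ⟨i, hi, h⟩
      change ((g i) <<< (m * i)).testBit (m * x + j) = true at h
      rw [Nat.testBit_shiftLeft, Bool.and_eq_true, decide_eq_true_eq] at h
      obtain ⟨h1, h2⟩ := h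
      have h3 : m * x + j - m * i < m := by
        by_contra h4
        rw [Nat.testBit_lt_two_pow (lt_of_lt_of_le (hg i hi) (Nat.pow_le_pow_right (by norm_num) (not_lt.1 h4)))] at h2
        exact absurd h2 (by simp)
      have h5 : i = x := by
        rcases lt_trichotomy i x with h | h | h
        · have : m * (i + 1) ≤ m * x := Nat.mul_le_mul_left _ h
          rw [Nat.mul_add] at this; omega
        · exact h
        · have : m * (x + 1) ≤ m * i := Nat.mul_le_mul_left _ h
          rw [Nat.mul_add] at this; omega
      subst h5
      rwa [Nat.add_sub_cancel_left] at h2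
    · intro h
      refine ⟨x, hx, ?_⟩
      change ((g x) <<< (m * x)).testBit (m * x + j) = true
      rw [Nat.testBit_shiftLeft, Nat.add_sub_cancel_left, h]; simp
  · simp only [hj, decide_false, Bool.and_false]
    exact (Nat.testBit_lt_two_pow (lt_of_lt_of_le (hg x hx) (Nat.pow_le_pow_right (by norm_num) (not_lt.1 hj)))).symm

theorem an2_bit (a b c d w : ℕ) (hw : w < 256) (ha : a < 8) (hc : c < 8) :
    (an2 a b c d).testBit w = ((w.testBit a && b.testBit w) ^^ (w.testBit c && d.testBit w)) := by
  unfold an2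
  rw [xor_bit, land_bit, land_bit, mc_bit a ha w hw, mc_bit c hc w hw]

theorem an2_lt {a b c d : ℕ} (ha : a < 8) (hc : c < 8) : an2 a b c d < 2 ^ 256 :=
  Nat.xor_lt_two_pow (land_lt (mc_lt a ha)) (land_lt (mc_lt c hc))

theorem xlt {a b : ℕ} (ha : a < 2 ^ 256) (hb : b < 2 ^ 256) : Nat.xor a b < 2 ^ 256 := Nat.xor_lt_two_pow ha hb

theorem cl_packD (p0 p1 p2 p3 x : ℕ) (h : p0 < 2 ^ 256) (hx : x < 16) : cl (packD p0 p1 p2 p3) x = clsD p0 p1 p2 p3 x :=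
  unpack (clsD p0 p1 p2 p3) 256 16 x (fun _ _ => land_lt (land_lt (lit_lt h _))) hx

instance xorComm : Std.Commutative Bool.xor := ⟨Bool.xor_comm⟩

theorem cl_bit (f x w : ℕ) (hx : x < 16) (hw : w < 256) :
    (cl (CB f) x).testBit w = decide (qN f w = x) := by
  unfold CB mulD redD
  rw [cl_packD _ _ _ _ _ (xlt (an2_lt (by norm_num) (by norm_num))
    (xlt (xlt (an2_lt (by norm_num) (by norm_num)) (an2_lt (by norm_num) (by norm_num))) (an2_lt (by norm_num) (by norm_num)))) hx]
  rw [clsD_bit _ _ _ _ _ _ hw]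
  have key := bits_eq_iff (qN f w) (qN_lt f w) x hx
  have hr := rowN_lt f w
  obtain ⟨m0, m1, m2, m3⟩ := mt_bits _ (lo_lt w) _ (hi_lt hr)
  obtain ⟨n0, n1, n2, n3⟩ := mt_bits _ (hi_lt hw) _ (lo_lt (rowN f w))
  rw [Bool.eq_iff_iff, decide_eq_true_eq, key]
  unfold qN detN
  simp only [xor_bit, m0, m1, m2, m3, n0, n1, n2, n3]
  rw [lo_bit _ 0 (by norm_num), lo_bit _ 1 (by norm_num), lo_bit _ 2 (by norm_num), lo_bit _ 3 (by norm_num),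
    lo_bit _ 0 (by norm_num), lo_bit _ 1 (by norm_num), lo_bit _ 2 (by norm_num), lo_bit _ 3 (by norm_num)]
  simp only [hi_bit]
  simp only [Nat.reduceAdd]
  rw [an2_bit _ _ _ _ _ hw (by norm_num) (by norm_num), an2_bit _ _ _ _ _ hw (by norm_num) (by norm_num),
    an2_bit _ _ _ _ _ hw (by norm_num) (by norm_num), an2_bit _ _ _ _ _ hw (by norm_num) (by norm_num),
    an2_bit _ _ _ _ _ hw (by norm_num) (by norm_num), an2_bit _ _ _ _ _ hw (by norm_num) (by norm_num),
    an2_bit _ _ _ _ _ hw (by norm_num) (by norm_num), an2_bit _ _ _ _ _ hw (by norm_num) (by norm_num),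
    an2_bit _ _ _ _ _ hw (by norm_num) (by norm_num), an2_bit _ _ _ _ _ hw (by norm_num) (by norm_num),
    an2_bit _ _ _ _ _ hw (by norm_num) (by norm_num), an2_bit _ _ _ _ _ hw (by norm_num) (by norm_num),
    an2_bit _ _ _ _ _ hw (by norm_num) (by norm_num), an2_bit _ _ _ _ _ hw (by norm_num) (by norm_num),
    an2_bit _ _ _ _ _ hw (by norm_num) (by norm_num), an2_bit _ _ _ _ _ hw (by norm_num) (by norm_num)]
  rw [plane_bit f w 0 hw (by norm_num), plane_bit f w 1 hw (by norm_num), plane_bit f w 2 hw (by norm_num),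
    plane_bit f w 3 hw (by norm_num), plane_bit f w 4 hw (by norm_num), plane_bit f w 5 hw (by norm_num),
    plane_bit f w 6 hw (by norm_num), plane_bit f w 7 hw (by norm_num)]
  generalize (rowN f w).testBit 0 = r0
  generalize (rowN f w).testBit 1 = r1
  generalize (rowN f w).testBit 2 = r2
  generalize (rowN f w).testBit 3 = r3
  generalize (rowN f w).testBit 4 = r4
  generalize (rowN f w).testBit 5 = r5
  generalize (rowN f w).testBit 6 = r6
  generalize (rowN f w).testBit 7 = r7
  simp only [Bool.and_eq_true, beq_iff_eq, and_assoc]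
  refine and_congr ?_ (and_congr ?_ (and_congr ?_ ?_)) <;>
  · refine Eq.congr_left ?_
    ac_rfl

end MRD

set_option maxRecDepth 100000
set_option exponentiation.threshold 600
namespace MRD

/-! ### population counts -/

/-- sixteen-spaced ones -/
def MM16 : ℕ → ℕ
  | 0 => 0
  | n + 1 => 1 + 2 ^ 16 * MM16 n

theorem M16_eq : M16 = MM16 16 := by decide +kernel

theorem land_MM16 (n u : ℕ) : u &&& MM16 (n + 1) = u % 2 + 2 ^ 16 * ((u / 2 ^ 16) &&& MM16 n) := by
  have h := land_block (w := 16) (a := u / 2 ^ 16) (b := u % 2 ^ 16) (a' := MM16 n) (b' := 1)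
    (Nat.mod_lt _ (by norm_num)) (by norm_num)
  rw [Nat.mod_add_div] at h
  have h2 : u % 2 ^ 16 &&& 1 = u % 2 := by
    rw [Nat.and_one_is_mod]; omega
  change u &&& (1 + 2 ^ 16 * MM16 n) = _
  refine h.trans ?_
  change (u % 2 ^ 16 &&& 1) + _ = _
  rw [h2]; rfl

theorem land_MM16_mod (n : ℕ) : ∀ u, (u &&& MM16 n) % 65535 =
    (∑ i ∈ Finset.range n, (u.testBit (16 * i)).toNat) % 65535 := by
  induction n with
  | zero => intro u; simp [MM16]
  | succ n ih =>
    intro u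
    rw [land_MM16, Finset.sum_range_succ', Nat.add_mod, Nat.mul_mod, ih]
    have : ∀ i, u.testBit (16 * (i + 1)) = (u / 2 ^ 16).testBit (16 * i) := by
      intro i
      rw [← Nat.shiftRight_eq_div_pow, Nat.testBit_shiftRight]
      congr 1; ring
    simp only [this]
    have h0 : (u.testBit (16 * 0)).toNat = u % 2 := by
      rw [Nat.toNat_testBit]; norm_num
    rw [h0]
    generalize ∑ i ∈ Finset.range n, ((u / 2 ^ 16).testBit (16 * i)).toNat = S
    omega

theorem sum_range_256 (g : ℕ → ℕ) : ∑ s ∈ Finset.range 16, ∑ i ∈ Finset.range 16, g (s + 16 * i) =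
    ∑ w ∈ Finset.range 256, g w := by
  rw [← Finset.sum_product']
  refine Finset.sum_bij' (fun p _ => p.1 + 16 * p.2) (fun w _ => (w % 16, w / 16)) ?_ ?_ ?_ ?_ ?_
  · rintro ⟨a, b⟩ h; simp only [Finset.mem_product, Finset.mem_range] at h ⊢; omega
  · intro w h; simp only [Finset.mem_product, Finset.mem_range] at h ⊢; omega
  · rintro ⟨a, b⟩ h; simp only [Finset.mem_product, Finset.mem_range] at h
    simp only [Prod.mk.injEq]; omega
  · intro w h; simp only; omega
  · rintro ⟨a, b⟩ h; rfl

theorem pop_eq (v : ℕ) : pop v = ((Finset.range 256).filter (fun w => v.testBit w = true)).card := by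
  unfold pop
  rw [sumN_eq, M16_eq]
  change (∑ s ∈ Finset.range 16, (v >>> s &&& MM16 16)) % 65535 = _
  rw [Finset.sum_nat_mod]
  simp only [land_MM16_mod]
  rw [← Finset.sum_nat_mod]
  simp only [Nat.testBit_shiftRight]
  rw [sum_range_256 (fun w => (v.testBit w).toNat)]
  rw [Finset.card_filter]
  have : ∀ w, (v.testBit w).toNat = if v.testBit w = true then 1 else 0 := by
    intro w; cases v.testBit w <;> rfl
  simp only [this]
  rw [← Finset.card_filter]
  apply Nat.mod_eq_of_lt
  refine (Finset.card_filter_le _ _).trans_lt ?_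
  rw [Finset.card_range]; norm_num

theorem pop_lt (v : ℕ) : pop v < 2 ^ 16 := by
  rw [pop_eq]
  refine (Finset.card_filter_le _ _).trans_lt ?_
  rw [Finset.card_range]; norm_num

theorem hh_eq (f x : ℕ) (hx : x < 16) : hh (HB (CB f)) x =
    ((Finset.range 256).filter (fun w => qN f w = x)).card := by
  have h := unpack (fun x => pop (cl (CB f) x)) 16 16 x (fun i _ => pop_lt _) hx
  have h1 : hh (HB (CB f)) x = pop (cl (CB f) x) := h
  rw [h1, pop_eq]
  congr 1
  apply Finset.filter_congr
  intro w hw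
  rw [cl_bit f x w hx (by simpa using hw), decide_eq_true_eq]

theorem frN_lt (r : ℕ) {x : ℕ} (hx : x < 16) : frN r x < 16 := by
  cases r with
  | zero => exact hx
  | succ r => exact mt_lt _ _

theorem frN_inj : ∀ r < 4, ∀ x < 16, ∀ y < 16, frN r x = frN r y → x = y := by decide +kernel
theorem mt_inj : ∀ n < 16, n ≠ 0 → ∀ x < 16, ∀ y < 16, mt n x = mt n y → x = y := by decide +kernel
theorem vr_lt (n r x : ℕ) : vr n r x < 16 := mt_lt _ _
theorem vr_inj {n r x y : ℕ} (hr : r < 4) (hn : n < 16) (h0 : n ≠ 0) (hx : x < 16) (hy : y < 16)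
    (h : vr n r x = vr n r y) : x = y :=
  frN_inj r hr x hx y hy (mt_inj n hn h0 _ (frN_lt r hx) _ (frN_lt r hy) h)
theorem vr_zero : ∀ n < 16, ∀ r < 4, vr n r 0 = 0 := by decide +kernel
theorem vr_ne {n r x : ℕ} (hn : n < 16) (h0 : n ≠ 0) (hr : r < 4) (hx : x < 16) (hx0 : x ≠ 0) :
    vr n r x ≠ 0 := fun h =>
  hx0 (vr_inj hr hn h0 hx (by norm_num) (h.trans (vr_zero n hn r hr).symm))

/-- numerical data of an equivalence of two codes -/
structure Iso (fi fj n r : ℕ) (s : ℕ → ℕ) : Prop where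
  lt : ∀ w < 256, s w < 256
  add : ∀ w < 256, ∀ w' < 256, s (w ^^^ w') = s w ^^^ s w'
  inj : ∀ w < 256, ∀ w' < 256, s w = s w' → w = w'
  q : ∀ w < 256, qN fj (s w) = vr n r (qN fi w)
  n_lt : n < 16
  n_ne : n ≠ 0
  r_lt : r < 4
  tt : ttN fj (s 1) (s 16) (s 2) (s 32) = mt (mt n n) (frN r (ttN fi 1 16 2 32))

theorem Iso.hist {fi fj n r : ℕ} {s : ℕ → ℕ} (h : Iso fi fj n r s) (x : ℕ) (hx : x < 16) :
    hh (HB (CB fi)) x = hh (HB (CB fj)) (vr n r x) := by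
  rw [hh_eq _ _ hx, hh_eq _ _ (vr_lt _ _ _)]
  have hs : Set.SurjOn s (Finset.range 256) (Finset.range 256) := by
    apply Finset.surjOn_of_injOn_of_card_le
    · intro w hw; simpa using h.lt w (by simpa using hw)
    · intro w hw w' hw' e; exact h.inj w (by simpa using hw) w' (by simpa using hw') e
    · exact le_rfl
  apply Finset.card_bij (fun w _ => s w)
  · intro w hw
    simp only [Finset.mem_filter, Finset.mem_range] at hw ⊢
    exact ⟨h.lt w hw.1, by rw [h.q w hw.1, hw.2]⟩
  · intro w hw w' hw' e
    simp only [Finset.mem_filter, Finset.mem_range] at hw hw'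
    exact h.inj w hw.1 w' hw'.1 e
  · intro y hy
    simp only [Finset.mem_filter, Finset.mem_range] at hy
    obtain ⟨w, hw, rfl⟩ := hs (by simpa using hy.1)
    have hw' : w < 256 := by simpa using hw
    refine ⟨w, ?_, rfl⟩
    simp only [Finset.mem_filter, Finset.mem_range]
    refine ⟨hw', ?_⟩
    have := hy.2
    rw [h.q w hw'] at this
    exact vr_inj h.r_lt h.n_lt h.n_ne (qN_lt _ _) hx this

theorem histok_succ (Hi Hj n r m : ℕ) (ih : Nat.rec (motive := fun _ => Bool) true (fun x ih =>
    Bool.rec (motive := fun _ => Bool) false ih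
      (Nat.beq (hh Hi (Nat.succ x)) (hh Hj (vr n r (Nat.succ x))))) m = true)
    (e : hh Hi (Nat.succ m) = hh Hj (vr n r (Nat.succ m))) : Nat.rec (motive := fun _ => Bool) true (fun x ih =>
    Bool.rec (motive := fun _ => Bool) false ih
      (Nat.beq (hh Hi (Nat.succ x)) (hh Hj (vr n r (Nat.succ x))))) (m + 1) = true := by
  have e2 : Nat.beq (hh Hi (Nat.succ m)) (hh Hj (vr n r (Nat.succ m))) = true := by
    rw [e]; exact Nat.beq_refl _
  simp only [e2, ih]

theorem histok_of {Hi Hj n r : ℕ} (h : ∀ x < 16, hh Hi x = hh Hj (vr n r x)) : histok Hi Hj n r = true := by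
  unfold histok
  have key : ∀ m, m ≤ 15 → Nat.rec (motive := fun _ => Bool) true (fun x ih =>
    Bool.rec (motive := fun _ => Bool) false ih
      (Nat.beq (hh Hi (Nat.succ x)) (hh Hj (vr n r (Nat.succ x))))) m = true := by
    intro m
    induction m with
    | zero => intro _; rfl
    | succ m ih => intro hm; exact histok_succ Hi Hj n r m (ih (by omega)) (h _ (by omega))
  exact key 15 le_rfl

theorem key_of {Hi Hj n r : ℕ} (h : ∀ x < 16, hh Hi x = hh Hj (vr n r x)) (hn : n < 16) (h0 : n ≠ 0)
    (hr : r < 4) : keyN Hi = keyN Hj := by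
  unfold keyN
  rw [sumN_eq, sumN_eq]
  have hne : ∀ x, x < 15 → 1 ≤ vr n r (x + 1) ∧ vr n r (x + 1) < 16 := fun x hx =>
    ⟨Nat.one_le_iff_ne_zero.2 (vr_ne hn h0 hr (by omega) (by omega)), vr_lt _ _ _⟩
  have hinj : Set.InjOn (fun x => vr n r (x + 1) - 1) (Finset.range 15) := by
    intro x hx y hy e
    have hx' : x < 15 := by simpa using hx
    have hy' : y < 15 := by simpa using hy
    have h1 := hne x hx'
    have h2 := hne y hy'
    have e' : vr n r (x + 1) - 1 = vr n r (y + 1) - 1 := e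
    have := vr_inj (x := x + 1) (y := y + 1) hr hn h0 (by omega) (by omega) (by omega)
    omega
  have hmaps : Set.MapsTo (fun x => vr n r (x + 1) - 1) (Finset.range 15) (Finset.range 15) := by
    intro x hx
    have h1 := hne x (by simpa using hx)
    simp only [Finset.coe_range, Set.mem_Iio]; omega
  have hs := Finset.surjOn_of_injOn_of_card_le _ hmaps hinj le_rfl
  have key : ∑ x ∈ Finset.range 15, Nat.pow 2 (Nat.mul 4 (hh Hi (Nat.succ x))) =
      ∑ x ∈ Finset.range 15, Nat.pow 2 (Nat.mul 4 (hh Hj (Nat.succ x))) := by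
    refine Finset.sum_bij (fun x _ => vr n r (x + 1) - 1) ?_ ?_ ?_ ?_
    · intro x hx; exact_mod_cast hmaps (by exact_mod_cast hx)
    · intro x hx y hy e; exact hinj (by exact_mod_cast hx) (by exact_mod_cast hy) e
    · intro y hy
      obtain ⟨x, hx, e⟩ := hs (by exact_mod_cast hy)
      exact ⟨x, by exact_mod_cast hx, e⟩
    · intro x hx
      have hx' : x < 15 := by simpa using hx
      have h1 := hne x hx'
      have e : (vr n r (x + 1) - 1).succ = vr n r (x + 1) := by omega
      rw [e, ← h (x + 1) (by omega)]
  rw [key]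

theorem Iso.histok {fi fj n r : ℕ} {s : ℕ → ℕ} (h : Iso fi fj n r s) :
    histok (HB (CB fi)) (HB (CB fj)) n r = true := histok_of h.hist

theorem Iso.key {fi fj n r : ℕ} {s : ℕ → ℕ} (h : Iso fi fj n r s) :
    keyN (HB (CB fi)) = keyN (HB (CB fj)) := key_of h.hist h.n_lt h.n_ne h.r_lt

/-! ### translations and sums over sets -/

theorem trW_aux (w x : ℕ) (m : ℕ) : m ≤ 8 → ∀ j < 256,
    (Nat.rec (motive := fun _ => ℕ) x (fun k acc =>
      Bool.rec (motive := fun _ => ℕ) acc (cswap k (lm k) acc) (Nat.beq (bit w k) 1)) m).testBit j =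
    x.testBit (j ^^^ (w % 2 ^ m)) := by
  induction m with
  | zero => intro _ j _; simp [Nat.mod_one]
  | succ m ih =>
    intro hm j hj
    have e : w % 2 ^ (m + 1) = (if w.testBit m then 2 ^ m else 0) ^^^ (w % 2 ^ m) := by
      apply Nat.eq_of_testBit_eq; intro i
      rw [Nat.testBit_xor, Nat.testBit_mod_two_pow, Nat.testBit_mod_two_pow]
      rcases lt_trichotomy i m with h | h | h
      · have h1 : (if w.testBit m then 2 ^ m else 0).testBit i = false := by
          split_ifs
          · rw [Nat.testBit_two_pow]; simp; omega
          · simp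
        rw [h1]; simp [h, Nat.lt_succ_of_lt h]
      · subst h
        cases hw : w.testBit i <;> simp
      · have h1 : (if w.testBit m then 2 ^ m else 0).testBit i = false := by
          split_ifs
          · rw [Nat.testBit_two_pow]; simp; omega
          · simp
        rw [h1]
        have a : ¬ i < m + 1 := by omega
        have b : ¬ i < m := by omega
        simp [a, b]
    rw [e, ← Nat.xor_assoc]
    have hb : Nat.beq (bit w m) 1 = w.testBit m := by rw [bit_eq]; cases w.testBit m <;> rfl
    simp only [hb]
    cases hw : w.testBit m
    · simpa using ih (by omega) j hj
    · have := cswap_bit (k := m) (x := (Nat.rec (motive := fun _ => ℕ) x (fun k acc =>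
        Bool.rec (motive := fun _ => ℕ) acc (cswap k (lm k) acc) (Nat.beq (bit w k) 1)) m)) (j := j) (by omega) hj
      simp only [if_true]
      refine this.trans ?_
      refine ih (by omega) _ (xor_lt_256 hj ?_)
      exact Nat.pow_lt_pow_right (n := 8) (by norm_num) (by omega)

theorem trW_bit {w x j : ℕ} (hw : w < 256) (hj : j < 256) : (trW w x).testBit j = x.testBit (j ^^^ w) := by
  have := trW_aux w x 8 le_rfl j hj
  rw [Nat.mod_eq_of_lt (show w < 2 ^ 8 from hw)] at this
  exact this

theorem so_ge (F : ℕ → ℕ) (k : ℕ) : ∀ base s, (∑ w ∈ Finset.range (2 ^ k), if s.testBit w then F (base + w) else 0)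
    ≤ so F k base s := by
  induction k with
  | zero =>
    intro base s
    change _ ≤ Bool.rec (motive := fun _ => ℕ) (F base) 0 (Nat.beq s 0)
    rw [pow_zero, Finset.sum_range_one]
    cases h : Nat.beq s 0
    · change _ ≤ F base
      split_ifs <;> simp
    · have : s = 0 := Nat.eq_of_beq_eq_true h
      simp [this]
  | succ k ih =>
    intro base s
    change _ ≤ Bool.rec (motive := fun _ => ℕ)
      (Nat.add (so F k base (Nat.mod s (Nat.pow 2 (Nat.pow 2 k))))
        (so F k (Nat.add base (Nat.pow 2 k)) (Nat.shiftRight s (Nat.pow 2 k)))) 0 (Nat.beq s 0)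
    cases h : Nat.beq s 0
    · change _ ≤ so F k base (s % 2 ^ 2 ^ k) + so F k (base + 2 ^ k) (s >>> 2 ^ k)
      rw [pow_succ, mul_two, Finset.sum_range_add]
      refine Nat.add_le_add (le_trans (le_of_eq ?_) (ih base (s % 2 ^ 2 ^ k))) (le_trans (le_of_eq ?_) (ih _ _))
      · apply Finset.sum_congr rfl
        intro w hw
        have hw' : w < 2 ^ k := by simpa using hw
        rw [Nat.testBit_mod_two_pow]; simp [hw']
      · apply Finset.sum_congr rfl
        intro w hw
        rw [Nat.testBit_shiftRight, add_assoc]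
    · have : s = 0 := Nat.eq_of_beq_eq_true h
      simp [this]

/-! ### the search is exhaustive -/

theorem cand_bit (tgt : ℕ → ℕ) (b w : ℕ) (hw : w < 256) (prev : List (ℕ × ℕ))
    (hp : ∀ p ∈ prev, p.2 < 256 ∧ (tgt (b ^^^ p.1)).testBit (w ^^^ p.2) = true) (h : (tgt b).testBit w = true) :
    (cand tgt b prev).testBit w = true := by
  induction prev with
  | nil => exact h
  | cons p t ih =>
    have h1 := ih (fun p hp' => hp p (List.mem_cons_of_mem _ hp'))
    obtain ⟨h2, h3⟩ := hp p List.mem_cons_self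
    change (Bool.rec (motive := fun _ => ℕ) (Nat.land (cand tgt b t) (trW p.2 (tgt (b ^^^ p.1)))) 0
      (Nat.beq (cand tgt b t) 0)).testBit w = true
    cases h4 : Nat.beq (cand tgt b t) 0
    · change (Nat.land (cand tgt b t) (trW p.2 (tgt (b ^^^ p.1)))).testBit w = true
      rw [land_bit, h1, trW_bit h2 hw, h3]; rfl
    · rw [Nat.eq_of_beq_eq_true h4] at h1; simp at h1

theorem dfs_sound {ι : Type} (s : ι → ℕ → ℕ) (tgt : ℕ → ℕ) (leaf : List (ℕ × ℕ) → ℕ) (bs : List ℕ) :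
    ∀ (prev : List (ℕ × ℕ)) (Z : Finset ι),
    (∀ z ∈ Z, ∀ b ∈ bs, s z b < 256 ∧ (tgt b).testBit (s z b) = true ∧
      (∀ b' ∈ bs, (tgt (b ^^^ b')).testBit (s z b ^^^ s z b') = true) ∧
      (∀ p ∈ prev, (tgt (b ^^^ p.1)).testBit (s z b ^^^ p.2) = true)) →
    (∀ p ∈ prev, p.2 < 256) →
    (∀ z ∈ Z, ∀ z' ∈ Z, (∀ b ∈ bs, s z b = s z' b) → z = z') →
    (∀ z ∈ Z, 1 ≤ leaf ((bs.map (fun b => (b, s z b))).reverse ++ prev)) →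
    Z.card ≤ dfs tgt leaf bs prev := by
  classical
  induction bs with
  | nil =>
    intro prev Z _ _ hinj hl
    change Z.card ≤ leaf prev
    rcases Z.eq_empty_or_nonempty with rfl | ⟨z, hz⟩
    · simp
    · have h1 : Z.card ≤ 1 := Finset.card_le_one.2 (fun a ha b hb => hinj a ha b hb (by simp))
      exact h1.trans (by simpa using hl z hz)
  | cons b bs ih =>
    intro prev Z hZ hp hinj hl
    change Z.card ≤ so (fun w => dfs tgt leaf bs ((b, w) :: prev)) 8 0 (cand tgt b prev)
    refine le_trans ?_ (so_ge _ 8 0 _)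
    have h1 : Z.card = ∑ w ∈ Finset.range (2 ^ 8), (Z.filter (fun z => s z b = w)).card := by
      apply Finset.card_eq_sum_card_fiberwise
      intro z hz
      simpa using (hZ z hz b List.mem_cons_self).1
    rw [h1]
    apply Finset.sum_le_sum
    intro w hw
    have hw' : w < 256 := by simpa using hw
    rcases (Z.filter (fun z => s z b = w)).eq_empty_or_nonempty with h0 | ⟨z, hz⟩
    · rw [h0]; simp
    · obtain ⟨hz1, hz2⟩ := Finset.mem_filter.1 hz
      obtain ⟨_, a2, a3, a4⟩ := hZ z hz1 b List.mem_cons_self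
      rw [hz2] at a2 a4
      rw [if_pos (cand_bit tgt b w hw' prev (fun p hp' => ⟨hp p hp', a4 p hp'⟩) a2), Nat.zero_add]
      apply ih
      · intro y hy b' hb'
        obtain ⟨hy1, hy2⟩ := Finset.mem_filter.1 hy
        obtain ⟨c1, c2, c3, c4⟩ := hZ y hy1 b' (List.mem_cons_of_mem _ hb')
        refine ⟨c1, c2, fun b'' hb'' => c3 b'' (List.mem_cons_of_mem _ hb''), ?_⟩
        intro p hp'
        rcases List.mem_cons.1 hp' with rfl | hp'
        · have := c3 b List.mem_cons_self
          rw [hy2] at this; exact this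
        · exact c4 p hp'
      · intro p hp'
        rcases List.mem_cons.1 hp' with rfl | hp'
        · exact hw'
        · exact hp p hp'
      · intro y hy y' hy' e
        obtain ⟨hy1, hy2⟩ := Finset.mem_filter.1 hy
        obtain ⟨hy1', hy2'⟩ := Finset.mem_filter.1 hy'
        apply hinj y hy1 y' hy1'
        intro b' hb'
        rcases List.mem_cons.1 hb' with rfl | hb'
        · rw [hy2, hy2']
        · exact e b' hb'
      · intro y hy
        obtain ⟨hy1, hy2⟩ := Finset.mem_filter.1 hy
        have := hl y hy1
        rw [List.map_cons, List.reverse_cons, List.append_assoc, hy2] at this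
        exact this

end MRD

set_option maxRecDepth 100000
set_option exponentiation.threshold 600
namespace MRD

/-! ### the search bounds the number of equivalences -/

theorem getw_eq (s : ℕ → ℕ) (b : ℕ) (l : List (ℕ × ℕ)) (h : ∀ p ∈ l, p.2 = s p.1) (hb : ∃ p ∈ l, p.1 = b) :
    getw l b = s b := by
  induction l with
  | nil => simp at hb
  | cons p t ih =>
    have e : getw (p :: t) b = Bool.rec (motive := fun _ => ℕ) (getw t b) p.2 (Nat.beq p.1 b) := rfl
    rw [e]
    cases hpb : Nat.beq p.1 b with
    | true =>
      change p.2 = _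
      rw [h p (by simp), Nat.eq_of_beq_eq_true hpb]
    | false =>
      change getw t b = _
      apply ih (fun q hq => h q (by simp [hq]))
      obtain ⟨q, hq, e'⟩ := hb
      rcases List.mem_cons.1 hq with rfl | hq
      · rw [e', Nat.beq_refl] at hpb; cases hpb
      · exact ⟨q, hq, e'⟩

theorem Snr_ge {ι : Type} (ord : List ℕ) (fi fj n r : ℕ) (Z : Finset ι) (s : ι → ℕ → ℕ)
    (ho : ∀ b ∈ ord, b < 256) (h4 : 1 ∈ ord ∧ 16 ∈ ord ∧ 2 ∈ ord ∧ 32 ∈ ord)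
    (hZ : ∀ z ∈ Z, Iso fi fj n r (s z))
    (hi : ∀ z ∈ Z, ∀ z' ∈ Z, s z 1 = s z' 1 → s z 16 = s z' 16 → s z 2 = s z' 2 → s z 32 = s z' 32 → z = z') :
    Z.card ≤ Snr ord fi fj n r := by
  unfold Snr
  apply dfs_sound s
  · intro z hz b hb
    have hI := hZ z hz
    have key : ∀ w < 256, (cl (CB fj) (vr n r (qN fi w))).testBit (s z w) = true := by
      intro w hw
      rw [cl_bit _ _ _ (vr_lt _ _ _) (hI.lt w hw), hI.q w hw]; simp
    refine ⟨hI.lt b (ho b hb), key b (ho b hb), ?_, by simp⟩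
    intro b' hb'
    rw [← hI.add b (ho b hb) b' (ho b' hb')]
    exact key _ (xor_lt_256 (ho b hb) (ho b' hb'))
  · simp
  · intro z hz z' hz' e
    exact hi z hz z' hz' (e 1 h4.1) (e 16 h4.2.1) (e 2 h4.2.2.1) (e 32 h4.2.2.2)
  · intro z hz
    have hg : ∀ b ∈ ord, getw ((ord.map (fun b => (b, s z b))).reverse ++ []) b = s z b := by
      intro b hb
      apply getw_eq
      · intro p hp
        simp only [List.append_nil, List.mem_reverse, List.mem_map] at hp
        obtain ⟨a, _, rfl⟩ := hp; rfl
      · exact ⟨(b, s z b), by simp only [List.append_nil, List.mem_reverse, List.mem_map]; exact ⟨b, hb, rfl⟩, rfl⟩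
    unfold leafN
    rw [hg 1 h4.1, hg 16 h4.2.1, hg 2 h4.2.2.1, hg 32 h4.2.2.2, (hZ z hz).tt, Nat.beq_refl]

theorem sum_fib {ι : Type} (P : ℕ → ℕ → Bool) (S : ℕ → ℕ → ℕ) (Z : Finset ι) (n r : ι → ℕ)
    (h1 : ∀ z ∈ Z, n z < 16 ∧ n z ≠ 0 ∧ r z < 4 ∧ P (n z) (r z) = true)
    (h2 : ∀ n0 r0, ∀ Z' ⊆ Z, (∀ z ∈ Z', n z = n0 ∧ r z = r0) → Z'.card ≤ S n0 r0) :
    Z.card ≤ sumN (fun r => sumN (fun m => Bool.rec (motive := fun _ => ℕ) 0 (S (Nat.succ m) r)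
    (P (Nat.succ m) r)) 15) 4 := by
  classical
  rw [sumN_eq]
  simp only [sumN_eq]
  have hm : ∀ z ∈ Z, (r z, n z - 1) ∈ Finset.range 4 ×ˢ Finset.range 15 := by
    intro z hz
    have h := h1 z hz
    simp only [Finset.mem_product, Finset.mem_range]; omega
  rw [Finset.card_eq_sum_card_fiberwise hm, Finset.sum_product]
  refine Finset.sum_le_sum fun r0 _ => Finset.sum_le_sum fun m _ => ?_
  set Z' := Z.filter (fun z => (r z, n z - 1) = (r0, m)) with hZ'
  rcases Z'.eq_empty_or_nonempty with he | ⟨z0, hz0⟩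
  · rw [he]; simp
  · have key : ∀ z ∈ Z', z ∈ Z ∧ n z = Nat.succ m ∧ r z = r0 := by
      intro z hz
      rw [hZ', Finset.mem_filter, Prod.mk.injEq] at hz
      have := (h1 z hz.1).2.1
      exact ⟨hz.1, by omega, hz.2.1⟩
    obtain ⟨a, b, e⟩ := key z0 hz0
    have hP := (h1 z0 a).2.2.2
    rw [b, e] at hP
    rw [hP]
    exact h2 _ _ Z' (Finset.filter_subset _ _) (fun z hz => (key z hz).2)

theorem SS_ge {ι : Type} (ord : List ℕ) (fi fj : ℕ) (Z : Finset ι) (n r : ι → ℕ) (s : ι → ℕ → ℕ)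
    (ho : ∀ b ∈ ord, b < 256) (h4 : 1 ∈ ord ∧ 16 ∈ ord ∧ 2 ∈ ord ∧ 32 ∈ ord)
    (hZ : ∀ z ∈ Z, Iso fi fj (n z) (r z) (s z))
    (hi : ∀ z ∈ Z, ∀ z' ∈ Z, n z = n z' → r z = r z' →
      s z 1 = s z' 1 → s z 16 = s z' 16 → s z 2 = s z' 2 → s z 32 = s z' 32 → z = z') :
    Z.card ≤ SS ord fi fj := by
  refine sum_fib (histok (HB (CB fi)) (HB (CB fj))) (Snr ord fi fj) Z n r ?_ ?_
  · intro z hz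
    have h := hZ z hz
    exact ⟨h.n_lt, h.n_ne, h.r_lt, h.histok⟩
  · intro n0 r0 Z' hs hk
    apply Snr_ge ord fi fj _ _ Z' s ho h4
    · intro z hz
      rw [← (hk z hz).1, ← (hk z hz).2]; exact hZ z (hs hz)
    · intro z hz z' hz'
      exact hi z (hs hz) z' (hs hz') ((hk z hz).1.trans (hk z' hz').1.symm) ((hk z hz).2.trans (hk z' hz').2.symm)

end MRD

set_option maxRecDepth 100000
set_option exponentiation.threshold 600
namespace MRD
open Cod

/-! ### the codes belonging to the numbers -/

theorem nib_xor (a b i : ℕ) : nib (a ^^^ b) i = nib a i ^^^ nib b i := by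
  change ((a ^^^ b) >>> (4 * i)) &&& 15 = ((a >>> (4 * i)) &&& 15) ^^^ ((b >>> (4 * i)) &&& 15)
  rw [Nat.shiftRight_xor_distrib, Nat.and_xor_distrib_right]

theorem rowN_xor (f w w' : ℕ) : rowN f (w ^^^ w') = rowN f w ^^^ rowN f w' := by
  apply Nat.eq_of_testBit_eq
  intro i
  by_cases hi : i < 8
  · rw [Nat.testBit_xor, rowN_bit _ _ _ hi, rowN_bit _ _ _ hi, rowN_bit _ _ _ hi]
    simp only [Nat.testBit_xor, Bool.and_xor_distrib_right]
    generalize (w.testBit 0 && _) = a0, (w.testBit 1 && _) = a1, (w.testBit 2 && _) = a2,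
      (w.testBit 3 && _) = a3, (w.testBit 4 && _) = a4, (w.testBit 5 && _) = a5,
      (w.testBit 6 && _) = a6, (w.testBit 7 && _) = a7
    ac_rfl
  · have h : ∀ x, x < 256 → x.testBit i = false := fun x hx =>
      Nat.testBit_lt_two_pow (hx.trans_le ((by norm_num : 256 = 2 ^ 8).le.trans (Nat.pow_le_pow_right (by norm_num) (by omega))))
    rw [h _ (rowN_lt _ _), h _ (xor_lt_256 (rowN_lt _ _) (rowN_lt _ _))]

theorem nib_zero_eq (w : ℕ) : nib w 0 = w % 16 := by
  change (w >>> 0) &&& 15 = _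
  rw [Nat.shiftRight_zero]; exact Nat.and_two_pow_sub_one_eq_mod w 4
theorem nib_one_eq (w : ℕ) : nib w 1 = w / 16 % 16 := by
  change (w >>> 4) &&& 15 = _
  rw [Nat.shiftRight_eq_div_pow]; exact Nat.and_two_pow_sub_one_eq_mod _ 4
theorem nib_two_eq (w : ℕ) : nib w 2 = w / 256 % 16 := by
  change (w >>> 8) &&& 15 = _
  rw [Nat.shiftRight_eq_div_pow]; exact Nat.and_two_pow_sub_one_eq_mod _ 4
theorem nib_three_eq (w : ℕ) : nib w 3 = w / 4096 % 16 := by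
  change (w >>> 12) &&& 15 = _
  rw [Nat.shiftRight_eq_div_pow]; exact Nat.and_two_pow_sub_one_eq_mod _ 4

/-- the matrix with first row `w` -/
noncomputable def el (f w : ℕ) : Mat :=
  !![d (nib w 0), d (nib w 1); d (nib (rowN f w) 0), d (nib (rowN f w) 1)]
/-- the code of the first row -/
noncomputable def topw (M : Mat) : ℕ := c (M 0 0) + 16 * c (M 0 1)

theorem topw_lt (M : Mat) : topw M < 256 := by
  have h1 := c_lt (M 0 0)
  have h2 := c_lt (M 0 1)
  unfold topw; omega

theorem topw_add (M N : Mat) : topw (M + N) = topw M ^^^ topw N := by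
  unfold topw
  rw [Matrix.add_apply, Matrix.add_apply, c_add, c_add]
  have h := pack_xor (c (M 0 0)) (c_lt _) (c (M 0 1)) (c_lt _) (c (N 0 0)) (c_lt _) (c (N 0 1)) (c_lt _)
  first | exact h | exact h.symm

theorem topw_el (f w : ℕ) (hw : w < 256) : topw (el f w) = w := by
  have h1 : (el f w) 0 0 = d (nib w 0) := rfl
  have h2 : (el f w) 0 1 = d (nib w 1) := rfl
  unfold topw
  rw [h1, h2, c_d _ (nib_lt _ _), c_d _ (nib_lt _ _), nib_zero_eq, nib_one_eq]; omega

theorem el_xor (f w w' : ℕ) : el f (w ^^^ w') = el f w + el f w' := by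
  unfold el
  rw [rowN_xor, nib_xor, nib_xor, nib_xor, nib_xor, d_xor (nib_lt _ _) (nib_lt _ _),
    d_xor (nib_lt _ _) (nib_lt _ _), d_xor (nib_lt _ _) (nib_lt _ _), d_xor (nib_lt _ _) (nib_lt _ _)]
  ext i j; fin_cases i <;> fin_cases j <;> rfl

/-- the code as a set -/
def cs (f : ℕ) : Set Mat := {M | el f (topw M) = M}

theorem el_mem (f w : ℕ) (hw : w < 256) : el f w ∈ cs f := by
  change el f (topw (el f w)) = el f w; rw [topw_el f w hw]

theorem cs_add {f : ℕ} {M N : Mat} (h : M ∈ cs f) (h' : N ∈ cs f) : M + N ∈ cs f := by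
  change el f (topw (M + N)) = M + N
  rw [topw_add, el_xor, h, h']

theorem mat_add_self (M : Mat) : M + M = 0 := by
  ext i j; exact add_self _
theorem mat_neg (M : Mat) : -M = M := neg_eq_of_add_eq_zero_left (mat_add_self M)

theorem cs_zero (f : ℕ) : (0 : Mat) ∈ cs f := by
  have h := cs_add (el_mem f 0 (by norm_num)) (el_mem f 0 (by norm_num))
  rwa [mat_add_self] at h

noncomputable def csAdd (f : ℕ) : AddSubgroup Mat where
  carrier := cs f
  add_mem' := cs_add
  zero_mem' := cs_zero f
  neg_mem' := fun {M} h => by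
    change -M ∈ cs f
    rw [mat_neg]; exact h

noncomputable def codeSub (f : ℕ) : Submodule (ZMod 2) Mat := AddSubgroup.toZModSubmodule 2 (csAdd f)
theorem coe_codeSub (f : ℕ) : (codeSub f : Set Mat) = cs f := rfl
theorem mem_codeSub (f : ℕ) (M : Mat) : M ∈ codeSub f ↔ M ∈ cs f := Iff.rfl

theorem qN_eq (f w : ℕ) (hw : w < 256) : qN f w =
    mt (nib w 0) (nib (rowN f w) 1) ^^^ mt (nib w 1) (nib (rowN f w) 0) := by
  have h : ∀ x, x < 256 → Nat.shiftRight x 4 = nib x 1 := by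
    intro x hx
    rw [nib_one_eq]
    change x >>> 4 = _
    rw [Nat.shiftRight_eq_div_pow]; omega
  have h0 : ∀ x, Nat.land x 15 = nib x 0 := fun x => rfl
  unfold qN detN
  rw [h _ hw, h _ (rowN_lt _ _), h0, h0]; rfl

theorem c_det (f w : ℕ) (hw : w < 256) : c (el f w).det = qN f w := by
  have e : (el f w).det = d (nib w 0) * d (nib (rowN f w) 1) - d (nib w 1) * d (nib (rowN f w) 0) := by
    rw [Matrix.det_fin_two]; rfl
  rw [e, CharTwo.sub_eq_add, c_add, c_mul, c_mul, c_d _ (nib_lt _ _), c_d _ (nib_lt _ _),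
    c_d _ (nib_lt _ _), c_d _ (nib_lt _ _), qN_eq f w hw]

theorem codeSub_mem (f : ℕ) (h : cl (CB f) 0 = 1) : codeSub f ∈ mrdSet := by
  constructor
  · have e : codeSub f ≃ Fin 256 :=
      { toFun := fun M => ⟨topw M.1, topw_lt M.1⟩
        invFun := fun w => ⟨el f w.1, el_mem f w.1 w.2⟩
        left_inv := fun M => Subtype.ext M.2
        right_inv := fun w => Fin.ext (topw_el f w.1 w.2) }
    have h1 := Module.natCard_eq_pow_finrank (K := ZMod 2) (V := codeSub f)
    rw [Nat.card_congr e, Nat.card_zmod, Nat.card_eq_fintype_card, Fintype.card_fin] at h1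
    exact (Nat.pow_right_injective (le_refl 2) (h1.symm.trans (by norm_num : 256 = 2 ^ 8)))
  · intro A hA hne
    rw [Matrix.isUnit_iff_isUnit_det, isUnit_iff_ne_zero]
    intro h0
    have hA' : el f (topw A) = A := hA
    have hq := c_det f (topw A) (topw_lt A)
    rw [hA', h0, c_zero] at hq
    have hb := cl_bit f 0 (topw A) (by norm_num) (topw_lt A)
    rw [← hq, h] at hb
    have ht : topw A = 0 := by
      by_contra hne0
      have : (1 : ℕ).testBit (topw A) = false := by
        have h1 : (1 : ℕ) = 2 ^ 0 := rfl
        rw [h1, Nat.testBit_two_pow]; simpa using fun h => hne0 h.symm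
      rw [this] at hb; simp at hb
    apply hne
    rw [← hA', ht]
    have h2 := el_xor f 0 0
    rw [Nat.xor_self] at h2
    exact left_eq_add.1 h2

/-- the invariant of four matrices -/
noncomputable def ttK (A B C D : Mat) : F16 := (A * B.adjugate * (C * D.adjugate)).trace

theorem nib_pack (x0 x1 x2 x3 : ℕ) (h0 : x0 < 16) (h1 : x1 < 16) (h2 : x2 < 16) (h3 : x3 < 16) :
    nib (Nat.add (Nat.add x0 (Nat.mul 16 x1)) (Nat.add (Nat.mul 256 x2) (Nat.mul 4096 x3))) 0 = x0 ∧
    nib (Nat.add (Nat.add x0 (Nat.mul 16 x1)) (Nat.add (Nat.mul 256 x2) (Nat.mul 4096 x3))) 1 = x1 ∧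
    nib (Nat.add (Nat.add x0 (Nat.mul 16 x1)) (Nat.add (Nat.mul 256 x2) (Nat.mul 4096 x3))) 2 = x2 ∧
    nib (Nat.add (Nat.add x0 (Nat.mul 16 x1)) (Nat.add (Nat.mul 256 x2) (Nat.mul 4096 x3))) 3 = x3 := by
  rw [nib_zero_eq, nib_one_eq, nib_two_eq, nib_three_eq]
  simp only [Nat.add_eq, Nat.mul_eq]
  omega

theorem c_mx (x y z t : F16) (a b e g : ℕ) (h1 : c x = a) (h2 : c y = b) (h3 : c z = e) (h4 : c t = g) :
    c (x * y - z * t) = Nat.xor (mt a b) (mt e g) := by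
  rw [CharTwo.sub_eq_add, c_add, c_mul, c_mul, h1, h2, h3, h4]; rfl

theorem c_madj (f w w' : ℕ) : ∀ m, m = madj w (rowN f w) w' (rowN f w') →
    c ((el f w * (el f w').adjugate) 0 0) = nib m 0 ∧
    c ((el f w * (el f w').adjugate) 0 1) = nib m 1 ∧
    c ((el f w * (el f w').adjugate) 1 0) = nib m 2 ∧
    c ((el f w * (el f w').adjugate) 1 1) = nib m 3 := by
  intro m hm
  have hx : ∀ a b e g, Nat.xor (mt a b) (mt e g) < 16 := fun a b e g => xor_lt16 (mt_lt _ _) (mt_lt _ _)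
  have hcd : ∀ t i, c (d (nib t i) : F16) = nib t i := fun t i => c_d _ (nib_lt _ _)
  obtain ⟨k0, k1, k2, k3⟩ := nib_pack _ _ _ _
    (hx (nib w 0) (nib (rowN f w') 1) (nib w 1) (nib (rowN f w') 0))
    (hx (nib w 0) (nib w' 1) (nib w 1) (nib w' 0))
    (hx (nib (rowN f w) 0) (nib (rowN f w') 1) (nib (rowN f w) 1) (nib (rowN f w') 0))
    (hx (nib (rowN f w) 0) (nib w' 1) (nib (rowN f w) 1) (nib w' 0))
  unfold madj at hm
  simp only [] at hm
  rw [← hm] at k0 k1 k2 k3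
  rw [k0, k1, k2, k3]
  rw [Matrix.adjugate_fin_two]
  refine ⟨?_, ?_, ?_, ?_⟩
  · rw [← c_mx _ _ _ _ _ _ _ _ (hcd w 0) (hcd (rowN f w') 1) (hcd w 1) (hcd (rowN f w') 0)]
    congr 1
    rw [Matrix.mul_apply, Fin.sum_univ_two]
    simp [el, CharTwo.sub_eq_add, neg_self]
  · rw [← c_mx _ _ _ _ _ _ _ _ (hcd w 0) (hcd w' 1) (hcd w 1) (hcd w' 0)]
    congr 1
    rw [Matrix.mul_apply, Fin.sum_univ_two]
    simp [el, CharTwo.sub_eq_add, neg_self]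
  · rw [← c_mx _ _ _ _ _ _ _ _ (hcd (rowN f w) 0) (hcd (rowN f w') 1) (hcd (rowN f w) 1) (hcd (rowN f w') 0)]
    congr 1
    rw [Matrix.mul_apply, Fin.sum_univ_two]
    simp [el, CharTwo.sub_eq_add, neg_self]
  · rw [← c_mx _ _ _ _ _ _ _ _ (hcd (rowN f w) 0) (hcd w' 1) (hcd (rowN f w) 1) (hcd w' 0)]
    congr 1
    rw [Matrix.mul_apply, Fin.sum_univ_two]
    simp [el, CharTwo.sub_eq_add, neg_self]

theorem c_tt (f w1 w2 w3 w4 : ℕ) : c (ttK (el f w1) (el f w2) (el f w3) (el f w4)) = ttN f w1 w2 w3 w4 := by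
  unfold ttK ttN trm
  obtain ⟨a0, a1, a2, a3⟩ := c_madj f w1 w2 _ rfl
  obtain ⟨b0, b1, b2, b3⟩ := c_madj f w3 w4 _ rfl
  rw [← a0, ← a1, ← a2, ← a3, ← b0, ← b1, ← b2, ← b3]
  generalize el f w1 * (el f w2).adjugate = P
  generalize el f w3 * (el f w4).adjugate = R
  rw [Matrix.trace_fin_two, Matrix.mul_apply, Fin.sum_univ_two, Matrix.mul_apply, Fin.sum_univ_two]
  rw [c_add, c_add, c_add, c_mul, c_mul, c_mul, c_mul]; rfl

end MRD

set_option maxRecDepth 100000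
set_option exponentiation.threshold 600
namespace MRD
open Cod

/-! ### semilinear equivalences -/

/-- the map `A ↦ X A^ρ Y` -/
noncomputable def sg (X Y : Mat) (ρ : F16 ≃+* F16) (A : Mat) : Mat := X * A.map ρ * Y

theorem sg_add (X Y : Mat) (ρ : F16 ≃+* F16) (A B : Mat) : sg X Y ρ (A + B) = sg X Y ρ A + sg X Y ρ B := by
  unfold sg
  rw [Matrix.map_add _ (map_add ρ), mul_add, add_mul]

theorem sg_smul (X Y : Mat) (ρ : F16 ≃+* F16) (x : F16) (A : Mat) : sg X Y ρ (x • A) = ρ x • sg X Y ρ A := by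
  unfold sg
  have : (x • A).map ρ = ρ x • A.map ρ := by ext i j; simp
  rw [this, Matrix.mul_smul, Matrix.smul_mul]

theorem map_mul' (ρ : F16 ≃+* F16) (A B : Mat) : (A * B).map ρ = A.map ρ * B.map ρ :=
  Matrix.map_mul (f := (ρ : F16 →+* F16))
theorem map_one' (ρ : F16 ≃+* F16) : (1 : Mat).map ρ = 1 := Matrix.map_one ρ (map_zero ρ) (map_one ρ)
theorem map_det' (ρ : F16 ≃+* F16) (A : Mat) : (A.map ρ).det = ρ A.det := by
  rw [Matrix.det_fin_two, Matrix.det_fin_two]; simp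
theorem map_adj' (ρ : F16 ≃+* F16) (A : Mat) : (A.map ρ).adjugate = A.adjugate.map ρ := by
  rw [Matrix.adjugate_fin_two, Matrix.adjugate_fin_two]
  ext i j; fin_cases i <;> fin_cases j <;> simp

theorem sg_det (X Y : Mat) (ρ : F16 ≃+* F16) (A : Mat) : (sg X Y ρ A).det = X.det * Y.det * ρ A.det := by
  unfold sg
  rw [Matrix.det_mul, Matrix.det_mul, map_det']; ring

theorem sg_half (X Y : Mat) (ρ : F16 ≃+* F16) (A B : Mat) :
    sg X Y ρ A * (sg X Y ρ B).adjugate = Y.det • (X * (A * B.adjugate).map ρ * X.adjugate) := by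
  unfold sg
  rw [Matrix.adjugate_mul_distrib, Matrix.adjugate_mul_distrib, map_adj', map_mul']
  have h : X * A.map ρ * Y * (Y.adjugate * (B.adjugate.map ρ * X.adjugate)) =
      X * A.map ρ * (Y * Y.adjugate) * (B.adjugate.map ρ * X.adjugate) := by
    simp only [mul_assoc]
  rw [h, Matrix.mul_adjugate]
  simp only [Matrix.mul_smul, Matrix.smul_mul, mul_one, mul_assoc]

theorem sg_tt (X Y : Mat) (ρ : F16 ≃+* F16) (A B C D : Mat) :
    ttK (sg X Y ρ A) (sg X Y ρ B) (sg X Y ρ C) (sg X Y ρ D) =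
      (X.det * Y.det) * (X.det * Y.det) * ρ (ttK A B C D) := by
  unfold ttK
  rw [sg_half, sg_half]
  generalize A * B.adjugate = P
  generalize C * D.adjugate = R
  have h : X * P.map ρ * X.adjugate * (X * R.map ρ * X.adjugate) =
      X * P.map ρ * (X.adjugate * X) * (R.map ρ * X.adjugate) := by simp only [mul_assoc]
  have h2 : (X * P.map ρ * (R.map ρ * X.adjugate)).trace = X.det * ρ (P * R).trace := by
    rw [Matrix.trace_mul_comm]
    have : R.map ρ * X.adjugate * (X * P.map ρ) = R.map ρ * (X.adjugate * X) * P.map ρ := by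
      simp only [mul_assoc]
    rw [this, Matrix.adjugate_mul, Matrix.mul_smul, mul_one, Matrix.smul_mul, Matrix.trace_smul,
      Matrix.trace_mul_comm, ← map_mul', smul_eq_mul]
    congr 1
    rw [Matrix.trace_fin_two, Matrix.trace_fin_two, map_add]; rfl
  rw [Matrix.smul_mul, Matrix.mul_smul, h, Matrix.adjugate_mul, Matrix.mul_smul, mul_one, Matrix.smul_mul,
    Matrix.trace_smul, Matrix.trace_smul, Matrix.trace_smul, h2]
  simp only [smul_eq_mul]; ring

theorem sg_inj {X Y : Mat} (hX : IsUnit X) (hY : IsUnit Y) (ρ : F16 ≃+* F16) : Function.Injective (sg X Y ρ) := by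
  intro A B h
  have h1 : X * A.map ρ = X * B.map ρ := hY.mul_right_cancel h
  have h2 : A.map ρ = B.map ρ := hX.mul_left_cancel h1
  ext i j
  exact ρ.injective (congrFun (congrFun h2 i) j)

theorem root_dec : ∀ n < 16, mt (mt n n) (mt n n) = n ^^^ 1 → ∃ k < 4, frN k 2 = n := by decide +kernel
theorem two_dec : mt (mt 2 2) (mt 2 2) = 2 ^^^ 1 ∧ mt 2 2 = 4 ∧ mt 2 4 = 8 := by decide +kernel

theorem d_four : (d 4 : F16) = d 2 * d 2 := c_inj (by
  rw [c_mul, c_d _ (by norm_num), c_d _ (by norm_num), two_dec.2.1])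
theorem d_eight : (d 8 : F16) = d 2 * d 4 := c_inj (by
  rw [c_mul, c_d _ (by norm_num), c_d _ (by norm_num), c_d _ (by norm_num), two_dec.2.2])

theorem aut_ext {ρ τ : F16 ≃+* F16} (h : ρ (d 2) = τ (d 2)) : ρ = τ := by
  have := hom_ext (f := (ρ : F16 →+ F16)) (g := (τ : F16 →+ F16))
    (by change ρ (d 1) = τ (d 1); rw [d_one, map_one, map_one]) h
    (by change ρ (d 4) = τ (d 4); rw [d_four, map_mul, map_mul, h])
    (by change ρ (d 8) = τ (d 8); rw [d_eight, d_four, map_mul, map_mul, map_mul, map_mul, h])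
  ext x
  exact DFunLike.congr_fun this x

theorem aut_frob (ρ : F16 ≃+* F16) : ∃ k < 4, ρ = frobE ^ k := by
  have h : (d 2 : F16) * d 2 * (d 2 * d 2) = d 2 + 1 := c_inj (by
    rw [c_mul, c_mul, c_add, c_one, c_d _ (by norm_num), two_dec.1])
  have h2 := congrArg (fun x => c (ρ x)) h
  simp only [map_mul, map_add, map_one, c_mul, c_add, c_one] at h2
  obtain ⟨k, hk, e⟩ := root_dec _ (c_lt _) h2
  refine ⟨k, hk, aut_ext (c_inj ?_)⟩
  rw [c_frobE, c_d _ (by norm_num), e]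

theorem iso_of {fi fj : ℕ} {X Y : Mat} (hX : IsUnit X) (hY : IsUnit Y) {r : ℕ} (hr : r < 4)
    (hm : ∀ A ∈ cs fi, sg X Y (frobE ^ r) A ∈ cs fj) :
    Iso fi fj (c (X.det * Y.det)) r (fun w => topw (sg X Y (frobE ^ r) (el fi w))) := by
  have he : ∀ w < 256, el fj (topw (sg X Y (frobE ^ r) (el fi w))) = sg X Y (frobE ^ r) (el fi w) :=
    fun w hw => hm _ (el_mem fi w hw)
  refine ⟨fun w _ => topw_lt _, ?_, ?_, ?_, c_lt _, ?_, hr, ?_⟩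
  · intro w _ w' _
    change topw _ = topw _ ^^^ topw _
    rw [el_xor, sg_add, topw_add]
  · intro w hw w' hw' e
    have e' : topw (sg X Y (frobE ^ r) (el fi w)) = topw (sg X Y (frobE ^ r) (el fi w')) := e
    have h1 := he w hw
    rw [e', he w' hw'] at h1
    have h2 := sg_inj hX hY _ h1
    rw [← topw_el fi w hw, ← topw_el fi w' hw', h2]
  · intro w hw
    change qN fj (topw _) = _
    rw [← c_det _ _ (topw_lt _), he w hw, sg_det, c_mul, c_frobE, c_det _ _ hw]; rfl
  · rw [Matrix.isUnit_iff_isUnit_det, isUnit_iff_ne_zero] at hX hY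
    exact c_ne_zero (mul_ne_zero hX hY)
  · rw [← c_tt, he _ (by norm_num), he _ (by norm_num), he _ (by norm_num), he _ (by norm_num), sg_tt,
      c_mul, c_frobE, c_mul, c_tt]

theorem span4 {t a b a' b' e g e' g' : F16} (hD : (e - t * a) * (g' - t * b') - (g - t * b) * (e' - t * a') ≠ 0)
    (M : Mat) : ∃ x1 x2 x3 x4 : F16, M = x1 • !![1, 0; a, b] + x2 • !![0, 1; a', b'] +
      x3 • !![t, 0; e, g] + x4 • !![0, t; e', g'] := by
  set D := (e - t * a) * (g' - t * b') - (g - t * b) * (e' - t * a') with hDd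
  obtain ⟨p, hp⟩ : ∃ p, p = M 1 0 - M 0 0 * a - M 0 1 * a' := ⟨_, rfl⟩
  obtain ⟨q, hq⟩ : ∃ q, q = M 1 1 - M 0 0 * b - M 0 1 * b' := ⟨_, rfl⟩
  obtain ⟨x, hx⟩ : ∃ x, x = (p * (g' - t * b') - q * (e' - t * a')) / D := ⟨_, rfl⟩
  obtain ⟨y, hy⟩ : ∃ y, y = ((e - t * a) * q - (g - t * b) * p) / D := ⟨_, rfl⟩
  have hx' : x * D = p * (g' - t * b') - q * (e' - t * a') := by rw [hx]; field_simp
  have hy' : y * D = (e - t * a) * q - (g - t * b) * p := by rw [hy]; field_simp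
  have h1 : x * (e - t * a) + y * (e' - t * a') = p := by
    apply mul_right_cancel₀ hD
    linear_combination (e - t * a) * hx' + (e' - t * a') * hy' + (-p) * hDd
  have h2 : x * (g - t * b) + y * (g' - t * b') = q := by
    apply mul_right_cancel₀ hD
    linear_combination (g - t * b) * hx' + (g' - t * b') * hy' + (-q) * hDd
  refine ⟨M 0 0 - x * t, M 0 1 - y * t, x, y, ?_⟩
  ext i j
  fin_cases i <;> fin_cases j
  · change M 0 0 = (M 0 0 - x * t) * 1 + (M 0 1 - y * t) * 0 + x * t + y * 0; ring
  · change M 0 1 = (M 0 0 - x * t) * 0 + (M 0 1 - y * t) * 1 + x * 0 + y * t; ring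
  · change M 1 0 = (M 0 0 - x * t) * a + (M 0 1 - y * t) * a' + x * e + y * e'
    linear_combination -h1 - hp
  · change M 1 1 = (M 0 0 - x * t) * b + (M 0 1 - y * t) * b' + x * g + y * g'
    linear_combination -h2 - hq

end MRD

set_option maxRecDepth 100000
set_option exponentiation.threshold 600
namespace MRD
open Cod

theorem rowN_eq_of (f w i : ℕ) (hi : i < 8) (hw : w = 2 ^ i) : rowN f w = byt f i := by
  apply Nat.eq_of_testBit_eq
  intro k
  by_cases hk : k < 8
  · rw [rowN_bit _ _ _ hk, byt_bit _ _ _ hk, hw]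
    simp only [Nat.testBit_two_pow]
    interval_cases i <;> simp
  · have h : ∀ x, x < 256 → x.testBit k = false := fun x hx =>
      Nat.testBit_lt_two_pow (hx.trans_le ((by norm_num : 256 = 2 ^ 8).le.trans
        (Nat.pow_le_pow_right (by norm_num) (by omega))))
    rw [h _ (rowN_lt _ _), h _ (byt_lt _ _)]

theorem nib_small : nib 1 0 = 1 ∧ nib 1 1 = 0 ∧ nib 16 0 = 0 ∧ nib 16 1 = 1 ∧ nib 2 0 = 2 ∧ nib 2 1 = 0 ∧
    nib 32 0 = 0 ∧ nib 32 1 = 2 := by decide +kernel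

theorem el_1 (f : ℕ) : el f 1 = !![1, 0; d (nib (byt f 0) 0), d (nib (byt f 0) 1)] := by
  unfold el; rw [rowN_eq_of f 1 0 (by norm_num) rfl, nib_small.1, nib_small.2.1, d_one, d_zero]
theorem el_16 (f : ℕ) : el f 16 = !![0, 1; d (nib (byt f 4) 0), d (nib (byt f 4) 1)] := by
  unfold el; rw [rowN_eq_of f 16 4 (by norm_num) rfl, nib_small.2.2.1, nib_small.2.2.2.1, d_one, d_zero]
theorem el_2 (f : ℕ) : el f 2 = !![d 2, 0; d (nib (byt f 1) 0), d (nib (byt f 1) 1)] := by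
  unfold el
  rw [rowN_eq_of f 2 1 (by norm_num) rfl, nib_small.2.2.2.2.1, nib_small.2.2.2.2.2.1, d_zero]
theorem el_32 (f : ℕ) : el f 32 = !![0, d 2; d (nib (byt f 5) 0), d (nib (byt f 5) 1)] := by
  unfold el
  rw [rowN_eq_of f 32 5 (by norm_num) rfl, nib_small.2.2.2.2.2.2.1, nib_small.2.2.2.2.2.2.2, d_zero]

theorem pack_lt {a b : ℕ} (ha : a < 16) (hb : b < 16) : Nat.add a (Nat.mul 16 b) < 256 := by
  change a + 16 * b < 256; omega
theorem nib_pack2 {a b : ℕ} (ha : a < 16) (hb : b < 16) : nib (Nat.add a (Nat.mul 16 b)) 0 = a ∧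
    nib (Nat.add a (Nat.mul 16 b)) 1 = b := by
  rw [nib_zero_eq, nib_one_eq]; simp only [Nat.add_eq, Nat.mul_eq]; omega

theorem detN_eq {w r : ℕ} (hw : w < 256) (hr : r < 256) : detN w r =
    mt (nib w 0) (nib r 1) ^^^ mt (nib w 1) (nib r 0) := by
  have h : ∀ x, x < 256 → Nat.shiftRight x 4 = nib x 1 := by
    intro x hx
    rw [nib_one_eq]
    change x >>> 4 = _
    rw [Nat.shiftRight_eq_div_pow]; omega
  have h0 : ∀ x, Nat.land x 15 = nib x 0 := fun x => rfl
  unfold detN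
  rw [h _ hw, h _ hr, h0, h0]; rfl

theorem span_det (x0 x1 y0 y1 : ℕ) (h0 : x0 < 256) (h1 : x1 < 256) (k0 : y0 < 256) (k1 : y1 < 256)
    (a b : ℕ) (ha : a = Nat.xor x1 (Nat.add (mt 2 (nib x0 0)) (Nat.mul 16 (mt 2 (nib x0 1)))))
    (hb : b = Nat.xor y1 (Nat.add (mt 2 (nib y0 0)) (Nat.mul 16 (mt 2 (nib y0 1))))) :
    c ((d (nib x1 0) - d 2 * d (nib x0 0)) * (d (nib y1 1) - d 2 * d (nib y0 1)) -
      (d (nib x1 1) - d 2 * d (nib x0 1)) * (d (nib y1 0) - d 2 * d (nib y0 0)) : F16) = detN a b := by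
  have hx : ∀ x y i j, c (d (nib x i) - d 2 * d (nib y j) : F16) = nib x i ^^^ mt 2 (nib y j) := by
    intro x y i j
    rw [CharTwo.sub_eq_add, c_add, c_mul, c_d _ (nib_lt _ _), c_d _ (nib_lt _ _), c_d _ (by norm_num)]
  have hk : ∀ x y, nib (x ^^^ (Nat.add (mt 2 (nib y 0)) (Nat.mul 16 (mt 2 (nib y 1))))) 0 =
      nib x 0 ^^^ mt 2 (nib y 0) ∧ nib (x ^^^ (Nat.add (mt 2 (nib y 0)) (Nat.mul 16 (mt 2 (nib y 1))))) 1 =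
      nib x 1 ^^^ mt 2 (nib y 1) := by
    intro x y
    rw [nib_xor, nib_xor, (nib_pack2 (mt_lt _ _) (mt_lt _ _)).1, (nib_pack2 (mt_lt _ _) (mt_lt _ _)).2]
    exact ⟨rfl, rfl⟩
  have ha' : a = x1 ^^^ (Nat.add (mt 2 (nib x0 0)) (Nat.mul 16 (mt 2 (nib x0 1)))) := ha
  have hb' : b = y1 ^^^ (Nat.add (mt 2 (nib y0 0)) (Nat.mul 16 (mt 2 (nib y0 1)))) := hb
  have la : a < 256 := by rw [ha']; exact xor_lt_256 h1 (pack_lt (mt_lt _ _) (mt_lt _ _))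
  have lb : b < 256 := by rw [hb']; exact xor_lt_256 k1 (pack_lt (mt_lt _ _) (mt_lt _ _))
  rw [detN_eq la lb, ha', hb', (hk _ _).1, (hk _ _).2, (hk _ _).1, (hk _ _).2]
  rw [CharTwo.sub_eq_add (R := F16) (_ * _) (_ * _), c_add, c_mul, c_mul, hx, hx, hx, hx]

theorem el_span (f : ℕ) (h : spanN f ≠ 0) (M : Mat) : ∃ x1 x2 x3 x4 : F16,
    M = x1 • el f 1 + x2 • el f 16 + x3 • el f 2 + x4 • el f 32 := by
  rw [el_1, el_16, el_2, el_32]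
  apply span4
  intro h0
  have h1 := span_det (byt f 0) (byt f 1) (byt f 4) (byt f 5) (byt_lt _ _) (byt_lt _ _) (byt_lt _ _) (byt_lt _ _)
    _ _ rfl rfl
  rw [h0, c_zero] at h1
  exact h h1.symm

theorem sg_ext {X Y X' Y' : Mat} {ρ : F16 ≃+* F16} (f : ℕ) (h : spanN f ≠ 0)
    (h1 : sg X Y ρ (el f 1) = sg X' Y' ρ (el f 1)) (h2 : sg X Y ρ (el f 16) = sg X' Y' ρ (el f 16))
    (h3 : sg X Y ρ (el f 2) = sg X' Y' ρ (el f 2)) (h4 : sg X Y ρ (el f 32) = sg X' Y' ρ (el f 32))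
    (A : Mat) : sg X Y ρ A = sg X' Y' ρ A := by
  obtain ⟨x1, x2, x3, x4, e⟩ := el_span f h A
  rw [e]
  simp only [sg_add, sg_smul, h1, h2, h3, h4]

/-! ### the group -/

theorem sg_sg (X Y X' Y' : Mat) (ρ τ : F16 ≃+* F16) (A : Mat) :
    sg X Y ρ (sg X' Y' τ A) = sg (X * X'.map ρ) (Y'.map ρ * Y) (τ.trans ρ) A := by
  unfold sg
  rw [map_mul', map_mul']
  have : (A.map τ).map ρ = A.map (τ.trans ρ) := by rw [Matrix.map_map]; rfl
  rw [this]; simp only [mul_assoc]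

theorem isUnit_map {X : Mat} (h : IsUnit X) (ρ : F16 ≃+* F16) : IsUnit (X.map ρ) := by
  rw [Matrix.isUnit_iff_isUnit_det, isUnit_iff_ne_zero] at h ⊢
  rw [map_det']; simpa using h

/-- the group of all equivalences -/
def Gr : Subgroup (Equiv.Perm Mat) where
  carrier := {e | ∃ (X Y : Mat) (ρ : F16 ≃+* F16), IsUnit X ∧ IsUnit Y ∧ ∀ A, e A = sg X Y ρ A}
  mul_mem' := by
    rintro e e' ⟨X, Y, ρ, hX, hY, h⟩ ⟨X', Y', τ, hX', hY', h'⟩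
    refine ⟨X * X'.map ρ, Y'.map ρ * Y, τ.trans ρ, hX.mul (isUnit_map hX' ρ), (isUnit_map hY' ρ).mul hY, ?_⟩
    intro A
    rw [Equiv.Perm.mul_apply, h', h, sg_sg]
  one_mem' := ⟨1, 1, RingEquiv.refl _, isUnit_one, isUnit_one, fun A => by
    unfold sg; rw [one_mul, mul_one]; ext i j; rfl⟩
  inv_mem' := by
    rintro e ⟨X, Y, ρ, ⟨u, rfl⟩, ⟨v, rfl⟩, h⟩
    refine ⟨((u⁻¹ : Matˣ) : Mat).map ρ.symm, ((v⁻¹ : Matˣ) : Mat).map ρ.symm, ρ.symm,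
      isUnit_map (Units.isUnit _) _, isUnit_map (Units.isUnit _) _, ?_⟩
    intro A
    rw [Equiv.Perm.inv_eq_iff_eq, h]
    unfold sg
    have hs : ∀ M : Mat, (M.map ρ.symm).map ρ = M := by
      intro M; ext i j; simp
    rw [map_mul', map_mul', hs, hs, hs]
    have : (u : Mat) * (((u⁻¹ : Matˣ) : Mat) * A * ((v⁻¹ : Matˣ) : Mat)) * (v : Mat) =
      ((u : Mat) * ((u⁻¹ : Matˣ) : Mat)) * A * (((v⁻¹ : Matˣ) : Mat) * (v : Mat)) := by simp only [mul_assoc]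
    rw [this, Units.mul_inv, Units.inv_mul, one_mul, mul_one]

theorem sg_surj {X Y : Mat} (hX : IsUnit X) (hY : IsUnit Y) (ρ : F16 ≃+* F16) : Function.Bijective (sg X Y ρ) :=
  Function.Injective.bijective_of_finite (sg_inj hX hY ρ)

/-- the permutation belonging to a triple -/
noncomputable def mkE {X Y : Mat} (hX : IsUnit X) (hY : IsUnit Y) (ρ : F16 ≃+* F16) : Gr :=
  ⟨Equiv.ofBijective _ (sg_surj hX hY ρ), X, Y, ρ, hX, hY, fun _ => rfl⟩
theorem mkE_apply {X Y : Mat} (hX : IsUnit X) (hY : IsUnit Y) (ρ : F16 ≃+* F16) (A : Mat) :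
    (mkE hX hY ρ).1 A = sg X Y ρ A := rfl

/-- a normalizing entry -/
noncomputable def lead (X : Mat) : F16 := open Classical in if X 0 0 = 0 then X 0 1 else X 0 0
theorem lead_ne {X : Mat} (h : IsUnit X) : lead X ≠ 0 := by
  unfold lead
  split_ifs with h0
  · intro h1
    rw [isUnit_iff_det, h0, h1] at h; simp at h
  · exact h0
theorem lead_smul (z : F16) (hz : z ≠ 0) (X : Mat) : lead (z • X) = z * lead X := by
  unfold lead
  have : (z • X) 0 0 = z * X 0 0 := rfl
  by_cases h : X 0 0 = 0
  · rw [if_pos h, if_pos (by rw [this, h, mul_zero])]; rfl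
  · rw [if_neg h, if_neg (by rw [this]; exact mul_ne_zero hz h)]; rfl

theorem frN_two : ∀ k < 4, ∀ l < 4, frN k 2 = frN l 2 → k = l := by decide +kernel

theorem map_01 (ρ : F16 ≃+* F16) : (!![0, 1; 0, 0] : Mat).map ρ = !![0, 1; 0, 0] ∧
    (!![0, 0; 1, 0] : Mat).map ρ = !![0, 0; 1, 0] := by
  constructor <;> (ext i j; fin_cases i <;> fin_cases j <;> simp)

theorem scalar_of (Z : Mat) (h1 : Z * !![0, 1; 0, 0] = !![0, 1; 0, 0] * Z)
    (h2 : Z * !![0, 0; 1, 0] = !![0, 0; 1, 0] * Z) : Z = Z 0 0 • 1 := by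
  have a := congrFun (congrFun h1 0) 0
  have b := congrFun (congrFun h1 0) 1
  have e := congrFun (congrFun h2 0) 0
  simp [Matrix.mul_apply, Fin.sum_univ_two] at a b e
  ext i j
  fin_cases i <;> fin_cases j
  · simp
  · simpa using e
  · simpa using a.symm
  · simpa using b.symm

theorem par_inj (u v u' v' : Matˣ) (k l : ℕ) (hk : k < 4) (hl : l < 4)
    (h : ∀ A, sg u v (frobE ^ k) A = sg u' v' (frobE ^ l) A) (hd : lead (u : Mat) = lead (u' : Mat)) :
    u = u' ∧ v = v' ∧ k = l := by
  have h1 : (u : Mat) * v = u' * v' := by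
    have := h 1
    unfold sg at this
    rwa [map_one', map_one', mul_one, mul_one] at this
  have hkl : k = l := by
    have h2 := h ((d 2 : F16) • 1)
    rw [sg_smul, sg_smul] at h2
    unfold sg at h2
    rw [map_one', map_one', mul_one, mul_one, h1, ← sub_eq_zero, ← sub_smul, smul_eq_zero] at h2
    rcases h2 with h2 | h2
    · apply frN_two k hk l hl
      have h3 := congrArg (c : F16 → ℕ) (sub_eq_zero.1 h2)
      rwa [c_frobE, c_frobE, c_d _ (by norm_num)] at h3
    · exact absurd h2 (u' * v').ne_zero
  subst hkl
  refine (fun hz => ?_) (scalar_of (((u'⁻¹ * u : Matˣ) : Mat)) ?_ ?_)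
  · set Z : Mat := ((u'⁻¹ * u : Matˣ) : Mat) with hZ
    have hu : (u : Mat) = Z 0 0 • (u' : Mat) := by
      have : (u : Mat) = u' * Z := by rw [hZ]; norm_cast; simp
      rw [this]
      conv_lhs => rw [hz]
      rw [Matrix.mul_smul, mul_one]
    have hz0 : Z 0 0 ≠ 0 := by
      intro h0
      rw [h0, zero_smul] at hu
      exact u.ne_zero hu
    rw [hu, lead_smul _ hz0] at hd
    have hz1 : Z 0 0 = 1 := by
      have := lead_ne u'.isUnit
      exact mul_right_cancel₀ this (hd.trans (one_mul _).symm)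
    rw [hz1, one_smul] at hu
    have hu' : u = u' := Units.ext hu
    subst hu'
    exact ⟨rfl, Units.ext (u.isUnit.mul_left_cancel h1), rfl⟩
  all_goals
    have key : ∀ B : Mat, (u : Mat) * B * v = u' * B * v' → ((u'⁻¹ * u : Matˣ) : Mat) * B = B * ((u'⁻¹ * u : Matˣ) : Mat) := by
      intro B hB
      have e1 : (u'⁻¹ * u : Matˣ) = v' * v⁻¹ := by
        rw [inv_mul_eq_iff_eq_mul, ← mul_assoc, eq_mul_inv_iff_mul_eq]
        exact Units.ext h1
      have e2 := congrArg (fun M : Mat => ((u'⁻¹ : Matˣ) : Mat) * M * ((v⁻¹ : Matˣ) : Mat)) hB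
      simp only [mul_assoc, Units.mul_inv, mul_one, Units.inv_mul_cancel_left] at e2
      conv_rhs => rw [e1]
      rw [Units.val_mul, Units.val_mul, mul_assoc, e2]
  · apply key
    have := h !![0, 1; 0, 0]
    unfold sg at this
    rwa [(map_01 _).1] at this
  · apply key
    have := h !![0, 0; 1, 0]
    unfold sg at this
    rwa [(map_01 _).2] at this

theorem card_Gr : 998784000 ≤ Nat.card Gr := by
  have hc := Matrix.card_GL_field (𝔽 := F16) 2
  rw [card_K, Fin.prod_univ_two] at hc
  let Φ : (GL (Fin 2) F16 × GL (Fin 2) F16) × Fin 4 → Gr × {x : F16 // x ≠ 0} := fun p =>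
    (mkE p.1.1.isUnit p.1.2.isUnit (frobE ^ p.2.1), ⟨lead p.1.1, lead_ne p.1.1.isUnit⟩)
  have hΦ : Function.Injective Φ := by
    rintro ⟨⟨u, v⟩, k⟩ ⟨⟨u', v'⟩, l⟩ h
    have h1 := congrArg Prod.fst h
    have h2 : lead u.1 = lead u'.1 := congrArg (fun x => x.2.1) h
    have h3 : ∀ A, sg u v (frobE ^ k.1) A = sg u' v' (frobE ^ l.1) A := fun A => by
      have := congrArg (fun e : Gr => e.1 A) h1
      exact this
    obtain ⟨a, b, e⟩ := par_inj u v u' v' k l k.2 l.2 h3 h2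
    rw [a, b, Fin.ext e]
  have h15 : Nat.card {x : F16 // x ≠ 0} = 15 := by
    classical
    rw [Nat.card_eq_fintype_card, Fintype.card_subtype_compl, card_K]; simp
  have := Nat.card_le_card_of_injective Φ hΦ
  rw [Nat.card_prod, Nat.card_prod, Nat.card_prod, h15, hc, Nat.card_fin] at this
  norm_num at this
  omega

end MRD

set_option maxRecDepth 100000
set_option exponentiation.threshold 600
namespace MRD
open Cod
open scoped Pointwise

/-! ### orbits -/

theorem smul_cs (e : Gr) (S : Set Mat) : e • S = e.1 '' S := rfl

theorem orbit_iff (S T : Set Mat) : T ∈ MulAction.orbit Gr S ↔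
    ∃ (X Y : Mat) (ρ : F16 ≃+* F16), IsUnit X ∧ IsUnit Y ∧ T = sg X Y ρ '' S := by
  constructor
  · rintro ⟨e, rfl⟩
    obtain ⟨X, Y, ρ, hX, hY, h⟩ := e.2
    refine ⟨X, Y, ρ, hX, hY, ?_⟩
    change e.1 '' S = _
    exact Set.image_congr (fun A _ => h A)
  · rintro ⟨X, Y, ρ, hX, hY, rfl⟩
    exact ⟨mkE hX hY ρ, rfl⟩

/-- equivalence of the codes belonging to two numbers -/
def rel (f g : ℕ) : Prop := cs g ∈ MulAction.orbit Gr (cs f)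

theorem rel_iso {f g : ℕ} (h : rel f g) : ∃ n r s, Iso f g n r s := by
  obtain ⟨X, Y, ρ, hX, hY, e⟩ := (orbit_iff _ _).1 h
  obtain ⟨r, hr, rfl⟩ := aut_frob ρ
  exact ⟨_, _, _, iso_of hX hY hr (fun A hA => by rw [e]; exact ⟨A, hA, rfl⟩)⟩

theorem not_rel_key {f g k l : ℕ} (hf : keyN (HB (CB f)) = k) (hg : keyN (HB (CB g)) = l) (h : k ≠ l) :
    ¬ rel f g := fun hr => by
  obtain ⟨n, r, s, hI⟩ := rel_iso hr
  exact h (hf.symm.trans (hI.key.trans hg))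

theorem not_rel_pair {f g : ℕ} (h : okPair f g = true) : ¬ rel f g := fun hr => by
  obtain ⟨n, r, s, hI⟩ := rel_iso hr
  have h1 := SS_ge (ι := Unit) [1, 16, 2, 32, 4, 64, 8, 128] f g {()} (fun _ => n) (fun _ => r) (fun _ => s)
    (by decide) (by decide) (fun _ _ => hI) (fun _ _ _ _ _ _ _ _ _ _ => rfl)
  have h2 := Nat.eq_of_beq_eq_true h
  rw [h2] at h1
  simp at h1

theorem stab_le {f : ℕ} (hsp : spanN f ≠ 0) :
    Nat.card (MulAction.stabilizer Gr (cs f)) ≤ SS [1, 16, 2, 32, 4] f f := by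
  classical
  have hex : ∀ e : MulAction.stabilizer Gr (cs f), ∃ (X Y : Mat) (r : ℕ), r < 4 ∧ IsUnit X ∧ IsUnit Y ∧
      ∀ A, e.1.1 A = sg X Y (frobE ^ r) A := by
    intro e
    obtain ⟨X, Y, ρ, hX, hY, h⟩ := e.1.2
    obtain ⟨r, hr, rfl⟩ := aut_frob ρ
    exact ⟨X, Y, r, hr, hX, hY, h⟩
  choose X Y r hr hX hY h using hex
  have hmap : ∀ e, ∀ A ∈ cs f, sg (X e) (Y e) (frobE ^ r e) A ∈ cs f := by
    intro e A hA
    have h1 : e.1 • cs f = cs f := e.2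
    rw [smul_cs] at h1
    rw [← h]
    exact h1.subset ⟨A, hA, rfl⟩
  haveI : Finite (Equiv.Perm Mat) := inferInstance
  haveI := Fintype.ofFinite (MulAction.stabilizer Gr (cs f))
  rw [Nat.card_eq_fintype_card]
  refine SS_ge [1, 16, 2, 32, 4] f f Finset.univ (fun e => c ((X e).det * (Y e).det)) r
    (fun e w => topw (sg (X e) (Y e) (frobE ^ r e) (el f w))) (by decide) (by decide)
    (fun e _ => iso_of (hX e) (hY e) (hr e) (hmap e)) ?_
  intro e _ e' _ _ er e1 e2 e3 e4
  have key : ∀ w < 256, topw (sg (X e) (Y e) (frobE ^ r e) (el f w)) =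
      topw (sg (X e') (Y e') (frobE ^ r e') (el f w)) →
      sg (X e) (Y e) (frobE ^ r e) (el f w) = sg (X e') (Y e') (frobE ^ r e) (el f w) := by
    intro w hw ew
    have k1 : el f (topw _) = _ := hmap e _ (el_mem f w hw)
    have k2 : el f (topw _) = _ := hmap e' _ (el_mem f w hw)
    rw [← k1, ew, k2, er]
  have hall := sg_ext f hsp (key 1 (by norm_num) e1) (key 16 (by norm_num) e2) (key 2 (by norm_num) e3)
    (key 32 (by norm_num) e4)
  apply Subtype.ext
  apply Subtype.ext
  apply Equiv.ext
  intro A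
  rw [h, h, ← er]; exact hall A

theorem orbit_ge {f s : ℕ} (hsp : spanN f ≠ 0) (hs : SS [1, 16, 2, 32, 4] f f ≤ s) :
    998784000 / s ≤ Nat.card (MulAction.orbit Gr (cs f)) := by
  have h1 := (stab_le hsp).trans hs
  have h2 := Subgroup.card_mul_index (MulAction.stabilizer Gr (cs f))
  rw [MulAction.index_stabilizer] at h2
  have h3 := card_Gr
  rw [← h2] at h3
  change 998784000 / s ≤ (MulAction.orbit Gr (cs f)).ncard
  exact Nat.div_le_of_le_mul (h3.trans (Nat.mul_le_mul_right _ h1))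

theorem orbit_mrd {f : ℕ} (hf : codeSub f ∈ mrdSet) {S : Set Mat} (hS : S ∈ MulAction.orbit Gr (cs f)) :
    ∃ C ∈ mrdSet, (C : Set Mat) = S := by
  obtain ⟨X, Y, ρ, hX, hY, rfl⟩ := (orbit_iff _ _).1 hS
  let φ : Mat →+ Mat := ⟨⟨sg X Y ρ, by simpa using sg_smul X Y ρ 0 0⟩, sg_add X Y ρ⟩
  have hφ : Function.Injective φ := sg_inj hX hY ρ
  let C : Submodule (ZMod 2) Mat := AddSubgroup.toZModSubmodule 2 ((csAdd f).map φ)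
  have hC : (C : Set Mat) = sg X Y ρ '' cs f := rfl
  refine ⟨C, ⟨?_, ?_⟩, hC⟩
  · have h1 := Module.natCard_eq_pow_finrank (K := ZMod 2) (V := C)
    have h2 : Nat.card C = 256 := by
      have h3 : Nat.card (sg X Y ρ '' cs f) = Nat.card (cs f) := Nat.card_image_of_injective hφ _
      exact h3.trans (card_of_mem hf.1)
    rw [h2, Nat.card_zmod] at h1
    exact (Nat.pow_right_injective (le_refl 2) (h1.symm.trans (by norm_num : 256 = 2 ^ 8)))
  · rintro _ ⟨A, hA, rfl⟩ hne
    have hA0 : A ≠ 0 := fun h0 => hne (by rw [h0]; exact map_zero φ)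
    exact (hX.mul (isUnit_map (hf.2 A hA hA0) ρ)).mul hY

/-! ### the final count, given a list of representatives -/

theorem mrd_iff (C C' : Submodule (ZMod 2) Mat) : mrdEquiv C C' ↔ (C' : Set Mat) ∈ MulAction.orbit Gr (C : Set Mat) := by
  rw [orbit_iff]; rfl

theorem mrd_equivalence : Equivalence (fun C C' : mrdSet => mrdEquiv C.1 C'.1) where
  refl C := (mrd_iff _ _).2 (MulAction.mem_orbit_self _)
  symm := fun {C C'} h => (mrd_iff _ _).2 (MulAction.mem_orbit_symm.1 ((mrd_iff _ _).1 h))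
  trans := fun {C C' C''} h h' => (mrd_iff _ _).2 (by
    rw [mrd_iff] at h h'
    rwa [← MulAction.orbit_eq_iff.2 h])

theorem final (R : List (ℕ × ℕ)) (hmem : ∀ p ∈ R, codeSub p.1 ∈ mrdSet)
    (hcard : ∀ p ∈ R, p.2 ≤ Nat.card (MulAction.orbit Gr (cs p.1)))
    (hd : R.Pairwise (fun p q => ¬ rel p.1 q.1)) (hsum : 665842058880 ≤ (R.map Prod.snd).sum) :
    Nat.card (Quotient (Setoid.mk _ mrd_equivalence)) = R.length := by
  classical
  have hrs : ∀ {f g}, rel f g → rel g f := fun h => MulAction.mem_orbit_symm.1 h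
  have hdis : ∀ i j : Fin R.length, rel (R.get i).1 (R.get j).1 → i = j := by
    intro i j h
    rcases lt_trichotomy i j with hl | hl | hl
    · exact absurd h (List.pairwise_iff_get.1 hd i j hl)
    · exact hl
    · exact absurd (hrs h) (List.pairwise_iff_get.1 hd j i hl)
  have hm : ∀ i : Fin R.length, codeSub (R.get i).1 ∈ mrdSet := fun i => hmem _ (List.get_mem _ _)
  choose C hC hCS using fun (i : Fin R.length) (S : MulAction.orbit Gr (cs (R.get i).1)) =>
    orbit_mrd (hm i) S.2
  let Φ : (Σ i : Fin R.length, MulAction.orbit Gr (cs (R.get i).1)) → mrdSet := fun p => ⟨C p.1 p.2, hC p.1 p.2⟩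
  have hΦ : Function.Injective Φ := by
    rintro ⟨i, S, hS⟩ ⟨j, T, hT⟩ h
    have h1 : C i ⟨S, hS⟩ = C j ⟨T, hT⟩ := congrArg Subtype.val h
    have h2 : S = T := by
      exact (hCS i ⟨S, hS⟩).symm.trans ((congrArg (fun C : Submodule (ZMod 2) Mat => (C : Set Mat)) h1).trans
        (hCS j ⟨T, hT⟩))
    subst h2
    have hij : i = j := by
      apply hdis
      have e1 := MulAction.orbit_eq_iff.2 hS
      have e2 := MulAction.orbit_eq_iff.2 hT
      change cs _ ∈ MulAction.orbit Gr _
      rw [← e1, e2]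
      exact MulAction.mem_orbit_self _
    subst hij
    rfl
  have hb : Function.Bijective Φ := by
    rw [Nat.bijective_iff_injective_and_card]
    refine ⟨hΦ, le_antisymm (Nat.card_le_card_of_injective _ hΦ) ?_⟩
    refine card_mrdSet_le.trans (hsum.trans ?_)
    rw [Nat.card_sigma]
    have : (R.map Prod.snd).sum = ∑ i : Fin R.length, (R.get i).2 := by
      rw [← List.sum_ofFn]
      congr 1
      apply List.ext_get
      · simp
      · intro n h1 h2; simp
    rw [this]
    exact Finset.sum_le_sum (fun i _ => hcard _ (List.get_mem _ _))
  let Ψ : Fin R.length → Quotient (Setoid.mk _ mrd_equivalence) := fun i => Quotient.mk _ ⟨codeSub (R.get i).1, hm i⟩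
  have hΨ : Function.Bijective Ψ := by
    constructor
    · intro i j h
      have h1 := Quotient.exact h
      exact hdis i j ((mrd_iff _ _).1 h1)
    · intro q
      obtain ⟨D, rfl⟩ := Quotient.exists_rep q
      obtain ⟨⟨i, S⟩, hS⟩ := hb.2 D
      refine ⟨i, Quotient.sound ?_⟩
      change mrdEquiv _ _
      rw [mrd_iff]
      have : (D.1 : Set Mat) = S.1 := by rw [← hS]; exact hCS i S
      rw [this]; exact S.2
  rw [← Nat.card_congr (Equiv.ofBijective Ψ hΨ), Nat.card_fin]

end MRD

set_option maxRecDepth 100000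
set_option exponentiation.threshold 600
namespace MRD
open Cod
open scoped Pointwise

/-! ### the orbit of the field -/

theorem f0_dec : ∀ w < 256, nib (rowN 10107805001817530384 w) 0 = mt 8 (nib w 1) ∧
    nib (rowN 10107805001817530384 w) 1 = nib w 0 ^^^ nib w 1 := by decide +kernel

theorem f0_mem (M : Mat) : M ∈ cs 10107805001817530384 ↔ M 1 0 = d 8 * M 0 1 ∧ M 1 1 = M 0 0 + M 0 1 := by
  have h0 : nib (topw M) 0 = c (M 0 0) := by
    have h1 := c_lt (M 0 0)
    have h2 := c_lt (M 0 1)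
    rw [nib_zero_eq]; unfold topw; omega
  have h1 : nib (topw M) 1 = c (M 0 1) := by
    have h1 := c_lt (M 0 0)
    have h2 := c_lt (M 0 1)
    rw [nib_one_eq]; unfold topw; omega
  have h := f0_dec (topw M) (topw_lt M)
  rw [h0, h1] at h
  have e : el 10107805001817530384 (topw M) = !![M 0 0, M 0 1; d 8 * M 0 1, M 0 0 + M 0 1] := by
    unfold el
    rw [h.1, h.2, h0, h1, d_c, d_c, d_xor (c_lt _) (c_lt _), d_c, d_c]
    have : (d (mt 8 (c (M 0 1))) : F16) = d 8 * M 0 1 := c_inj (by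
      rw [c_mul, c_d _ (mt_lt _ _), c_d _ (by norm_num)])
    rw [this]
  change el _ _ = M ↔ _
  rw [e]
  constructor
  · intro h
    exact ⟨(congrFun (congrFun h 1) 0).symm, (congrFun (congrFun h 1) 1).symm⟩
  · rintro ⟨h2, h3⟩
    ext i j
    fin_cases i <;> fin_cases j
    · rfl
    · rfl
    · exact h2.symm
    · exact h3.symm

theorem sg_one (p β y z u x v w : F16) : sg !![1, 0; p, β] !![1, 0; y, z] (RingEquiv.refl F16) !![u, x; v, w] =
    !![u + x * y, x * z; p * u + β * v + (p * x + β * w) * y, (p * x + β * w) * z] := by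
  unfold sg
  have : (!![u, x; v, w] : Mat).map (RingEquiv.refl F16) = !![u, x; v, w] := by
    ext i j; rfl
  rw [this, Matrix.mul_fin_two, Matrix.mul_fin_two]
  ext i j; fin_cases i <;> fin_cases j <;> simp

theorem half_dec : ∀ m < 8, ∀ m' < 8, mt (2 * m) (2 * m) ^^^ (2 * m) = mt (2 * m') (2 * m') ^^^ (2 * m') → m = m' := by
  decide +kernel

theorem f0_eqs (p β y z p' β' y' z' : F16) (hz : z ≠ 0) (hz' : z' ≠ 0)
    (h : sg !![1, 0; p, β] !![1, 0; y, z] (RingEquiv.refl F16) '' cs 10107805001817530384 ⊆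
      sg !![1, 0; p', β'] !![1, 0; y', z'] (RingEquiv.refl F16) '' cs 10107805001817530384) :
    p + β * y = p' + β' * y' ∧ β * z = β' * z' ∧ p + β * y + β = p' + β' * y' + β' ∧
    β * (d 8 + y * y + y) * z' = β' * (d 8 + y' * y' + y') * z := by
  have key : ∀ u x : F16, ∃ u' x' : F16, u + x * y = u' + x' * y' ∧ x * z = x' * z' ∧
      p * u + β * (d 8 * x) + (p * x + β * (u + x)) * y = p' * u' + β' * (d 8 * x') + (p' * x' + β' * (u' + x')) * y' ∧
      (p * x + β * (u + x)) * z = (p' * x' + β' * (u' + x')) * z' := by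
    intro u x
    have hm : !![u, x; d 8 * x, u + x] ∈ cs 10107805001817530384 := (f0_mem _).2 ⟨rfl, rfl⟩
    obtain ⟨A, hA, e⟩ := h ⟨_, hm, rfl⟩
    rw [f0_mem] at hA
    rw [Matrix.eta_fin_two A, hA.1, hA.2, sg_one, sg_one] at e
    refine ⟨A 0 0, A 0 1, ?_, ?_, ?_, ?_⟩
    · exact (congrFun (congrFun e 0) 0).symm
    · exact (congrFun (congrFun e 0) 1).symm
    · exact (congrFun (congrFun e 1) 0).symm
    · exact (congrFun (congrFun e 1) 1).symm
  have h2 : (2 : F16) = 0 := two_zero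
  obtain ⟨u, x, e1, e2, e3, e4⟩ := key 1 0
  have hx : x = 0 := by
    rw [zero_mul] at e2
    exact (mul_eq_zero.1 e2.symm).resolve_right hz'
  subst hx
  have hu : u = 1 := by simpa using e1.symm
  subst hu
  obtain ⟨u, x, k1, k2, k3, k4⟩ := key (y / z) (1 / z)
  have hx : x = 1 / z' := by field_simp; rw [← k2]; field_simp
  subst hx
  have hu : u = y' / z' := by
    have : y / z + 1 / z * y = 0 := by rw [one_div_mul_eq_div]; exact add_self _
    rw [this] at k1
    have h3 : u = -(1 / z' * y') := eq_neg_of_add_eq_zero_left k1.symm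
    rw [h3, neg_self, one_div_mul_eq_div]
  subst hu
  field_simp at k3 k4
  refine ⟨?_, ?_, ?_, ?_⟩
  · linear_combination e3
  · linear_combination e4
  · linear_combination k4
  · linear_combination k3 + (-(p * y * z')) * h2 + (p' * y' * z) * h2

theorem f0_orbit : 28800 ≤ Nat.card (MulAction.orbit Gr (cs 10107805001817530384)) := by
  classical
  have hX : ∀ p β : F16, β ≠ 0 → IsUnit (!![1, 0; p, β] : Mat) := by
    intro p β h
    rw [isUnit_iff_det]; simpa using h
  let Φ : (F16 × {x : F16 // x ≠ 0}) × (Fin 8 × {x : F16 // x ≠ 0}) →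
      MulAction.orbit Gr (cs 10107805001817530384) := fun q =>
    ⟨sg !![1, 0; q.1.1, q.1.2.1] !![1, 0; d (2 * q.2.1.1), q.2.2.1] (RingEquiv.refl F16) '' cs 10107805001817530384,
      (orbit_iff _ _).2 ⟨_, _, _, hX _ _ q.1.2.2, hX _ _ q.2.2.2, rfl⟩⟩
  have hΦ : Function.Injective Φ := by
    rintro ⟨⟨p, β, hβ⟩, ⟨m, z, hz⟩⟩ ⟨⟨p', β', hβ'⟩, ⟨m', z', hz'⟩⟩ h
    have h1 := congrArg Subtype.val h
    obtain ⟨a1, a2, a3, a4⟩ := f0_eqs p β (d (2 * m.1)) z p' β' (d (2 * m'.1)) z' hz hz' h1.subset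
    have b1 : β = β' := by linear_combination a3 - a1
    subst b1
    have b2 : z = z' := mul_left_cancel₀ hβ a2
    subst b2
    have b3 := mul_left_cancel₀ hβ (mul_right_cancel₀ hz a4)
    have b4 : (d (2 * m.1) * d (2 * m.1) + d (2 * m.1) : F16) = d (2 * m'.1) * d (2 * m'.1) + d (2 * m'.1) := by
      linear_combination b3
    have b5 := congrArg (c : F16 → ℕ) b4
    have l1 := m.2
    have l2 := m'.2
    rw [c_add, c_add, c_mul, c_mul, c_d _ (by omega), c_d _ (by omega)] at b5
    have b6 : m = m' := Fin.ext (half_dec m.1 m.2 m'.1 m'.2 b5)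
    subst b6
    have b7 : p = p' := by linear_combination a1
    rw [b7]
  have h15 : Nat.card {x : F16 // x ≠ 0} = 15 := by
    rw [Nat.card_eq_fintype_card, Fintype.card_subtype_compl, card_K]; simp
  have := Nat.card_le_card_of_injective Φ hΦ
  rw [Nat.card_prod, Nat.card_prod, Nat.card_prod, h15, natcard_K, Nat.card_fin] at this
  exact this

/-! ### unpacking the kernel checks -/

theorem okSelf_of {k f s : ℕ} (h : okSelf k f s = true) : cl (CB f) 0 = 1 ∧ spanN f ≠ 0 ∧
    keyN (HB (CB f)) = k ∧ SS [1, 16, 2, 32, 4] f f ≤ s := by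
  unfold okSelf at h
  rw [Bool.and_eq_true, Bool.and_eq_true, Bool.and_eq_true] at h
  obtain ⟨h1, h2, h3, h4⟩ := h
  refine ⟨Nat.eq_of_beq_eq_true h1, ?_, Nat.eq_of_beq_eq_true h3, Nat.le_of_ble_eq_true h4⟩
  intro h0
  rw [h0] at h2
  cases h2

theorem okTail_of {f : ℕ} {t : List (ℕ × ℕ)} (h : List.rec (motive := fun _ => Bool) true
    (fun q _ ih => and (okPair f q.1) ih) t = true) : ∀ q ∈ t, okPair f q.1 = true := by
  induction t with
  | nil => simp
  | cons q t ih =>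
    have h' : and (okPair f q.1) (List.rec (motive := fun _ => Bool) true
      (fun q _ ih => and (okPair f q.1) ih) t) = true := h
    rw [Bool.and_eq_true] at h'
    intro r hr
    rcases List.mem_cons.1 hr with rfl | hr
    · exact h'.1
    · exact ih h'.2 r hr

theorem okGroup_of {k : ℕ} {l : List (ℕ × ℕ)} (h : okGroup k l = true) :
    (∀ p ∈ l, okSelf k p.1 p.2 = true) ∧ l.Pairwise (fun p q => okPair p.1 q.1 = true) := by
  induction l with
  | nil => simp
  | cons p t ih =>
    have h' : and (okSelf k p.1 p.2) (and (List.rec (motive := fun _ => Bool) true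
      (fun q _ ih => and (okPair p.1 q.1) ih) t) (okGroup k t)) = true := h
    rw [Bool.and_eq_true, Bool.and_eq_true] at h'
    obtain ⟨h1, h2, h3⟩ := h'
    refine ⟨?_, List.pairwise_cons.2 ⟨okTail_of h2, (ih h3).2⟩⟩
    intro r hr
    rcases List.mem_cons.1 hr with rfl | hr
    · exact h1
    · exact (ih h3).1 r hr

theorem okAll_of {L : List (ℕ × List (ℕ × ℕ))} (h : okAll L = true) : ∀ g ∈ L, okGroup g.1 g.2 = true := by
  induction L with
  | nil => simp
  | cons p t ih =>
    have h' : and (okGroup p.1 p.2) (okAll t) = true := h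
    rw [Bool.and_eq_true] at h'
    intro r hr
    rcases List.mem_cons.1 hr with rfl | hr
    · exact h'.1
    · exact ih h'.2 r hr

/-- the keys increase -/
noncomputable def incr (L : List (ℕ × List (ℕ × ℕ))) : ℕ → Bool :=
  List.rec (motive := fun _ => ℕ → Bool) (fun _ => true) (fun p _ ih b => and (Nat.blt b p.1) (ih p.1)) L
theorem incr_of {L : List (ℕ × List (ℕ × ℕ))} : ∀ {b : ℕ}, incr L b = true →
    (∀ p ∈ L, b < p.1) ∧ L.Pairwise (fun p q => p.1 < q.1) := by
  induction L with
  | nil => simp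
  | cons p t ih =>
    intro b h
    have h' : and (Nat.blt b p.1) (incr t p.1) = true := h
    rw [Bool.and_eq_true] at h'
    obtain ⟨h1, h2⟩ := h'
    have h1' : b < p.1 := Nat.le_of_ble_eq_true h1
    obtain ⟨k1, k2⟩ := ih h2
    refine ⟨?_, List.pairwise_cons.2 ⟨k1, k2⟩⟩
    intro r hr
    rcases List.mem_cons.1 hr with rfl | hr
    · exact h1'
    · exact h1'.trans (k1 r hr)

theorem assemble (L : List (ℕ × List (ℕ × ℕ))) (f0 k0 : ℕ) (hL : ∀ g ∈ L, okGroup g.1 g.2 = true)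
    (hinc : incr L 0 = true) (h0 : cl (CB f0) 0 = 1) (hk0 : keyN (HB (CB f0)) = k0)
    (ho : 28800 ≤ Nat.card (MulAction.orbit Gr (cs f0)))
    (hpair : ∀ g ∈ L, g.1 = k0 → ∀ p ∈ g.2, okPair p.1 f0 = true)
    (hlen : (L.flatMap (fun g => g.2)).length = 756)
    (hsum : ((L.flatMap (fun g => g.2)).map (fun p => 998784000 / p.2)).sum = 665842030080) :
    Nat.card (Quotient (Setoid.mk _ mrd_equivalence)) = 757 := by
  have hg : ∀ g ∈ L, ∀ p ∈ g.2, cl (CB p.1) 0 = 1 ∧ spanN p.1 ≠ 0 ∧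
    keyN (HB (CB p.1)) = g.1 ∧ SS [1, 16, 2, 32, 4] p.1 p.1 ≤ p.2 := fun g h p hp =>
    okSelf_of ((okGroup_of (hL g h)).1 p hp)
  rw [final ((L.flatMap (fun g => g.2)).map (fun p => (p.1, 998784000 / p.2)) ++ [(f0, 28800)])]
  · simp only [List.length_append, List.length_map, hlen]; rfl
  · intro p hp
    rcases List.mem_append.1 hp with hp | hp
    · obtain ⟨q, hq, rfl⟩ := List.mem_map.1 hp
      obtain ⟨g, hgL, hq⟩ := List.mem_flatMap.1 hq
      exact codeSub_mem _ (hg g hgL q hq).1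
    · rw [List.mem_singleton.1 hp]; exact codeSub_mem _ h0
  · intro p hp
    rcases List.mem_append.1 hp with hp | hp
    · obtain ⟨q, hq, rfl⟩ := List.mem_map.1 hp
      obtain ⟨g, hgL, hq⟩ := List.mem_flatMap.1 hq
      exact orbit_ge (hg g hgL q hq).2.1 (hg g hgL q hq).2.2.2
    · rw [List.mem_singleton.1 hp]; exact ho
  · rw [List.pairwise_append]
    refine ⟨?_, List.pairwise_singleton _ _, ?_⟩
    · rw [List.pairwise_map, List.pairwise_flatMap]
      refine ⟨?_, ?_⟩
      · intro g hgL
        exact (okGroup_of (hL g hgL)).2.imp (fun h => not_rel_pair h)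
      · refine (incr_of hinc).2.imp_of_mem ?_
        intro g g' hgL hgL' hlt p hp q hq
        exact not_rel_key (hg g hgL p hp).2.2.1 (hg g' hgL' q hq).2.2.1 hlt.ne
    · intro p hp q hq
      rw [List.mem_singleton.1 hq]
      obtain ⟨r, hr, rfl⟩ := List.mem_map.1 hp
      obtain ⟨g, hgL, hr⟩ := List.mem_flatMap.1 hr
      by_cases hk : g.1 = k0
      · exact not_rel_pair (hpair g hgL hk r hr)
      · exact not_rel_key (hg g hgL r hr).2.2.1 hk0 hk
  · rw [List.map_append, List.map_map, List.sum_append]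
    have : (Prod.snd ∘ fun p : ℕ × ℕ => (p.1, 998784000 / p.2)) = fun p => 998784000 / p.2 := rfl
    rw [this, hsum]
    simp

end MRD

set_option maxRecDepth 100000
set_option exponentiation.threshold 600
namespace MRD
open Cod

/-! ### representatives, grouped by invariant, with stabiliser orders -/

def reps0 : List (ℕ × List (ℕ × ℕ)) := [
  (61, [(8363604742159661753, 2), (3938362046931317503, 2)]),
  (86, [(5972979070968252259, 1)]),
  (110, [(10278661526782844436, 2)]),
  (129, [(8926570617098516206, 1), (1011571164751894432, 1)]),
  (130, [(2799004124681360055, 1), (2811598276292535291, 1)]),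
  (136, [(17568202438785645638, 1)]),
  (157, [(10949422919113868502, 1), (12973821952960761894, 1)]),
  (167, [(7237657112982056361, 2)]),
  (211, [(2551607656276675546, 1), (14342024194109197560, 1), (12769556571445431061, 1), (8890007417681512475, 1), (9201671451674716603, 1), (550840603081397947, 1)]),
  (242, [(265683262134800742, 2)]),
  (249, [(2614225452665700439, 1), (15509854498212919774, 1)]),
  (263, [(8808098667433719082, 1), (16565982488804841915, 1)]),
  (301, [(9626264420845178834, 1), (10794172219628076312, 1)]),
  (306, [(4791393736847223856, 4)]),
  (355, [(11179349815349443974, 1), (12634205947942900004, 1)]),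
  (412, [(8990784169319312024, 1), (8693675771142654011, 1)]),
  (439, [(11683542419479250970, 2), (10274710237265813887, 2)]),
  (447, [(18040387012358924433, 1), (5498642619106508283, 1)]),
  (474, [(8532160125521450712, 1), (17410077277094977084, 1), (18223533511334340051, 1), (8605131281336775649, 1), (2047386834243798064, 1), (18379535491225742523, 1), (17725683052533979013, 1), (6317022925482964035, 1)]),
  (493, [(13803101343479385242, 1)]),
  (499, [(4603830394138075033, 1), (15232403725773736126, 1)]),
  (513, [(1918345411658604316, 1), (16498633800390655959, 1)]),
  (572, [(7893605808995965587, 6), (7242546491282823827, 6), (7474345131192628356, 6), (3966251991119902850, 6)]),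
  (599, [(9324787931071031160, 1), (5252333778450214388, 1)]),
  (629, [(13607299940122339889, 1)]),
  (636, [(1069747624164101060, 1), (6635952937387828083, 1)]),
  (655, [(15290827470124479544, 1), (6032413342088447023, 2), (2009844058340027485, 2)]),
  (681, [(11105832867599201339, 204)]),
  (749, [(9504588812656693779, 1), (3953454916470600598, 1), (13055710341933247416, 1), (10229613477171362694, 1)]),
  (751, [(4496627029657666959, 1)]),
  (817, [(11607752927233275542, 1), (10043794684880522715, 1), (12675471525352476187, 1), (331551694749773817, 1)]),
  (849, [(15091523136469007842, 2), (16766105172423650127, 2)])]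

def reps1 : List (ℕ × List (ℕ × ℕ)) := [
  (869, [(13964490312097077299, 1), (17745374547458550302, 1)]),
  (921, [(17272727940942889958, 1)]),
  (938, [(9528688766496824209, 1)]),
  (947, [(17270908516146681253, 2), (7926729166744954732, 2)]),
  (955, [(2671802574246301842, 1), (14216909047192443103, 1)]),
  (979, [(10330211849805361239, 1), (12154989793758018079, 1)]),
  (1012, [(8748486964123659819, 2), (15924347399681241785, 2), (11804732859990126800, 1), (356133339677474788, 1)]),
  (1013, [(17899140633287439614, 1), (1545627186024676291, 1), (11640959464962901069, 1), (16695649855572647013, 1), (640454545609653574, 1), (2555222571942097739, 1), (10069280103480149545, 1), (499320126064043994, 1), (4082446210121440214, 1), (12575679662059723587, 1)]),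
  (1018, [(9914310928706141039, 1), (6168742373459983926, 1)]),
  (1022, [(1793754821073904927, 300)]),
  (1080, [(13616636771417555830, 1), (10053781924082741787, 1)]),
  (1127, [(16398426027893285794, 1)]),
  (1140, [(3050530815801760977, 1), (9149416890727378225, 1)]),
  (1174, [(14242419779929756705, 1)]),
  (1202, [(650217005073933745, 2), (18419273578475135526, 2), (6418786458758618778, 1), (1908595172058774504, 1)]),
  (1230, [(18007356007501677586, 1), (12055410561921868105, 1)]),
  (1249, [(3701602969124940950, 1), (11275491070696637662, 1)]),
  (1256, [(17697858692068283754, 1), (17048235146414094763, 1)]),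
  (1330, [(7468754634816412553, 1), (3905591241026984183, 1)]),
  (1355, [(6751874298910659253, 1), (10319605345678049860, 1)]),
  (1377, [(12224867416652370518, 1), (619616778413286109, 1)]),
  (1407, [(18270704710463035121, 4), (17859863948295172414, 1), (3208220714387346853, 1)]),
  (1444, [(9181222985985160808, 1)]),
  (1466, [(12779900721461656811, 1), (14649356580838810906, 1)]),
  (1512, [(9142601717648887092, 2), (3970307035323711848, 2), (16957997263326942102, 1), (6500204250167041789, 1)]),
  (1518, [(6728227820838773070, 2), (18169409182529676026, 2)]),
  (1545, [(17001630263094309010, 1), (685668426861654968, 1)]),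
  (1554, [(17937003984426348126, 2), (16971503852784100321, 2)]),
  (1574, [(15480934323850926046, 2)]),
  (1644, [(17651483366839350103, 1), (1953510187442383020, 1)]),
  (1684, [(556953266870607888, 2)]),
  (1694, [(11824767605355278991, 1), (11158177393717751688, 1)])]

def reps2 : List (ℕ × List (ℕ × ℕ)) := [
  (1733, [(15657907452644573573, 4), (3944975720915957929, 4)]),
  (1756, [(16423067295977754862, 1), (15288058831312655163, 1)]),
  (1781, [(8614410540059369711, 1), (15752743972756280755, 1)]),
  (1808, [(16304030497275222879, 1), (14464861516032128932, 1)]),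
  (1855, [(17490149378102970544, 1), (2154551465268986940, 1)]),
  (1882, [(10542000970589861502, 1), (16671070832931000042, 1)]),
  (1886, [(11034484956573239733, 1), (14160740990685814195, 1)]),
  (1942, [(9959457370937356346, 1), (15352095318442303650, 1)]),
  (1944, [(8756241957444434853, 1)]),
  (1963, [(4908099210026063298, 1), (2614735785048116144, 1)]),
  (2045, [(5937612690520166642, 1), (18399875847707000563, 1)]),
  (2064, [(4458429642431095033, 1), (11843894801920711715, 1)]),
  (2083, [(7685461422547617115, 1), (3145582864958411056, 1)]),
  (2131, [(6036983450689875734, 1)]),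
  (2140, [(12323737140587382561, 1)]),
  (2172, [(1479139219646257386, 10)]),
  (2174, [(1923906076265117994, 1)]),
  (2296, [(6728090442410140989, 1)]),
  (2443, [(15462459914537848163, 2), (4189955355797847441, 2)]),
  (2458, [(8443227598127011170, 4)]),
  (2459, [(12097981040961884536, 8)]),
  (2496, [(9682715459372545690, 1), (18240218833331611443, 1)]),
  (2497, [(17000088449108349755, 1), (5886101862569602143, 1)]),
  (2502, [(7219790026689120482, 1), (4591609319912669560, 1)]),
  (2512, [(18092154745743680455, 1), (9764255970771345186, 1), (8413693026875636680, 1), (2023638196376032630, 1), (14476497112562464462, 1), (3397257990199991190, 1)]),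
  (2558, [(146456310270113759, 1), (4541329212022295394, 1)]),
  (2603, [(2150244871079431475, 1), (10231079830299859311, 1)]),
  (2614, [(4422264611336001360, 2)]),
  (2616, [(4144398013061999269, 2)]),
  (2694, [(18001718763214183785, 1), (7551425808684348992, 1)]),
  (2695, [(3564446388340104292, 1), (17217182946595116492, 1)]),
  (2713, [(2668967316119152941, 1), (4801346323626769582, 1)])]

def reps3 : List (ℕ × List (ℕ × ℕ)) := [
  (2756, [(2777227439420939923, 2)]),
  (2760, [(15215325089914968722, 1), (17508206962390920591, 1), (2888768487261971758, 1), (11274954346897417425, 1)]),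
  (2775, [(1548442029689775396, 1), (5381769675054920478, 1)]),
  (2814, [(13435752183765152023, 2), (16535930192858428263, 2), (16818120794402096345, 1), (5448323236445985765, 1), (14442451002130638251, 1), (14878489928715434532, 1), (132655022255090500, 1), (11422472797864550868, 1), (1683685214299878026, 1), (11323476520550617711, 1), (4371682114188395333, 1), (13542770219884187066, 1)]),
  (2866, [(17686910204705695563, 1), (10371417177761475678, 1)]),
  (2920, [(8943854410499649081, 1), (13927237435740568649, 1)]),
  (2937, [(2599194674754561941, 2)]),
  (2950, [(4052839799384277950, 1), (16058901112178513057, 1)]),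
  (2996, [(15743515276196254923, 1), (13002293816805298537, 1)]),
  (3012, [(8606901517095316842, 1), (14890782201004140608, 1), (16833773032514804770, 1), (11925288757477036020, 1), (1832094641380448717, 1), (17997881742177841034, 1)]),
  (3116, [(4038438032002958055, 1), (18233473059195446436, 1)]),
  (3170, [(9483886858788560778, 1)]),
  (3314, [(1698676741948605681, 2), (17727250808173286136, 2), (18010437255917074143, 1), (14514449856983988459, 1), (16823027337133002160, 1), (8508181692189702036, 1), (12355262186719271672, 1), (7624479638620306746, 1), (11955577783464123744, 1), (12632942241152695704, 1), (14117619411651958565, 1), (1655451354596119103, 1), (7185539620324450156, 1), (13283751649938087080, 1), (3750258883814195693, 1), (2270190135881648234, 1), (14896060275838336393, 1), (9776156020535665889, 1), (13580387150608298137, 1), (5322377020120712252, 1), (9203871299606713079, 1), (15284962850071403125, 1), (6914589192794961308, 1), (4762709562051801544, 1)]),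
  (3339, [(6560071213090094121, 2)]),
  (3386, [(14022290129472898405, 1)]),
  (3446, [(1920916273069665559, 1)]),
  (3496, [(3709926746975130500, 1), (15266383855328785510, 1)]),
  (3517, [(17859212397902962995, 1), (16738223315391472979, 1)]),
  (3523, [(7162276161936414346, 1)]),
  (3550, [(15097046261987195974, 2), (14068570655348738585, 2), (1784152807093638384, 1), (849225975931528255, 1)]),
  (3567, [(16921169945828472461, 2)]),
  (3577, [(4048145028725390414, 1), (7182515267689127403, 1), (9534853517966906954, 1), (13099686277774893888, 1), (7142363222509550173, 1), (4478981471163954853, 1)]),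
  (3578, [(7974805219103436704, 1), (13816083431897439463, 1)]),
  (3612, [(217299838165316988, 180), (5493003727762749415, 180), (7157412683453980053, 12), (1963232207713947077, 12)]),
  (3616, [(5153457499306928291, 1), (10620892821494049270, 1), (6998215709031166386, 1), (6031806871746302021, 1), (8825260848535210287, 1), (2739252112037920415, 1), (15092873357913944487, 1), (10576688327081226826, 1)]),
  (3619, [(12305012339598051882, 1)]),
  (3648, [(11204013332851112254, 1)]),
  (3654, [(10102773295878020051, 1)]),
  (3709, [(9406613788286816566, 1), (11950103784075065217, 1)]),
  (3814, [(15146585197466595395, 1), (15587858696501349462, 1), (9414083264127760786, 1), (4320540189613046812, 1), (18073838776024777076, 1), (9131121008306325341, 1)]),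
  (3820, [(6382608555249226401, 1), (4905450548388792660, 1)]),
  (3846, [(18242695247391904713, 1), (11781248342416656036, 1), (11414104913165212694, 1), (947590608643088238, 1), (10523465660798412050, 1)])]

def reps4 : List (ℕ × List (ℕ × ℕ)) := [
  (3852, [(14674031457117165535, 1), (14785271960437421054, 1)]),
  (3895, [(8874414875297163076, 1), (12883167747981813867, 1)]),
  (3920, [(6019843881174425248, 2), (12503935740965477352, 2), (10836202577101384691, 1), (9162092828581177516, 1)]),
  (3969, [(4011130853193725730, 2)]),
  (4050, [(10663140227588615459, 1), (163795030628223443, 1)]),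
  (4094, [(12568898566056488054, 1), (5508252657092844222, 1)]),
  (4116, [(5368701851978199357, 1), (16229491615057321250, 1)]),
  (4128, [(8013401118905332426, 1), (9702266255954392127, 1)]),
  (4172, [(17879156849218801745, 1), (5309219056543148126, 1)]),
  (4222, [(17876071075041624099, 1), (12325559614984779433, 1), (12124433258339865845, 1), (2781277037166729268, 1), (12567802718807530190, 1), (9425384650238880016, 1)]),
  (4244, [(17570285552959613511, 1), (9912189306112279138, 1), (9656011857262850543, 1)]),
  (4296, [(13980733907184083325, 1), (3004393199469449525, 1)]),
  (4326, [(11455529401129427398, 2), (2646818615579893013, 2)]),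
  (4335, [(9320531272061489820, 18), (12632042160794531756, 36)]),
  (4352, [(17160547575437981854, 1), (16715441060704169616, 1)]),
  (4389, [(1102989716204416801, 1)]),
  (4399, [(14257019999019955219, 1), (17393920090204082328, 1)]),
  (4417, [(17963675943092577670, 2), (16558483443695573870, 2)]),
  (4420, [(2907590997869771129, 1)]),
  (4426, [(6088397928321477775, 1)]),
  (4450, [(4335758709585668229, 2)]),
  (4480, [(4867309665860906451, 2)]),
  (4484, [(2961741639387484522, 1)]),
  (4537, [(13002607645176710188, 6), (7387148797224569387, 6)]),
  (4567, [(14005734994045060528, 2), (2726675364764118616, 2)]),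
  (4580, [(8685590933067424138, 1)]),
  (4623, [(12354502945555978846, 1), (13483555961222013765, 1), (2527946066487066076, 1)]),
  (4648, [(15205694347925267392, 1), (7514179293812616730, 1), (8599829502155030248, 1), (10058008236136347239, 1), (11878832611037378603, 1), (6498569271577359146, 1)]),
  (4672, [(16919043368573062442, 2)]),
  (4681, [(1624083245068490549, 4)]),
  (4689, [(16904662355362740802, 1), (9462378068793356782, 1), (4586605371854813824, 1), (10723587615134554340, 1), (1882933515766835435, 1), (6616357817201224406, 1), (1346032197291483500, 1), (4943775172123853306, 1)]),
  (4742, [(686527179790717904, 1)])]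

def reps5 : List (ℕ × List (ℕ × ℕ)) := [
  (4765, [(14735029593944118591, 1)]),
  (4793, [(5192130767968173460, 2)]),
  (4795, [(15559089899104706874, 1), (948396845167370868, 1)]),
  (4812, [(10654635849072296231, 1), (151927311092704909, 1)]),
  (4850, [(7723964241770627873, 2), (9672218199091429986, 2), (11500893649949530039, 1), (15768480987367653788, 1)]),
  (4859, [(1491256050091182422, 1), (6993366770982660382, 1), (18424766174419816913, 1), (4474647472184686143, 1), (13337245725564014819, 1)]),
  (4985, [(6170274666797836772, 1)]),
  (4987, [(18399891923850182074, 1)]),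
  (5023, [(10010726251894335429, 6), (8704794503293457137, 6), (11731150178216916107, 6), (17382026693621151472, 6), (7286728570594340469, 3), (17283533051304765123, 3), (11870896306133716443, 3), (7364189286334442850, 3), (12598560384945429537, 3), (17808511188708845863, 3)]),
  (5062, [(16866680380377115729, 1), (1052448215686896698, 1)]),
  (5089, [(6622893093863773830, 1), (272961683912318738, 1)]),
  (5114, [(5441956302870438715, 2), (18259260394103316864, 2)]),
  (5125, [(10706723580228924390, 2), (18060584722312554965, 2)]),
  (5263, [(7633577379573283098, 1), (5283474730341834666, 1)]),
  (5278, [(13230172603784198088, 2), (14804523701201193958, 2)]),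
  (5325, [(17062970960794233395, 1), (3282855450203890744, 1), (6647898470855997605, 1), (6608010583714347991, 1), (8451758788838393705, 1), (8787723495296340047, 1), (6262128023301881020, 1), (6991204441705376715, 1), (8352492882548982118, 1)]),
  (5350, [(13601990944036069073, 2), (2190066355077194149, 2)]),
  (5363, [(17739174253236216952, 1), (7648228870117032788, 1), (9823833661251228848, 1), (17188512117180949986, 1)]),
  (5379, [(17739288708119112928, 1), (14651122805702636268, 1)]),
  (5384, [(9151618497277685411, 1), (392615686887599765, 1)]),
  (5470, [(16932256014999203356, 1), (15203194955439633338, 1), (4844519718812569052, 1)]),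
  (5506, [(14493311623161204309, 1), (8584207207356765991, 1)]),
  (5561, [(4570790833792429759, 1), (1767536191348698067, 1), (9388061657925800389, 1), (14054492584556926336, 1), (11470057524453062129, 1), (11864161620745509091, 1), (15471253236338784844, 1), (7628811115244435623, 1)]),
  (5562, [(6237993068120781661, 1), (7855292379792254916, 1)]),
  (5593, [(12577880052297413875, 1), (18434574482746989350, 1)]),
  (5613, [(8936779621453263426, 1), (7308912392054906251, 1)]),
  (5615, [(6652279313842411694, 1), (17857698003033201034, 1)]),
  (5653, [(11312850833973159659, 1)]),
  (5681, [(18204154109442646805, 1), (12912410259064419680, 1)]),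
  (5706, [(8888635772481753851, 1)]),
  (5754, [(5056896875276442832, 1)]),
  (5758, [(10890725825610981168, 1), (10681432205610210993, 1)])]

def reps6 : List (ℕ × List (ℕ × ℕ)) := [
  (5778, [(4551009251378620294, 1), (5448690526091582435, 1), (2395034194787848597, 1)]),
  (5861, [(2901826139142778619, 1), (12215052479014480935, 1)]),
  (5879, [(17659331040748077050, 1), (16647272777896158007, 1), (7793656998292824057, 1), (5754757593093654883, 1)]),
  (5917, [(11641071091551334620, 1), (7944872849840221573, 1), (8227490555374594192, 1), (16337085360034062900, 1)]),
  (5931, [(14471264694952377118, 1)]),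
  (5956, [(3876434306015977238, 5)]),
  (5969, [(689733223914909283, 1), (503956362138369868, 1), (7083514843153020574, 1), (18275450511876709788, 1), (8774432123110637624, 1)]),
  (5970, [(7727634625210519292, 1), (9705246128219138844, 1)]),
  (6091, [(5357147925888460345, 6)]),
  (6115, [(2913309793995695138, 1), (5843830700646220018, 1)]),
  (6120, [(17689738894522012915, 2), (2401624570000702949, 2)]),
  (6155, [(16788588808154936023, 1)]),
  (6156, [(16847280105534999164, 2), (13012765647463433958, 2)]),
  (6159, [(12888062903351942493, 1)]),
  (6181, [(17473678770361225015, 1), (11081382716740128791, 1), (9440881128017189585, 1), (13210183411349701930, 1), (12540398812971174524, 1), (14731630788101150268, 1), (6340479093681139780, 1), (13411074187452692036, 1), (2205364428327530293, 1), (3388391460697665103, 1), (16611970176785674880, 1), (1991850916640902818, 1), (4571757031445418689, 1), (12039082293707197837, 1)]),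
  (6249, [(11488251550506320036, 6)]),
  (6343, [(2842466628123575911, 1)]),
  (6363, [(9695447221476629620, 1), (15972024342884069009, 1)]),
  (6384, [(11654182745058175327, 1), (14032423312394777184, 1), (6695176588612137510, 1), (9830436801194673284, 1)]),
  (6395, [(14777342456099695036, 1)]),
  (6410, [(2189234144198932910, 2), (16543040050426018621, 2)]),
  (6417, [(13259084927751760245, 1), (1011213281301257211, 1), (10942653739116610203, 1), (17055418467929219021, 1), (11334210224148346000, 1), (14483501213249784113, 1), (288218438331174976, 1), (14637402058061473516, 1), (14224282958330037529, 1), (17776346870154325680, 1)]),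
  (6424, [(15653715342282338452, 6), (1829058589222139986, 6)]),
  (6436, [(10062240297066490305, 1), (404853085132323780, 1), (13655447277867628853, 1), (11188156541914060700, 1)]),
  (6469, [(5033288010928992715, 1), (6471205075069794908, 1)]),
  (6473, [(3025627293529917414, 2), (8740905914495146976, 2)]),
  (6506, [(339988344791534931, 1), (2947973054862124537, 1)]),
  (6659, [(8206594992477937430, 2), (6413045355520084560, 2), (14667717679531327869, 1), (6123726172599002944, 1)]),
  (6681, [(1267037396889627842, 1), (10308447262941114042, 1)]),
  (6755, [(16264093430092218940, 4)]),
  (6787, [(5559197033006635248, 1), (13068649395719073327, 1), (15853220458320413245, 1), (17448342817338499971, 1)]),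
  (6809, [(12427297928670381804, 1)])]

def reps7 : List (ℕ × List (ℕ × ℕ)) := [
  (6824, [(1915940391931132705, 1), (13203731171683522633, 1)]),
  (6843, [(5453762437073596437, 1), (95522977544244805, 1)]),
  (6848, [(18444488742969506511, 1)]),
  (6861, [(9032530116755336049, 1), (4051399376713777316, 1), (1816247910816641683, 1)]),
  (6928, [(3359495069441674795, 2)]),
  (7039, [(16689111725816338622, 1), (8362348616522301257, 1)]),
  (7043, [(587564917456723925, 4)]),
  (7145, [(14193192814003391132, 1), (8339955356041877343, 1)]),
  (7165, [(14575951809334955289, 1), (848548029466344041, 1)]),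
  (7217, [(10547827968742533240, 1), (8033643198731817935, 1)]),
  (7287, [(10066498064727796698, 1), (17719034854484801852, 1), (13834065642182205944, 1), (955253868986638248, 1)]),
  (7308, [(15280265783321112824, 2), (12024910054228093630, 2)]),
  (7333, [(6747828487373541097, 1)]),
  (7363, [(6600132201632082325, 1), (4767842537743356006, 1)]),
  (7415, [(5666572253830635366, 10)]),
  (7470, [(5585122633543179806, 2)]),
  (7494, [(8698006977453678265, 2), (7457355998914141115, 2)]),
  (7564, [(4330654315127686431, 1), (4196789738735375494, 1)]),
  (7571, [(11143233813628622984, 1), (17888775728753252818, 1)]),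
  (7600, [(10086142401239586615, 1), (10784445580219465949, 1)]),
  (7612, [(15472367317968198652, 1)]),
  (7626, [(8732768561694191825, 1), (15521932339832624108, 1), (12601059422535562118, 1), (2941877965325100524, 1)]),
  (7665, [(3453566839470166746, 1)]),
  (7726, [(6166461924360509741, 1), (6128552038880266019, 1)]),
  (7729, [(1263693582225227231, 1)]),
  (7784, [(9172074370867102784, 1)]),
  (7803, [(1750224382482859566, 1)]),
  (7835, [(13215122765887795263, 6), (7386277559830385387, 6)]),
  (7862, [(11294875201231465336, 4), (2905787563821606695, 4)]),
  (7863, [(18098095552287863883, 1), (1598054833197240252, 1)]),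
  (7874, [(3456298441095369421, 1)]),
  (7882, [(3313124997550346335, 1), (5066428417638350054, 2)])]

def reps8 : List (ℕ × List (ℕ × ℕ)) := [
  (7893, [(9949714767757849426, 1), (8169075109726699863, 1)]),
  (7900, [(8763490523546973347, 1)]),
  (7901, [(7668771221878055721, 1), (1463102885394393553, 1)]),
  (7928, [(15916255854804752324, 2), (369941082568374490, 2), (7756966859879363463, 1), (1532980294696974667, 1), (7665118793170277103, 1), (11324040451871506413, 1), (17752966468128433704, 1), (13588797969853392415, 1), (16051527817175884927, 1), (12578949631389145790, 1)]),
  (7929, [(186591597377697890, 1), (5498782548614588564, 1)]),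
  (7953, [(17504765018672520909, 1), (2574563276797459905, 1)]),
  (8036, [(4772550437477011032, 1)]),
  (8131, [(11196600781007879404, 8)]),
  (8164, [(13329891193173287977, 1), (15384076337458302190, 1), (6441689223828293423, 1), (13736426719478958249, 1)]),
  (8165, [(6514777965913514578, 1), (9361545696648042417, 1), (4995732508938715610, 1), (5878400761651840910, 1), (14133963845795089763, 1)]),
  (8183, [(18090230779222871643, 1), (15412686643506285424, 1)]),
  (8187, [(12432536397861387868, 3), (9858017929541346949, 3)]),
  (8246, [(5277311248240271656, 1), (404862231686462171, 1), (9378677549327417771, 1), (10059156432204322876, 1)]),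
  (8346, [(15432444543156970876, 1)]),
  (8389, [(13180743598413638780, 2)]),
  (8401, [(18056448722419416545, 1), (979786329460294045, 1), (18322187262963166306, 1), (8398297349486540584, 1)]),
  (8409, [(10482600715643547996, 1)]),
  (8428, [(15903497337584144687, 1), (10577872589541792568, 1)]),
  (8463, [(9967435463041059098, 1), (3964304663688925494, 1)]),
  (8482, [(10841399792348704433, 1), (6892052773410534552, 1), (12926458951311386758, 1), (15274596331429133552, 1)]),
  (8485, [(7085832711154218716, 1), (17241285467373009283, 1)]),
  (8534, [(16333530383483579156, 1), (2644161675422462346, 1)]),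
  (8564, [(17776771612133644615, 1)]),
  (8573, [(17685026647623253660, 1)]),
  (8632, [(7934721524668475166, 2)]),
  (8664, [(2502206611712387437, 1), (13308960115018622934, 1), (15887261915814643222, 1), (12600358966007854238, 1), (10578505392291071678, 1), (14738257614418396117, 1), (8933165175179598511, 1), (7764706737077124660, 1)]),
  (8684, [(5926154738375791981, 1)]),
  (8719, [(12516205035176738898, 1), (8431216554283130527, 1)]),
  (8746, [(8146509374991967639, 1), (1652019597053517419, 1)]),
  (8771, [(7972782629702212912, 1), (18077328866127049038, 1), (2133548754110401937, 1)]),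
  (8784, [(5162756148769044179, 1), (9406761167201589400, 1)]),
  (8790, [(7504952124840906525, 1)])]

def reps9 : List (ℕ × List (ℕ × ℕ)) := [
  (8808, [(13007869684749867553, 1)]),
  (8922, [(392591482936791480, 1)]),
  (8959, [(2882124811594540589, 30)]),
  (8994, [(17061363101062395521, 2)]),
  (8999, [(16470673457976980852, 1), (14190105666165708015, 1)]),
  (9023, [(701787410991522031, 2), (1685263577970801793, 2)]),
  (9033, [(14146855400865649729, 1), (4593067261626219098, 3)]),
  (9048, [(2660886827504217745, 1), (7446043392354920250, 1)]),
  (9059, [(12580986505754986015, 2), (8320681740438638720, 2)]),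
  (9077, [(11721452447419621338, 1)]),
  (9110, [(3966042381042658448, 1), (14896320755582660816, 1)]),
  (9135, [(6582465715976754491, 2), (14893892382241749498, 2)]),
  (9170, [(1608903220120120653, 1)]),
  (9208, [(13477526033979218823, 2)]),
  (9251, [(2303366210360425951, 1), (11191130893574983440, 1), (4514800227556230598, 1), (16031362181655720842, 1), (18016338827837043026, 1), (6997683192938831764, 1), (9097864532547524759, 1), (17905581609498804156, 1), (15504857804617265174, 1), (11030058878516510406, 1)]),
  (9256, [(212154194975867613, 1), (8209303900000061586, 1)]),
  (9284, [(9305011078094983611, 1), (4985852815562262619, 1), (11634112838643358926, 1), (7366144318342785234, 1)]),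
  (9293, [(17625359188836871664, 1), (13963009288940090257, 1)]),
  (9303, [(956775634365217276, 1)]),
  (9352, [(15913612064875346536, 1), (14275915506616231497, 1)]),
  (9379, [(6247452509330029675, 1)]),
  (9464, [(15895089813682033548, 2)]),
  (9629, [(1955879212460856032, 2), (10851861364199794553, 2)]),
  (9649, [(1949018517777649804, 1), (16753975885296455633, 1)]),
  (9654, [(8283574815980484483, 1), (9437309330269411676, 1)]),
  (9710, [(2493055362248523586, 1), (15142537534609585698, 1)]),
  (9735, [(7435948825671524277, 1), (3947941716977957271, 1)]),
  (9771, [(6209200690858179091, 30)]),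
  (9787, [(10144154359304563839, 2), (17899384276574908478, 2)]),
  (9816, [(6637715751863064167, 2)]),
  (9909, [(17914410156405235126, 1)]),
  (9912, [(12324671461023798914, 1), (16016757137655904844, 1)])]

def reps : List (ℕ × List (ℕ × ℕ)) :=
  reps0 ++ (reps1 ++ (reps2 ++ (reps3 ++ (reps4 ++ (reps5 ++ (reps6 ++ (reps7 ++ (reps8 ++ (reps9)))))))))

theorem reps_chunks : okAll reps0 = true ∧ okAll reps1 = true ∧ okAll reps2 = true ∧ okAll reps3 = true ∧ okAll reps4 = true ∧ okAll reps5 = true ∧ okAll reps6 = true ∧ okAll reps7 = true ∧ okAll reps8 = true ∧ okAll reps9 = true := by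
  refine ⟨?_, ?_, ?_, ?_, ?_, ?_, ?_, ?_, ?_, ?_⟩
  all_goals decide +kernel

theorem reps_ok : ∀ g ∈ reps, okGroup g.1 g.2 = true := by
  obtain ⟨h0, h1, h2, h3, h4, h5, h6, h7, h8, h9⟩ := reps_chunks
  intro g hg
  unfold reps at hg
  simp only [List.mem_append] at hg
  rcases hg with hg | hg | hg | hg | hg | hg | hg | hg | hg | hg
  · exact okAll_of h0 g hg
  · exact okAll_of h1 g hg
  · exact okAll_of h2 g hg
  · exact okAll_of h3 g hg
  · exact okAll_of h4 g hg
  · exact okAll_of h5 g hg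
  · exact okAll_of h6 g hg
  · exact okAll_of h7 g hg
  · exact okAll_of h8 g hg
  · exact okAll_of h9 g hg

theorem reps_incr : incr reps 0 = true := by decide +kernel
theorem reps_key0 : ∀ g ∈ reps, g.1 = 681 → ∀ p ∈ g.2, p.1 = 11105832867599201339 := by decide +kernel
theorem reps_pair0 : okPair 11105832867599201339 10107805001817530384 = true := by decide +kernel
theorem reps_len : (reps.flatMap (fun g => g.2)).length = 756 := by decide +kernel
theorem reps_sum : ((reps.flatMap (fun g => g.2)).map (fun p => 998784000 / p.2)).sum = 665842030080 := by
  decide +kernel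
theorem f0_cl : cl (CB 10107805001817530384) 0 = 1 := by decide +kernel
theorem f0_key : keyN (HB (CB 10107805001817530384)) = 681 := by decide +kernel

theorem reps_pair : ∀ g ∈ reps, g.1 = 681 → ∀ p ∈ g.2, okPair p.1 10107805001817530384 = true := by
  intro g hg h p hp
  rw [reps_key0 g hg h p hp]
  exact reps_pair0

theorem card_classes : Nat.card (Quotient (Setoid.mk _ mrd_equivalence)) = 757 :=
  assemble reps 10107805001817530384 681 reps_ok reps_incr f0_cl f0_key f0_orbit reps_pair reps_len reps_sum

end MRD

/-- `~` is an equivalence relation on `S`, and the number of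
equivalence classes of `S` under `~` is exactly `757`.  Equivalently: the number of
isotopy classes of finite semifields of order `2⁸` with right nucleus containing
`F_{2⁴}`, i.e. of equivalence classes of MRD codes in `M₂(F_{2⁴})` with minimum
distance `2`, is `757`. -/
theorem card_mrd_classes_eq_757 :
    ∃ h : Equivalence (fun C C' : mrdSet => mrdEquiv C.1 C'.1),
      Nat.card (Quotient (Setoid.mk (fun C C' : mrdSet => mrdEquiv C.1 C'.1) h)) = 757 := by
  exact ⟨MRD.mrd_equivalence, MRD.card_classes⟩
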